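/- arXiv:1804.06036 — 4 statements merged into one kernel-verified Lean document; each statement's English description precedes it below -/
import Mathlib

section
/- Let G be a semicubic simple graph with at least one pendent vertex, and suppose that the graph obtained from G by deleting all pendent vertices of G is a single vertex (K_1) or is 2-connected. Let L be an incidence 6-list assignment of G. Then every pendent edge of G is freely L-choosable. -/
/-- `(v, e)` is an incidence of the simple graph `G` when `e` is an edge of `G` and `v` is an
endpoint of `e`. -/
def IsIncidence {V : Type*} (G : SimpleGraph V) (v : V) (e : Sym2 V) : Prop :=
  e ∈ G.edgeSet ∧ v ∈ e

/-- Two incidences `(v, e)` and `(w, f)` are adjacent if `v = w`, or `e = f`, or the edge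
joining `v` and `w` is `e` or `f`. -/
def IncAdj {V : Type*} (v : V) (e : Sym2 V) (w : V) (f : Sym2 V) : Prop :=
  v = w ∨ e = f ∨ s(v, w) = e ∨ s(v, w) = f

/-- `φ` is an incidence coloring of `G` choosing colors from the list assignment `L`. -/
def IsIncListColoring {V : Type*} (G : SimpleGraph V) (L : V × Sym2 V → Finset ℕ)
    (φ : V × Sym2 V → ℕ) : Prop :=
  (∀ v e, IsIncidence G v e → φ (v, e) ∈ L (v, e)) ∧
  (∀ v e w f, IsIncidence G v e → IsIncidence G w f → (v, e) ≠ (w, f) → IncAdj v e w f →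
    φ (v, e) ≠ φ (w, f))

/-- `G` is incidence `k`-choosable: for every assignment of lists of `k` colors to the
incidences of `G` there is an incidence coloring choosing colors from the lists. -/
def IncChoosable {V : Type*} (G : SimpleGraph V) (k : ℕ) : Prop :=
  ∀ L : V × Sym2 V → Finset ℕ, (∀ v e, IsIncidence G v e → (L (v, e)).card = k) →
    ∃ φ, IsIncListColoring G L φ

/-- The incidence choice number of `G`: the least `k` such that `G` is incidence
`k`-choosable. -/
noncomputable def incChoiceNumber {V : Type*} (G : SimpleGraph V) : ℕ :=
  sInf {k | IncChoosable G k}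

/-- The degree of a vertex of a simple graph (number of neighbors). -/
noncomputable def vdeg {V : Type*} (G : SimpleGraph V) (v : V) : ℕ :=
  (G.neighborSet v).ncard

/-- A graph is 2-connected if it has at least 3 vertices, is connected, and deleting any
single vertex leaves it connected. -/
def TwoConnected {W : Type*} (H : SimpleGraph W) : Prop :=
  H.Connected ∧ 3 ≤ Nat.card W ∧ ∀ w : W, (H.induce {x | x ≠ w}).Connected

/-- The edge `uv` is freely `L`-choosable: for any two distinct colors `c₁ ∈ L(u, uv)` and
`c₂ ∈ L(v, uv)` there is an incidence `L`-coloring of `G` assigning `c₁` to `(u, uv)` and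
`c₂` to `(v, uv)`. -/
def FreelyLChoosable {V : Type*} (G : SimpleGraph V) (L : V × Sym2 V → Finset ℕ)
    (u v : V) : Prop :=
  ∀ c₁ ∈ L (u, s(u, v)), ∀ c₂ ∈ L (v, s(u, v)), c₁ ≠ c₂ →
    ∃ φ, IsIncListColoring G L φ ∧ φ (u, s(u, v)) = c₁ ∧ φ (v, s(u, v)) = c₂

def Deg013 {V : Type*} (G : SimpleGraph V) : Prop :=
  ∀ v, (∀ w, ¬ G.Adj v w) ∨ (∃ a, ∀ w, G.Adj v w ↔ w = a) ∨
    (∃ a b c, a ≠ b ∧ a ≠ c ∧ b ≠ c ∧ ∀ w, G.Adj v w ↔ (w = a ∨ w = b ∨ w = c))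

structure Col {V : Type*} (G : SimpleGraph V) (L : V → V → Finset ℕ) (ψ : V → V → ℕ) : Prop where
  mem : ∀ v w, G.Adj v w → ψ v w ∈ L v w
  out : ∀ v w w', G.Adj v w → G.Adj v w' → w ≠ w' → ψ v w ≠ ψ v w'
  thr : ∀ v w y, G.Adj v w → G.Adj v y → ψ w v ≠ ψ v y

def ExtP {V : Type*} (G : SimpleGraph V) : Prop :=
  ∀ L : V → V → Finset ℕ, (∀ v w, 6 ≤ (L v w).card) →
    (∃ ψ, Col G L ψ) ∧ ∀ u p, G.Adj u p → (∀ z, G.Adj p z → z = u) →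
      ∀ c₁ ∈ L u p, ∀ c₂ ∈ L p u, c₁ ≠ c₂ → ∃ ψ, Col G L ψ ∧ ψ u p = c₁ ∧ ψ p u = c₂

lemma pick_avoid (A B : Finset ℕ) (h : B.card < A.card) : ∃ x ∈ A, x ∉ B :=
  Finset.exists_mem_notMem_of_card_lt_card h

lemma pick1 (A : Finset ℕ) (h : 2 ≤ A.card) (x : ℕ) : ∃ y ∈ A, y ≠ x := by
  obtain ⟨y, hy, h'⟩ := pick_avoid A {x} (by simp; omega)
  exact ⟨y, hy, by simpa using h'⟩

lemma pick2 (A : Finset ℕ) (h : 3 ≤ A.card) (x z : ℕ) : ∃ y ∈ A, y ≠ x ∧ y ≠ z := by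
  obtain ⟨y, hy, h'⟩ := pick_avoid A {x, z} (lt_of_le_of_lt Finset.card_le_two (by omega))
  exact ⟨y, hy, by simpa using h'⟩

lemma pick3 (A : Finset ℕ) (h : 4 ≤ A.card) (x z t : ℕ) : ∃ y ∈ A, y ≠ x ∧ y ≠ z ∧ y ≠ t := by
  obtain ⟨y, hy, h'⟩ := pick_avoid A {x, z, t} (lt_of_le_of_lt Finset.card_le_three (by omega))
  exact ⟨y, hy, by simpa using h'⟩

/-- greedy colouring of the square of a ray -/
lemma ray (M : ℕ → Finset ℕ) (hM : ∀ i, 2 ≤ i → 3 ≤ (M i).card) (x y : ℕ) (hx : x ∈ M 0)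
    (hy : y ∈ M 1) (hxy : x ≠ y) :
    ∃ f : ℕ → ℕ, f 0 = x ∧ f 1 = y ∧ (∀ i, f i ∈ M i) ∧ (∀ i, f i ≠ f (i+1)) ∧
      (∀ i, f i ≠ f (i+2)) := by
  have hp : ∀ i x z, ∃ y, 2 ≤ i → y ∈ M i ∧ y ≠ x ∧ y ≠ z := by
    intro i x z
    by_cases hi : 2 ≤ i
    · obtain ⟨y, h1, h2⟩ := pick2 _ (hM i hi) x z
      exact ⟨y, fun _ => ⟨h1, h2⟩⟩
    · exact ⟨0, fun h => absurd h hi⟩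
  choose nx hnx using hp
  let g : ℕ → ℕ × ℕ := fun n => Nat.rec (x, y) (fun n q => (q.2, nx (n+2) q.1 q.2)) n
  have g0 : g 0 = (x, y) := rfl
  have gs : ∀ n, g (n+1) = ((g n).2, nx (n+2) (g n).1 (g n).2) := fun n => rfl
  have e1 : ∀ n, (g (n+1)).1 = (g n).2 := fun n => by rw [gs]
  have e2 : ∀ n, (g (n+2)).1 = nx (n+2) (g n).1 (g n).2 := fun n => (e1 (n+1)).trans (by rw [gs])
  refine ⟨fun n => (g n).1, by simp [g0], by simp [e1, g0], ?_, ?_, ?_⟩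
  · intro i
    match i with
    | 0 => simpa [g0] using hx
    | 1 => simpa [e1, g0] using hy
    | i+2 =>
      simp only [e2]
      exact (hnx _ _ _ (by omega)).1
  · intro i
    match i with
    | 0 => simpa [e1, g0] using hxy
    | i+1 =>
      simp only [e2]
      rw [e1]
      exact (hnx (i+2) (g i).1 (g i).2 (by omega)).2.2.symm
  · intro i
    simp only [e2]
    exact (hnx (i+2) (g i).1 (g i).2 (by omega)).2.1.symm

lemma cyc_sq (n : ℕ) (hn : 4 ≤ n) (M : ℕ → Finset ℕ) (h0 : 4 ≤ (M 0).card) (h1 : 4 ≤ (M 1).card)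
    (β : ℕ) (hβ1 : β ∈ M 1) (hβ0 : β ∉ M 0) (hM : ∀ i, 2 ≤ i → i < n → 3 ≤ (M i).card) :
    ∃ f : ℕ → ℕ, (∀ i < n, f i ∈ M i) ∧ (∀ i, i + 1 < n → f i ≠ f (i+1)) ∧
      (∀ i, i + 2 < n → f i ≠ f (i+2)) ∧ f (n-1) ≠ f 0 ∧ f (n-1) ≠ f 1 ∧ f (n-2) ≠ f 0 := by
  obtain ⟨y, hy, hyβ⟩ := pick1 (M 3) (by have := hM 3 (by omega) (by omega); omega) β
  obtain ⟨x, hx, hxβ, hxy⟩ := pick2 (M 2) (hM 2 (by omega) (by omega)) β y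
  let N : ℕ → Finset ℕ := fun i => if i + 2 < n then M (i+2) else {0,1,2}
  obtain ⟨g, g0, g1, gm, ga, gb⟩ := ray N (by
    intro i hi
    by_cases h : i + 2 < n
    · simp only [N, h, if_true]; exact hM _ (by omega) h
    · simp [N, h]) x y (by simp only [N]; rw [if_pos (by omega)]; exact hx)
      (by simp only [N]; rw [if_pos (by omega)]; exact hy) hxy
  have key : ∃ q0 ∈ M 0, ∃ q1 ∈ M 1, q0 ≠ q1 ∧ q0 ≠ x ∧ q0 ≠ g (n-3) ∧ q0 ≠ g (n-4) ∧
      q1 ≠ x ∧ q1 ≠ y ∧ q1 ≠ g (n-3) := by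
    by_cases hc : g (n-3) = β
    · obtain ⟨q1, m1, d1, d2, d3⟩ := pick3 (M 1) h1 x y (g (n-3))
      obtain ⟨q0, m0, e1, e2, e3⟩ := pick3 (M 0) h0 q1 x (g (n-4))
      exact ⟨q0, m0, q1, m1, e1, e2, fun h => hβ0 (by rw [← hc, ← h]; exact m0), e3, d1, d2, d3⟩
    · obtain ⟨q0, m0, e1, e2, e3⟩ := pick3 (M 0) h0 x (g (n-3)) (g (n-4))
      exact ⟨q0, m0, β, hβ1, fun h => hβ0 (h ▸ m0), e1, e2, e3, hxβ.symm, hyβ.symm,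
        fun h => hc h.symm⟩
  obtain ⟨q0, m0, q1, m1, k1, k2, k3, k4, k5, k6, k7⟩ := key
  let f : ℕ → ℕ := fun i => if i = 0 then q0 else if i = 1 then q1 else g (i-2)
  have f0 : f 0 = q0 := rfl
  have f1 : f 1 = q1 := rfl
  have f2 : ∀ i, f (i+2) = g i := fun i => by simp [f]
  have fn1 : f (n-1) = g (n-3) := by rw [← f2]; congr 1; omega
  have fn2 : f (n-2) = g (n-4) := by rw [← f2]; congr 1; omega
  refine ⟨f, ?_, ?_, ?_, ?_, ?_, ?_⟩
  · intro i hi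
    match i with
    | 0 => exact m0
    | 1 => exact m1
    | i+2 => rw [f2]; have := gm i; simp only [N, hi, if_true] at this; exact this
  · intro i hi
    match i with
    | 0 => exact k1
    | 1 => rw [f1, f2 0, g0]; exact k5
    | i+2 => rw [f2, show i+2+1 = (i+1)+2 by ring, f2]; exact ga i
  · intro i hi
    match i with
    | 0 => rw [f0, f2 0, g0]; exact k2
    | 1 => rw [f1, f2 1, g1]; exact k6
    | i+2 => rw [f2, f2]; exact gb i
  · rw [fn1, f0]; exact k3.symm
  · rw [fn1, f1]; exact k7.symm
  · rw [fn2, f0]; exact k4.symm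

lemma cyc_ab (k : ℕ) [NeZero k] (hk : 3 ≤ k) (A B : Fin k → Finset ℕ) (h0 : 4 ≤ (A 0).card)
    (h1 : 4 ≤ (B 0).card) (β : ℕ) (hβ1 : β ∈ B 0) (hβ0 : β ∉ A 0)
    (hA : ∀ i, 3 ≤ (A i).card) (hB : ∀ i, 3 ≤ (B i).card) :
    ∃ a b : Fin k → ℕ, (∀ i, a i ∈ A i) ∧ (∀ i, b i ∈ B i) ∧ (∀ i, a i ≠ b i) ∧
      (∀ i, a i ≠ a (i+1)) ∧ (∀ i, b i ≠ b (i+1)) ∧ (∀ i, b i ≠ a (i+1)) := by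
  let M : ℕ → Finset ℕ := fun j => if j % 2 = 0 then A (Fin.ofNat k (j/2)) else B (Fin.ofNat k (j/2))
  have Me : ∀ i : Fin k, M (2 * i.val) = A i := by
    intro i; simp [M]
  have Mo : ∀ i : Fin k, M (2 * i.val + 1) = B i := by
    intro i
    have : (2 * i.val + 1) / 2 = i.val := by omega
    simp [M, this]
  obtain ⟨f, fm, f1, f2, f3, f4, f5⟩ := cyc_sq (2*k) (by omega) M (by have := Me 0; simp at this; rwa [this])
    (by have := Mo 0; simp at this; rwa [this]) β (by have := Mo 0; simp at this; rwa [this])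
    (by have := Me 0; simp at this; rwa [this]) (by
      intro i _ _; simp only [M]; split_ifs; exacts [hA _, hB _])
  have hs : ∀ i : Fin k, ((i+1 : Fin k).val = i.val + 1 ∧ i.val + 1 < k) ∨
      (i.val + 1 = k ∧ (i+1 : Fin k).val = 0) := by
    intro i
    have h1 : (1 : Fin k).val = 1 := by
      rw [Fin.val_one']; exact Nat.mod_eq_of_lt (by omega)
    have := i.isLt
    rw [Fin.val_add, h1]
    by_cases h : i.val + 1 < k
    · left; exact ⟨Nat.mod_eq_of_lt h, h⟩
    · right
      have : i.val + 1 = k := by omega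
      exact ⟨this, by rw [this]; simp⟩
  refine ⟨fun i => f (2 * i.val), fun i => f (2*i.val+1), ?_, ?_, ?_, ?_, ?_, ?_⟩
  · intro i; rw [← Me]; exact fm _ (by omega)
  · intro i; rw [← Mo]; exact fm _ (by omega)
  · intro i; exact f1 _ (by omega)
  · intro i
    rcases hs i with ⟨h, h'⟩ | ⟨h, h'⟩
    · simp only [h]; exact f2 _ (by omega)
    · simp only [h']; rw [show 2 * i.val = 2*k-2 by omega]; exact f5
  · intro i
    rcases hs i with ⟨h, h'⟩ | ⟨h, h'⟩
    · simp only [h]; exact f2 _ (by omega)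
    · simp only [h']; rw [show 2 * i.val +1 = 2*k-1 by omega]; exact f4
  · intro i
    rcases hs i with ⟨h, h'⟩ | ⟨h, h'⟩
    · simp only [h]; exact f1 _ (by omega)
    · simp only [h']; rw [show 2 * i.val +1 = 2*k-1 by omega]; exact f3

/-- choice of the colours on the second spoke -/
lemma choose_spoke (La Lb Ls Lt : Finset ℕ) (ha : 6 ≤ La.card) (hb : 6 ≤ Lb.card)
    (hs : 6 ≤ Ls.card) (ht : 6 ≤ Lt.card) (s0 t0 : ℕ) :
    ∃ s ∈ Ls, ∃ t ∈ Lt, s ≠ t ∧ ∃ A ⊆ La \ {s0, t0, s}, ∃ B ⊆ Lb \ {s0, s, t}, ∃ β ∈ B,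
      β ∉ A ∧ 4 ≤ A.card ∧ 4 ≤ B.card := by
  obtain ⟨A, hA, cA⟩ := Finset.exists_subset_card_eq (s := La \ {s0, t0}) (n := 4) (by
    have := Finset.le_card_sdiff {s0, t0} La
    have : ({s0, t0} : Finset ℕ).card ≤ 2 := Finset.card_le_two
    omega)
  obtain ⟨B, hB, cB⟩ := Finset.exists_subset_card_eq (s := Lb \ {s0}) (n := 5) (by
    have := Finset.le_card_sdiff {s0} Lb
    have : ({s0} : Finset ℕ).card = 1 := Finset.card_singleton _
    omega)
  obtain ⟨β, hβ, hβA⟩ := pick_avoid B A (by omega)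
  obtain ⟨s, hsL, hsA⟩ := pick_avoid Ls (insert β A) (by
    have := Finset.card_insert_le β A; omega)
  have hsA' : s ≠ β ∧ s ∉ A := by simpa using hsA
  have hA' : A ⊆ La \ {s0, t0, s} := by
    intro z hz
    have := hA hz
    simp only [Finset.mem_sdiff, Finset.mem_insert, Finset.mem_singleton, not_or] at this ⊢
    exact ⟨this.1, this.2.1, this.2.2, fun h => hsA'.2 (h ▸ hz)⟩
  have hBs : ∀ t, B \ {s, t} ⊆ Lb \ {s0, s, t} := by
    intro t z hz
    simp only [Finset.mem_sdiff, Finset.mem_insert, Finset.mem_singleton, not_or] at hz ⊢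
    have := hB hz.1
    simp only [Finset.mem_sdiff, Finset.mem_singleton] at this
    exact ⟨this.1, this.2, hz.2.1, hz.2.2⟩
  by_cases hsB : s ∈ B
  · obtain ⟨t, htL, htB⟩ := pick_avoid Lt B (by omega)
    refine ⟨s, hsL, t, htL, fun h => htB (h ▸ hsB), A, hA', B \ {s, t}, hBs t, β, ?_, hβA, by omega, ?_⟩
    · simp only [Finset.mem_sdiff, Finset.mem_insert, Finset.mem_singleton, not_or]
      exact ⟨hβ, hsA'.1.symm, fun h => htB (h ▸ hβ)⟩
    · have : B.erase s ⊆ B \ {s, t} := by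
        intro z hz
        simp only [Finset.mem_erase] at hz
        simp only [Finset.mem_sdiff, Finset.mem_insert, Finset.mem_singleton, not_or]
        exact ⟨hz.2, hz.1, fun h => htB (h ▸ hz.2)⟩
      have := Finset.card_le_card this
      rw [Finset.card_erase_of_mem hsB] at this
      omega
  · obtain ⟨t, htL, hts, htβ⟩ := pick2 Lt (by omega) s β
    refine ⟨s, hsL, t, htL, hts.symm, A, hA', B \ {s, t}, hBs t, β, ?_, hβA, by omega, ?_⟩
    · simp only [Finset.mem_sdiff, Finset.mem_insert, Finset.mem_singleton, not_or]
      exact ⟨hβ, hsA'.1.symm, htβ.symm⟩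
    · have : B.erase t ⊆ B \ {s, t} := by
        intro z hz
        simp only [Finset.mem_erase] at hz
        simp only [Finset.mem_sdiff, Finset.mem_insert, Finset.mem_singleton, not_or]
        exact ⟨hz.2, fun h => hsB (h ▸ hz.2), hz.1⟩
      have := Finset.card_le_card this
      have := Finset.pred_card_le_card_erase (s := B) (a := t)
      omega

lemma deg3_of_two {V : Type*} {G : SimpleGraph V} (D : Deg013 G) {x y z : V} (h1 : G.Adj x y)
    (h2 : G.Adj x z) (hyz : y ≠ z) :
    ∃ w, w ≠ y ∧ w ≠ z ∧ ∀ t, G.Adj x t ↔ (t = y ∨ t = z ∨ t = w) := by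
  rcases D x with h | ⟨a, h⟩ | ⟨a, b, c, hab, hac, hbc, h⟩
  · exact absurd h1 (h y)
  · exact absurd (((h y).1 h1).trans ((h z).1 h2).symm) hyz
  · have hy := (h y).1 h1
    have hz := (h z).1 h2
    rcases hy with rfl | rfl | rfl <;> rcases hz with rfl | rfl | rfl <;>
      first
      | exact absurd rfl hyz
      | exact ⟨a, by tauto, by tauto, fun t => by rw [h]; tauto⟩
      | exact ⟨b, by tauto, by tauto, fun t => by rw [h]; tauto⟩
      | exact ⟨c, by tauto, by tauto, fun t => by rw [h]; tauto⟩
      | exact ⟨_, hac.symm, hbc.symm, fun t => by rw [h]⟩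

lemma card_sdiff3 (A : Finset ℕ) (h : 6 ≤ A.card) (x y z : ℕ) : 3 ≤ (A \ {x, y, z}).card := by
  have := Finset.le_card_sdiff {x, y, z} A
  have : ({x, y, z} : Finset ℕ).card ≤ 3 := Finset.card_le_three
  omega

set_option maxHeartbeats 4000000 in
lemma cyc_extend {V : Type*} (G : SimpleGraph V) (D : Deg013 G)
    (IH : ∀ G' < G, Deg013 G' → ExtP G')
    (L : V → V → Finset ℕ) (hL : ∀ v w, 6 ≤ (L v w).card)
    (k : ℕ) [NeZero k] (hk : 3 ≤ k) (v : Fin k → V) (inj : Function.Injective v)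
    (adj : ∀ i, G.Adj (v i) (v (i+1))) (w0 : V) (hw0 : G.Adj (v 0) w0)
    (hne1 : w0 ≠ v 1) (hne2 : w0 ≠ v (-1))
    (hw0' : (∃ i, v i = w0) ∨ ∀ z, G.Adj w0 z → z = v 0)
    (c₁ c₂ : ℕ) (hc₁ : c₁ ∈ L (v 0) w0) (hc₂ : c₂ ∈ L w0 (v 0)) (hc : c₁ ≠ c₂) :
    ∃ ψ, Col G L ψ ∧ ψ (v 0) w0 = c₁ ∧ ψ w0 (v 0) = c₂ := by
  classical
  have h1v : (1 : Fin k).val = 1 := by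
    rw [Fin.val_one']; exact Nat.mod_eq_of_lt (by omega)
  have one_ne : (1 : Fin k) ≠ 0 := by
    intro h; have := congrArg Fin.val h; simp at this; omega
  have two_ne : (1 : Fin k) + 1 ≠ 0 := by
    intro h; have := congrArg Fin.val h
    rw [Fin.val_add, h1v, Nat.mod_eq_of_lt (by omega)] at this
    simp at this
  have pm : ∀ i : Fin k, v (i+1) ≠ v (i-1) := by
    intro i h
    have h := inj h
    apply two_ne
    have h3 : i + 1 - (i - 1) = 0 := by rw [h]; simp
    rw [← h3]; abel
  have adj' : ∀ i, G.Adj (v i) (v (i-1)) := by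
    intro i; have := adj (i-1); rw [sub_add_cancel] at this; exact this.symm
  have hw : ∀ i, ∃ w, w ≠ v (i+1) ∧ w ≠ v (i-1) ∧
      (∀ t, G.Adj (v i) t ↔ (t = v (i+1) ∨ t = v (i-1) ∨ t = w)) :=
    fun i => deg3_of_two D (adj i) (adj' i) (pm i)
  choose w hwa hwb hN using hw
  have hw00 : w 0 = w0 := by
    have := (hN 0 w0).1 hw0
    simp only [zero_add, zero_sub] at this
    rcases this with h | h | h
    exacts [absurd h hne1, absurd h hne2, h.symm]
  have hAw : ∀ i, G.Adj (v i) (w i) := fun i => (hN i _).2 (Or.inr (Or.inr rfl))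
  -- cycle edges
  let CE : V → V → Prop := fun x y => ∃ i, (x = v i ∧ y = v (i+1)) ∨ (y = v i ∧ x = v (i+1))
  have CEs : ∀ x y, CE x y → CE y x := by
    rintro x y ⟨i, h | h⟩
    · exact ⟨i, Or.inr h⟩
    · exact ⟨i, Or.inl h⟩
  have CEv : ∀ i y, CE (v i) y ↔ y = v (i+1) ∨ y = v (i-1) := by
    intro i y
    constructor
    · rintro ⟨j, ⟨h, h'⟩ | ⟨h, h'⟩⟩
      · left; rw [inj h]; exact h'
      · right; rw [inj h', h]; congr 1; abel
    · rintro (h | h)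
      · exact ⟨i, Or.inl ⟨rfl, h⟩⟩
      · exact ⟨i-1, Or.inr ⟨h, by congr 1; abel⟩⟩
  have CEw : ∀ i, ¬ CE (v i) (w i) := by
    intro i; rw [CEv]; exact fun h => h.elim (hwa i) (hwb i)
  have CEo : ∀ x, (∀ i, x ≠ v i) → ∀ y, ¬ CE x y := by
    rintro x hx y ⟨i, ⟨h, _⟩ | ⟨_, h⟩⟩
    · exact hx _ h
    · exact hx _ h
  let G' : SimpleGraph V :=
    { Adj := fun x y => G.Adj x y ∧ ¬ CE x y ∧ ¬ (x = v 0 ∧ y = w0) ∧ ¬ (x = w0 ∧ y = v 0)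
      symm := ⟨by
        rintro x y ⟨h1, h2, h3, h4⟩
        exact ⟨h1.symm, fun h => h2 (CEs _ _ h), fun h => h4 ⟨h.2, h.1⟩, fun h => h3 ⟨h.2, h.1⟩⟩⟩
      loopless := ⟨fun x h => G.loopless.irrefl x h.1⟩ }
  have hG' : ∀ x y, G'.Adj x y ↔ (G.Adj x y ∧ ¬ CE x y ∧ ¬ (x = v 0 ∧ y = w0) ∧ ¬ (x = w0 ∧ y = v 0)) :=
    fun x y => Iff.rfl
  have lt : G' < G := by
    refine lt_of_le_of_ne (fun x y h => h.1) ?_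
    intro h
    have : G'.Adj (v 0) w0 := h ▸ hw0
    exact this.2.2.1 ⟨rfl, rfl⟩
  have w0only : ∀ z, ¬ G'.Adj w0 z := by
    rintro z ⟨h1, h2, h3, h4⟩
    rcases hw0' with ⟨i, hi⟩ | h
    · subst hi
      have h0 := (hN i _).1 hw0.symm
      have hcz : ¬ (z = v (i+1) ∨ z = v (i-1)) := by rwa [← CEv]
      have hc0 : ¬ (v 0 = v (i+1) ∨ v 0 = v (i-1)) := by
        rw [← CEv]; intro h; exact CEw 0 (by rw [hw00]; exact CEs _ _ h)
      have hz := (hN i _).1 h1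
      have : z = v 0 := by
        have e1 : z = w i := by
          rcases hz with h | h | h
          exacts [absurd (Or.inl h) hcz, absurd (Or.inr h) hcz, h]
        have e2 : v 0 = w i := by
          rcases h0 with h | h | h
          exacts [absurd (Or.inl h) hc0, absurd (Or.inr h) hc0, h]
        rw [e1, e2]
      exact h4 ⟨rfl, this⟩
    · exact h4 ⟨rfl, h z h1⟩
  have v0only : ∀ z, ¬ G'.Adj (v 0) z := by
    rintro z ⟨h1, h2, h3, h4⟩
    rw [CEv] at h2
    have := (hN 0 _).1 h1
    rw [hw00] at this
    rcases this with h | h | h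
    exacts [h2 (Or.inl h), h2 (Or.inr h), h3 ⟨rfl, h⟩]
  have Ni : ∀ i, i ≠ 0 → v i ≠ w0 → ∀ z, G'.Adj (v i) z ↔ z = w i := by
    intro i hi hi' z
    rw [hG', CEv, hN]
    have h0 : v i ≠ v 0 := fun h => hi (inj h)
    constructor
    · rintro ⟨h | h | h, h', _⟩
      exacts [absurd (Or.inl h) h', absurd (Or.inr h) h', h]
    · rintro rfl
      exact ⟨Or.inr (Or.inr rfl), fun h => h.elim (hwa i) (hwb i), fun h => h0 h.1, fun h => hi' h.1⟩
  have D' : Deg013 G' := by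
    intro x
    by_cases h0 : x = w0
    · left; rw [h0]; exact w0only
    by_cases hx : ∃ i, x = v i
    · obtain ⟨i, rfl⟩ := hx
      by_cases hi : i = 0
      · left; rw [hi]; exact v0only
      · right; left; exact ⟨w i, Ni i hi h0⟩
    · have hx' : ∀ i, x ≠ v i := fun i h => hx ⟨i, h⟩
      have : ∀ y, G'.Adj x y ↔ G.Adj x y := by
        intro y
        rw [hG']
        exact ⟨fun h => h.1, fun h => ⟨h, CEo x hx' y, fun h => hx' 0 h.1, fun h => h0 h.1⟩⟩
      simp only [this]
      exact D x
  have v1w0 : v 1 ≠ w0 := hne1.symm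
  have A1 : ∀ z, G'.Adj (v 1) z ↔ z = w 1 := Ni 1 one_ne v1w0
  obtain ⟨s1, hs1, t1, ht1, hst1, A0, hA0, B0, hB0, β, hβ, hβA, cA, cB⟩ :=
    choose_spoke (L (v 0) (v 1)) (L (v 1) (v 0)) (L (v 1) (w 1)) (L (w 1) (v 1))
      (hL _ _) (hL _ _) (hL _ _) (hL _ _) c₁ c₂
  obtain ⟨ψ0, C0, e1, e2⟩ := (IH G' lt D' L hL).2 (w 1) (v 1) ((A1 _).2 rfl).symm
    (fun z h => (A1 z).1 h) t1 ht1 s1 hs1 hst1.symm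
  -- add the edge v0 w0
  let ψ1 : V → V → ℕ := fun x y => if x = v 0 ∧ y = w0 then c₁ else if x = w0 ∧ y = v 0 then c₂
    else ψ0 x y
  have v0w0 : v 0 ≠ w0 := hw0.ne
  have p1 : ψ1 (v 0) w0 = c₁ := by simp [ψ1]
  have p2 : ψ1 w0 (v 0) = c₂ := by simp [ψ1, v0w0, v0w0.symm]
  have p3 : ∀ x y, G'.Adj x y → ψ1 x y = ψ0 x y := by
    rintro x y ⟨_, _, h1, h2⟩
    simp only [ψ1, if_neg h1, if_neg h2]
  have G1 : ∀ x y, (G.Adj x y ∧ ¬ CE x y) → G'.Adj x y ∨ (x = v 0 ∧ y = w0) ∨ (x = w0 ∧ y = v 0) := by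
    rintro x y ⟨h, h'⟩
    by_cases h1 : x = v 0 ∧ y = w0
    · exact Or.inr (Or.inl h1)
    by_cases h2 : x = w0 ∧ y = v 0
    · exact Or.inr (Or.inr h2)
    exact Or.inl ⟨h, h', h1, h2⟩
  have Cmem : ∀ x y, G.Adj x y → ¬ CE x y → ψ1 x y ∈ L x y := by
    intro x y h h'
    rcases G1 x y ⟨h, h'⟩ with h | ⟨rfl, rfl⟩ | ⟨rfl, rfl⟩
    · rw [p3 _ _ h]; exact C0.mem _ _ h
    · rwa [p1]
    · rwa [p2]
  have Cout : ∀ x y y', G.Adj x y → ¬ CE x y → G.Adj x y' → ¬ CE x y' → y ≠ y' →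
      ψ1 x y ≠ ψ1 x y' := by
    intro x y y' h h' g g' hyy
    rcases G1 x y ⟨h, h'⟩ with h | ⟨rfl, rfl⟩ | ⟨rfl, rfl⟩ <;>
      rcases G1 _ y' ⟨g, g'⟩ with g | ⟨h1, h2⟩ | ⟨h1, h2⟩
    · rw [p3 _ _ h, p3 _ _ g]; exact C0.out _ _ _ h g hyy
    · subst h1; exact absurd h (v0only _)
    · subst h1; exact absurd h (w0only _)
    · exact absurd g (v0only _)
    · exact absurd h2.symm hyy
    · exact absurd h1 v0w0
    · exact absurd g (w0only _)
    · exact absurd h1.symm v0w0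
    · exact absurd h2.symm hyy
  have Cthr : ∀ x y y', G.Adj x y → ¬ CE x y → G.Adj x y' → ¬ CE x y' →
      ψ1 y x ≠ ψ1 x y' := by
    intro x y y' h h' g g'
    rcases G1 x y ⟨h, h'⟩ with h | ⟨rfl, rfl⟩ | ⟨rfl, rfl⟩ <;>
      rcases G1 _ y' ⟨g, g'⟩ with g | ⟨h1, h2⟩ | ⟨h1, h2⟩
    · rw [p3 _ _ h.symm, p3 _ _ g]; exact C0.thr _ _ _ h g
    · subst h1; exact absurd h (v0only _)
    · subst h1; exact absurd h (w0only _)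
    · exact absurd g (v0only _)
    · rw [h2, p1, p2]; exact hc.symm
    · exact absurd h1 v0w0
    · exact absurd g (w0only _)
    · exact absurd h1.symm v0w0
    · rw [h2, p1, p2]; exact hc
  let s : Fin k → ℕ := fun i => ψ1 (v i) (w i)
  let t : Fin k → ℕ := fun i => ψ1 (w i) (v i)
  have s0 : s 0 = c₁ := by simp only [s, hw00, p1]
  have t0 : t 0 = c₂ := by simp only [t, hw00, p2]
  have ss1 : s 1 = s1 := by simp only [s]; rw [p3 _ _ ((A1 _).2 rfl), e2]
  have tt1 : t 1 = t1 := by simp only [t]; rw [p3 _ _ ((A1 _).2 rfl).symm, e1]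
  obtain ⟨a, b, ha, hb, ab, aa, bb, ba⟩ := cyc_ab k hk
    (fun i => if i = 0 then A0 else L (v i) (v (i+1)) \ {s i, t i, s (i+1)})
    (fun i => if i = 0 then B0 else L (v (i+1)) (v i) \ {s i, s (i+1), t (i+1)})
    (by simpa using cA) (by simpa using cB) β (by simpa using hβ) (by simpa using hβA)
    (by intro i; split_ifs; exacts [by omega, card_sdiff3 _ (hL _ _) _ _ _])
    (by intro i; split_ifs; exacts [by omega, card_sdiff3 _ (hL _ _) _ _ _])
  have ha' : ∀ i, a i ∈ L (v i) (v (i+1)) ∧ a i ≠ s i ∧ a i ≠ t i ∧ a i ≠ s (i+1) := by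
    intro i
    have : a i ∈ L (v i) (v (i+1)) \ {s i, t i, s (i+1)} := by
      have := ha i
      by_cases hi : i = 0
      · rw [if_pos hi] at this
        subst hi
        rw [zero_add, s0, t0, ss1]
        exact hA0 this
      · rwa [if_neg hi] at this
    simpa using this
  have hb' : ∀ i, b i ∈ L (v (i+1)) (v i) ∧ b i ≠ s i ∧ b i ≠ s (i+1) ∧ b i ≠ t (i+1) := by
    intro i
    have : b i ∈ L (v (i+1)) (v i) \ {s i, s (i+1), t (i+1)} := by
      have := hb i
      by_cases hi : i = 0
      · rw [if_pos hi] at this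
        subst hi
        rw [zero_add, s0, ss1, tt1]
        exact hB0 this
      · rwa [if_neg hi] at this
    simpa using this
  have hψ : ∃ ψ : V → V → ℕ, (∀ i, ψ (v i) (v (i+1)) = a i) ∧ (∀ i, ψ (v (i+1)) (v i) = b i) ∧
      ∀ x y, ¬ CE x y → ψ x y = ψ1 x y := by
    refine ⟨fun x y => if h : ∃ i, x = v i ∧ y = v (i+1) then a h.choose else
      if h : ∃ i, y = v i ∧ x = v (i+1) then b h.choose else ψ1 x y, ?_, ?_, ?_⟩
    · intro i
      have h : ∃ j, v i = v j ∧ v (i+1) = v (j+1) := ⟨i, rfl, rfl⟩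
      simp only [dif_pos h]
      rw [← inj h.choose_spec.1]
    · intro i
      have h : ¬ ∃ j, v (i+1) = v j ∧ v i = v (j+1) := by
        rintro ⟨j, h1, h2⟩
        apply pm j
        rw [← h2, ← inj h1]; congr 1; abel
      have h' : ∃ j, v i = v j ∧ v (i+1) = v (j+1) := ⟨i, rfl, rfl⟩
      simp only [dif_neg h, dif_pos h']
      rw [← inj h'.choose_spec.1]
    · intro x y h
      have h1 : ¬ ∃ i, x = v i ∧ y = v (i+1) := fun ⟨i, hi⟩ => h ⟨i, Or.inl hi⟩
      have h2 : ¬ ∃ i, y = v i ∧ x = v (i+1) := fun ⟨i, hi⟩ => h ⟨i, Or.inr hi⟩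
      simp only [dif_neg h1, dif_neg h2]
  obtain ⟨ψ, ψa, ψb, ψo⟩ := hψ
  have f1 := ψa
  have f2 : ∀ i, ψ (v i) (v (i-1)) = b (i-1) := by
    intro i; have := ψb (i-1); rwa [sub_add_cancel] at this
  have f3 : ∀ i, ψ (v i) (w i) = s i := fun i => ψo _ _ (CEw i)
  have f4 := ψb
  have f5 : ∀ i, ψ (v (i-1)) (v i) = a (i-1) := by
    intro i; have := ψa (i-1); rwa [sub_add_cancel] at this
  have f6 : ∀ i, ψ (w i) (v i) = t i := fun i => ψo _ _ (fun h => CEw i (CEs _ _ h))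
  have sp : ∀ i : Fin k, i - 1 + 1 = i := fun i => sub_add_cancel i 1
  have st : ∀ i, t i ≠ s i := fun i => Cthr _ _ _ (hAw i) (CEw i) (hAw i) (CEw i)
  refine ⟨ψ, ⟨?_, ?_, ?_⟩, ?_, ?_⟩
  · intro x y h
    by_cases hx : CE x y
    · obtain ⟨i, ⟨rfl, rfl⟩ | ⟨rfl, rfl⟩⟩ := hx
      · rw [ψa]; exact (ha' i).1
      · rw [ψb]; exact (hb' i).1
    · rw [ψo _ _ hx]; exact Cmem _ _ h hx
  · intro x y y' h h' hyy
    by_cases hx : ∃ i, x = v i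
    · obtain ⟨i, rfl⟩ := hx
      have q1 := ha' i
      have q2 := hb' (i-1)
      have q3 := ba (i-1)
      rw [sp] at q2 q3
      rcases (hN i y).1 h with rfl | rfl | rfl <;> rcases (hN i y').1 h' with rfl | rfl | rfl <;>
        first
        | exact absurd rfl hyy
        | (simp only [f1, f2, f3]; first | exact q3 | exact q3.symm | exact q1.2.1 | exact q1.2.1.symm | exact q2.2.2.1 | exact q2.2.2.1.symm)
    · have hx' : ∀ i, x ≠ v i := fun i h => hx ⟨i, h⟩
      rw [ψo _ _ (CEo x hx' _), ψo _ _ (CEo x hx' _)]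
      exact Cout _ _ _ h (CEo x hx' _) h' (CEo x hx' _) hyy
  · intro x y y' h h'
    by_cases hx : ∃ i, x = v i
    · obtain ⟨i, rfl⟩ := hx
      have q1 := ha' i
      have q1' := ha' (i-1)
      have q2 := hb' (i-1)
      have q2' := hb' i
      have q3 := ba (i-1)
      have q4 := aa (i-1)
      have q5 := bb (i-1)
      have q6 := ab i
      have q7 := ab (i-1)
      have q8 := st i
      rw [sp] at q1' q2 q3 q4 q5
      rcases (hN i y).1 h with rfl | rfl | rfl <;> rcases (hN i y').1 h' with rfl | rfl | rfl <;>
        simp only [f1, f2, f3, f4, f5, f6] <;>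
        first
        | exact q3 | exact q3.symm | exact q4 | exact q4.symm | exact q5 | exact q5.symm
        | exact q6 | exact q6.symm | exact q7 | exact q7.symm | exact q8
        | exact q1.2.1 | exact q1.2.2.1.symm | exact q2.2.2.1 | exact q2.2.2.2.symm
        | exact q1'.2.2.2 | exact q2'.2.1
    · have hx' : ∀ i, x ≠ v i := fun i h => hx ⟨i, h⟩
      rw [ψo _ _ (fun h => CEo x hx' _ (CEs _ _ h)), ψo _ _ (CEo x hx' _)]
      exact Cthr _ _ _ h (CEo x hx' _) h' (CEo x hx' _)
  · rw [← hw00, f3, s0]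
  · rw [← hw00, f6, t0]

lemma star_ext {V : Type*} (G : SimpleGraph V) (D : Deg013 G)
    (IH : ∀ G' < G, Deg013 G' → ExtP G')
    (L : V → V → Finset ℕ) (hL : ∀ v w, 6 ≤ (L v w).card) (u p : V) (hup : G.Adj u p)
    (hleaf : ∀ x, G.Adj u x → ∀ z, G.Adj x z → z = u)
    (c₁ c₂ : ℕ) (hc₁ : c₁ ∈ L u p) (hc₂ : c₂ ∈ L p u) (hc : c₁ ≠ c₂) :
    ∃ ψ, Col G L ψ ∧ ψ u p = c₁ ∧ ψ p u = c₂ := by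
  classical
  let G' : SimpleGraph V :=
    { Adj := fun x y => G.Adj x y ∧ x ≠ u ∧ y ≠ u
      symm := ⟨by
        rintro x y ⟨h1, h2, h3⟩
        exact ⟨h1.symm, h3, h2⟩⟩
      loopless := ⟨fun x h => G.loopless.irrefl x h.1⟩ }
  have hG' : ∀ x y, G'.Adj x y ↔ (G.Adj x y ∧ x ≠ u ∧ y ≠ u) := fun x y => Iff.rfl
  have lt : G' < G := by
    refine lt_of_le_of_ne (fun x y h => h.1) ?_
    intro h
    have : G'.Adj u p := h ▸ hup
    exact this.2.1 rfl
  have same : ∀ x, x ≠ u → ¬ G.Adj u x → ∀ y, G'.Adj x y ↔ G.Adj x y := by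
    intro x hx hx' y
    rw [hG']
    refine ⟨fun h => h.1, fun h => ⟨h, hx, ?_⟩⟩
    rintro rfl
    exact hx' h.symm
  have D' : Deg013 G' := by
    intro x
    by_cases hx : x = u
    · left; rintro w ⟨_, h, _⟩; exact h hx
    by_cases hx' : G.Adj u x
    · left; rintro w ⟨h, _, h'⟩; exact h' (hleaf x hx' w h)
    simp only [same x hx hx']
    exact D x
  obtain ⟨ψ0, C0⟩ := (IH G' lt D' L hL).1
  -- colours out of u
  have key : ∃ o : V → ℕ, o p = c₁ ∧ (∀ x, G.Adj u x → o x ∈ L u x ∧ o x ≠ c₂) ∧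
      (∀ x y, G.Adj u x → G.Adj u y → x ≠ y → o x ≠ o y) ∧
      ∀ x, ∃ i ∈ L x u, (x = p → i = c₂) ∧ ∀ y, G.Adj u y → i ≠ o y := by
    by_cases h3 : ∃ x, G.Adj u x ∧ x ≠ p
    · obtain ⟨x, hx, hxp⟩ := h3
      obtain ⟨y, hyp, hyx, hN⟩ := deg3_of_two D hup hx hxp.symm
      obtain ⟨α, hα, hα1, hα2⟩ := pick2 (L u x) (by have := hL u x; omega) c₁ c₂
      obtain ⟨β, hβ, hβ1, hβ2, hβ3⟩ := pick3 (L u y) (by have := hL u y; omega) c₁ c₂ α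
      let o : V → ℕ := fun z => if z = p then c₁ else if z = x then α else β
      have op : o p = c₁ := by simp [o]
      have ox : o x = α := by simp [o, hxp]
      have oy : o y = β := by simp [o, hyp, hyx]
      refine ⟨o, op, ?_, ?_, ?_⟩
      · intro z hz
        rcases (hN z).1 hz with rfl | rfl | rfl
        · rw [op]; exact ⟨hc₁, hc⟩
        · rw [ox]; exact ⟨hα, hα2⟩
        · rw [oy]; exact ⟨hβ, hβ2⟩
      · intro z z' hz hz' hne
        rcases (hN z).1 hz with h | h | h <;> rcases (hN z').1 hz' with h' | h' | h' <;>
          rw [h, h'] at hne ⊢ <;> simp only [op, ox, oy] <;> tauto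
      · intro z
        by_cases hz : z = p
        · subst hz
          refine ⟨c₂, hc₂, fun _ => rfl, ?_⟩
          intro z' hz'
          rcases (hN z').1 hz' with h' | h' | h' <;> rw [h'] <;> simp only [op, ox, oy] <;> tauto
        · obtain ⟨i, hi, h1, h2, h3⟩ := pick3 (L z u) (by have := hL z u; omega) c₁ α β
          refine ⟨i, hi, fun h => absurd h hz, ?_⟩
          intro z' hz'
          rcases (hN z').1 hz' with h' | h' | h' <;> rw [h'] <;> simp only [op, ox, oy] <;> tauto
    · have hN : ∀ x, G.Adj u x → x = p := by
        intro x hx; by_contra h; exact h3 ⟨x, hx, h⟩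
      refine ⟨fun _ => c₁, rfl, ?_, ?_, ?_⟩
      · intro x hx; rw [hN x hx]; exact ⟨hc₁, hc⟩
      · intro x y hx hy h; exact absurd ((hN x hx).trans (hN y hy).symm) h
      · intro z
        by_cases hz : z = p
        · subst hz; exact ⟨c₂, hc₂, fun _ => rfl, fun _ _ => hc.symm⟩
        · obtain ⟨i, hi, h1⟩ := pick1 (L z u) (by have := hL z u; omega) c₁
          exact ⟨i, hi, fun h => absurd h hz, fun _ _ => h1⟩
  obtain ⟨o, o1, o2, o3, o4⟩ := key
  choose ι i1 i2 i3 using o4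
  let ψ : V → V → ℕ := fun x y => if x = u then o y else if y = u then ι x else ψ0 x y
  have ψ1 : ∀ y, ψ u y = o y := fun y => by simp [ψ]
  have ψ2 : ∀ x, x ≠ u → ψ x u = ι x := fun x hx => by simp [ψ, hx]
  have ψ3 : ∀ x y, x ≠ u → y ≠ u → ψ x y = ψ0 x y := fun x y hx hy => by simp [ψ, hx, hy]
  refine ⟨ψ, ⟨?_, ?_, ?_⟩, ?_, ?_⟩
  · intro x y h
    by_cases hx : x = u
    · subst hx; rw [ψ1]; exact (o2 y h).1
    by_cases hy : y = u
    · subst hy; rw [ψ2 x hx]; exact i1 x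
    · rw [ψ3 x y hx hy]; exact C0.mem _ _ ⟨h, hx, hy⟩
  · intro x y y' h h' hne
    by_cases hx : x = u
    · subst hx; rw [ψ1, ψ1]; exact o3 _ _ h h' hne
    by_cases hux : G.Adj u x
    · exact absurd ((hleaf x hux y h).trans (hleaf x hux y' h').symm) hne
    · have g := (same x hx hux y).2 h
      have g' := (same x hx hux y').2 h'
      rw [ψ3 x y hx g.2.2, ψ3 x y' hx g'.2.2]
      exact C0.out _ _ _ g g' hne
  · intro x y y' h h'
    by_cases hx : x = u
    · subst hx; rw [ψ1, ψ2 y h.ne']; exact i3 _ _ h'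
    by_cases hux : G.Adj u x
    · have e1 := hleaf x hux y h
      have e2 := hleaf x hux y' h'
      subst e1; subst e2
      rw [ψ1, ψ2 x hx]; exact (i3 _ _ hux).symm
    · have g := (same x hx hux y).2 h
      have g' := (same x hx hux y').2 h'
      rw [ψ3 y x g.2.2 hx, ψ3 x y' hx g'.2.2]
      exact C0.thr _ _ _ g g'
  · rw [ψ1, o1]
  · rw [ψ2 p hup.ne', i2 p rfl]

lemma split_ext {V : Type*} (G : SimpleGraph V) (D : Deg013 G)
    (IH : ∀ G' < G, Deg013 G' → ExtP G')
    (L : V → V → Finset ℕ) (hL : ∀ v w, 6 ≤ (L v w).card) (u p : V) (hup : G.Adj u p)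
    (hp : ∀ z, G.Adj p z → z = u)
    (x : V) (hux : G.Adj u x) (x' : V) (hx' : G.Adj x x') (hxu' : x' ≠ u)
    (S : Set V) (hxS : x ∈ S) (huS : u ∉ S)
    (hS : ∀ y z, G.Adj y z → y ∈ S → z ∉ S → y = x ∧ z = u)
    (c₁ c₂ : ℕ) (hc₁ : c₁ ∈ L u p) (hc₂ : c₂ ∈ L p u) (hc : c₁ ≠ c₂) :
    ∃ ψ, Col G L ψ ∧ ψ u p = c₁ ∧ ψ p u = c₂ := by
  classical
  have hxp : x ≠ p := by
    rintro rfl; exact hxu' (hp _ hx')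
  have hpS : p ∉ S := fun h => hxp (hS p u hup.symm h huS).1.symm
  have hx'S : x' ∈ S := by
    by_contra h; exact hxu' (hS x x' hx' hxS h).2
  let G1 : SimpleGraph V :=
    { Adj := fun y z => G.Adj y z ∧ ¬ (y ∈ S ∧ z ∈ S)
      symm := ⟨by
        rintro x y ⟨h1, h2⟩
        exact ⟨h1.symm, fun h => h2 ⟨h.2, h.1⟩⟩⟩
      loopless := ⟨fun x h => G.loopless.irrefl x h.1⟩ }
  let G2 : SimpleGraph V :=
    { Adj := fun y z => G.Adj y z ∧ (y ∈ S ∨ z ∈ S)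
      symm := ⟨by
        rintro x y ⟨h1, h2⟩
        exact ⟨h1.symm, h2.symm⟩⟩
      loopless := ⟨fun x h => G.loopless.irrefl x h.1⟩ }
  have hG1 : ∀ y z, G1.Adj y z ↔ (G.Adj y z ∧ ¬ (y ∈ S ∧ z ∈ S)) := fun y z => Iff.rfl
  have hG2 : ∀ y z, G2.Adj y z ↔ (G.Adj y z ∧ (y ∈ S ∨ z ∈ S)) := fun y z => Iff.rfl
  have lt1 : G1 < G := by
    refine lt_of_le_of_ne (fun x y h => h.1) ?_
    intro h
    have : G1.Adj x x' := h ▸ hx'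
    exact this.2 ⟨hxS, hx'S⟩
  have lt2 : G2 < G := by
    refine lt_of_le_of_ne (fun x y h => h.1) ?_
    intro h
    have : G2.Adj u p := h ▸ hup
    rcases this.2 with h | h
    exacts [huS h, hpS h]
  have n1 : ∀ y, y ∉ S → ∀ z, G1.Adj y z ↔ G.Adj y z := by
    intro y hy z; rw [hG1]; tauto
  have n2 : ∀ y, y ∈ S → ∀ z, G2.Adj y z ↔ G.Adj y z := by
    intro y hy z; rw [hG2]; tauto
  have D1 : Deg013 G1 := by
    intro y
    by_cases hy : y ∈ S
    · by_cases hyx : y = x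
      · right; left
        refine ⟨u, fun w => ⟨fun h => ?_, fun h => ?_⟩⟩
        · exact (hS y w h.1 hy (fun hw => h.2 ⟨hy, hw⟩)).2
        · subst h; subst hyx; exact ⟨hux.symm, fun h => huS h.2⟩
      · left; intro w h
        exact hyx (hS y w h.1 hy (fun hw => h.2 ⟨hy, hw⟩)).1
    · simp only [n1 y hy]; exact D y
  have n2u : ∀ z, G2.Adj u z → z = x := by
    rintro z ⟨h1, h2 | h2⟩
    · exact absurd h2 huS
    · exact (hS z u h1.symm h2 huS).1
  have g2ux : G2.Adj u x := ⟨hux, Or.inr hxS⟩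
  have D2 : Deg013 G2 := by
    intro y
    by_cases hy : y ∈ S
    · simp only [n2 y hy]; exact D y
    · by_cases hyx : y = u
      · right; left
        refine ⟨x, fun w => ⟨fun h => ?_, fun h => ?_⟩⟩
        · subst hyx; exact n2u w h
        · subst h; subst hyx; exact g2ux
      · left; rintro w ⟨h1, h2 | h2⟩
        · exact hy h2
        · exact hyx (hS w y h1.symm h2 hy).2
  obtain ⟨ψ1, C1, e1, e2⟩ := (IH G1 lt1 D1 L hL).2 u p ⟨hup, fun h => huS h.1⟩
    (fun z h => hp z h.1) c₁ hc₁ c₂ hc₂ hc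
  have g1ux : G1.Adj u x := ⟨hux, fun h => huS h.1⟩
  obtain ⟨ψ2, C2, e3, e4⟩ := (IH G2 lt2 D2 L hL).2 x u g2ux.symm n2u (ψ1 x u) (C1.mem _ _ g1ux.symm)
    (ψ1 u x) (C1.mem _ _ g1ux) (C1.thr _ _ _ g1ux g1ux)
  let ψ : V → V → ℕ := fun y z => if y ∈ S ∨ z ∈ S then ψ2 y z else ψ1 y z
  have a1 : ∀ y z, y ∈ S → ψ y z = ψ2 y z := fun y z h => by simp [ψ, h]
  have a2 : ∀ y z, z ∈ S → ψ y z = ψ2 y z := fun y z h => by simp [ψ, h]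
  have a3 : ∀ y z, y ∉ S → G.Adj y z → ψ y z = ψ1 y z := by
    intro y z hy h
    by_cases hz : z ∈ S
    · obtain ⟨rfl, rfl⟩ := hS z y h.symm hz hy
      rw [a2 _ _ hz, e4]
    · simp [ψ, hy, hz]
  have a4 : ∀ y z, y ∉ S → G.Adj y z → ψ z y = ψ1 z y := by
    intro y z hy h
    by_cases hz : z ∈ S
    · obtain ⟨rfl, rfl⟩ := hS z y h.symm hz hy
      rw [a1 _ _ hz, e3]
    · simp [ψ, hy, hz]
  refine ⟨ψ, ⟨?_, ?_, ?_⟩, ?_, ?_⟩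
  · intro y z h
    by_cases hy : y ∈ S
    · rw [a1 _ _ hy]; exact C2.mem _ _ ((n2 y hy z).2 h)
    · rw [a3 _ _ hy h]; exact C1.mem _ _ ((n1 y hy z).2 h)
  · intro y z z' h h' hne
    by_cases hy : y ∈ S
    · rw [a1 _ _ hy, a1 _ _ hy]; exact C2.out _ _ _ ((n2 y hy z).2 h) ((n2 y hy z').2 h') hne
    · rw [a3 _ _ hy h, a3 _ _ hy h']; exact C1.out _ _ _ ((n1 y hy z).2 h) ((n1 y hy z').2 h') hne
  · intro y z z' h h'
    by_cases hy : y ∈ S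
    · rw [a2 _ _ hy, a1 _ _ hy]; exact C2.thr _ _ _ ((n2 y hy z).2 h) ((n2 y hy z').2 h')
    · rw [a4 _ _ hy h, a3 _ _ hy h']; exact C1.thr _ _ _ ((n1 y hy z).2 h) ((n1 y hy z').2 h')
  · rw [a3 _ _ huS hup, e1]
  · rw [a4 _ _ huS hup, e2]

/-- a version of `cyc_extend` for a cycle given by a path and a closing edge -/
lemma path_extend {V : Type*} (G : SimpleGraph V) (D : Deg013 G)
    (IH : ∀ G' < G, Deg013 G' → ExtP G')
    (L : V → V → Finset ℕ) (hL : ∀ v w, 6 ≤ (L v w).card)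
    (n : ℕ) (hn : 2 ≤ n) (f : ℕ → V) (inj : ∀ i j, i ≤ n → j ≤ n → f i = f j → i = j)
    (adj : ∀ i < n, G.Adj (f i) (f (i+1))) (adjn : G.Adj (f n) (f 0)) (w0 : V)
    (hw0 : G.Adj (f 0) w0)
    (hne1 : w0 ≠ f 1) (hne2 : w0 ≠ f n)
    (hw0' : (∃ i ≤ n, f i = w0) ∨ ∀ z, G.Adj w0 z → z = f 0)
    (c₁ c₂ : ℕ) (hc₁ : c₁ ∈ L (f 0) w0) (hc₂ : c₂ ∈ L w0 (f 0)) (hc : c₁ ≠ c₂) :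
    ∃ ψ, Col G L ψ ∧ ψ (f 0) w0 = c₁ ∧ ψ w0 (f 0) = c₂ := by
  have h1 : (1 : Fin (n+1)).val = 1 := by
    rw [Fin.val_one']; exact Nat.mod_eq_of_lt (by omega)
  have hl : (-1 : Fin (n+1)) = Fin.last n := by
    exact neg_eq_of_add_eq_zero_left (Fin.last_add_one n)
  have := cyc_extend G D IH L hL (n+1) (by omega) (fun i => f i.val)
    (by
      intro i j h
      exact Fin.ext (inj _ _ (by omega) (by omega) h))
    (by
      intro i
      by_cases h : i = Fin.last n
      · subst h; simpa using adjn
      · have : i.val < n := by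
          have := i.isLt
          have : i.val ≠ n := fun h' => h (Fin.ext h')
          omega
        rw [Fin.val_add_one_of_lt (Fin.lt_def.2 (by simpa using this))]
        exact adj _ this)
    w0 (by simpa using hw0) (by simpa only [h1] using hne1)
    (by simpa only [hl, Fin.val_last] using hne2)
    (by
      rcases hw0' with ⟨i, hi, h⟩ | h
      · left; exact ⟨⟨i, by omega⟩, h⟩
      · right; simpa using h) c₁ c₂ (by simpa using hc₁) (by simpa using hc₂) hc
  simpa using this

theorem main_ext {V : Type*} [Fintype V] (G : SimpleGraph V) : Deg013 G → ExtP G := by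
  classical
  induction G using WellFoundedLT.induction with
  | ind G IH =>
  intro D L hL
  have pres : ∀ u p, G.Adj u p → (∀ z, G.Adj p z → z = u) →
      ∀ c₁ ∈ L u p, ∀ c₂ ∈ L p u, c₁ ≠ c₂ → ∃ ψ, Col G L ψ ∧ ψ u p = c₁ ∧ ψ p u = c₂ := by
    intro u p hup hp c₁ hc₁ c₂ hc₂ hc
    by_cases hst : ∀ x, G.Adj u x → ∀ z, G.Adj x z → z = u
    · exact star_ext G D IH L hL u p hup hst c₁ c₂ hc₁ hc₂ hc
    push Not at hst
    obtain ⟨x, hux, x', hxx', hx'u⟩ := hst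
    by_cases hr : (G.deleteEdges {s(u, x)}).Reachable u x
    · obtain ⟨q, hq⟩ := hr.exists_isPath
      have hq0 : q.getVert 0 = u := q.getVert_zero
      have hql : q.getVert q.length = x := q.getVert_length
      have hinj := hq.getVert_injOn
      have hxp : x ≠ p := by rintro rfl; exact hx'u (hp _ hxx')
      have hadj : ∀ i < q.length, (G.deleteEdges {s(u, x)}).Adj (q.getVert i) (q.getVert (i+1)) :=
        fun i hi => q.adj_getVert_succ hi
      have hlen : 2 ≤ q.length := by
        by_contra h
        have : q.length = 0 ∨ q.length = 1 := by omega
        rcases this with h0 | h0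
        · rw [h0, hq0] at hql; exact hux.ne hql
        · have h2 := hadj 0 (by omega)
          rw [hq0, zero_add, ← h0, hql] at h2
          simp at h2
      have hadjG : ∀ i < q.length, G.Adj (q.getVert i) (q.getVert (i+1)) :=
        fun i hi => (SimpleGraph.deleteEdges_le _) (hadj i hi)
      have hne1 : p ≠ q.getVert 1 := by
        intro h
        have h2 := hadjG 1 (by omega)
        rw [← h] at h2
        have h3 := (hp _ h2).trans hq0.symm
        have := hinj (by simp; omega) (by simp) h3
        omega
      have := path_extend G D IH L hL q.length hlen q.getVert
        (fun i j hi hj h => hinj (by simpa using hi) (by simpa using hj) h) hadjG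
        (by rw [hql, hq0]; exact hux.symm) p (by rw [hq0]; exact hup) hne1
        (by rw [hql]; exact hxp.symm) (Or.inr (by rw [hq0]; exact hp)) c₁ c₂
        (by rw [hq0]; exact hc₁) (by rw [hq0]; exact hc₂) hc
      rwa [hq0] at this
    · refine split_ext G D IH L hL u p hup hp x hux x' hxx' hx'u
        {z | (G.deleteEdges {s(u, x)}).Reachable x z} (SimpleGraph.Reachable.refl _)
        (fun h => hr h.symm) ?_ c₁ c₂ hc₁ hc₂ hc
      intro y z hyz hy hz
      by_contra hne
      apply hz
      have hy' : (G.deleteEdges {s(u, x)}).Reachable x y := hy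
      refine hy'.trans (SimpleGraph.Adj.reachable ?_)
      rw [SimpleGraph.deleteEdges_adj]
      refine ⟨hyz, ?_⟩
      intro h
      simp only [Set.mem_singleton_iff, Sym2.eq_iff] at h
      rcases h with ⟨rfl, rfl⟩ | ⟨rfl, rfl⟩
      · exact hr hy'.symm
      · exact hne ⟨rfl, rfl⟩
  refine ⟨?_, pres⟩
  by_cases hpend : ∃ u p, G.Adj u p ∧ ∀ z, G.Adj p z → z = u
  · obtain ⟨u, p, hup, hp⟩ := hpend
    obtain ⟨c₁, hc₁, _⟩ := pick1 (L u p) (by have := hL u p; omega) 0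
    obtain ⟨c₂, hc₂, h⟩ := pick1 (L p u) (by have := hL p u; omega) c₁
    obtain ⟨ψ, C, _⟩ := pres u p hup hp c₁ hc₁ c₂ hc₂ h.symm
    exact ⟨ψ, C⟩
  by_cases hedge : ∃ x y, G.Adj x y
  swap
  · push Not at hedge
    exact ⟨fun _ _ => 0, fun v w h => absurd h (hedge _ _), fun v w _ h => absurd h (hedge _ _),
      fun v w _ h => absurd h (hedge _ _)⟩
  -- longest path
  let P : ℕ → Prop := fun n => ∃ (a b : V) (q : G.Walk a b), q.IsPath ∧ q.length = n
  obtain ⟨x0, y0, hxy0⟩ := hedge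
  have P1 : P 1 := ⟨x0, y0, hxy0.toWalk, by simp [hxy0.ne], by simp⟩
  have Pb : ∀ n, P n → n ≤ Fintype.card V := by
    rintro n ⟨a, b, q, hq, rfl⟩; exact hq.length_lt.le
  have hc1 : 1 ≤ Fintype.card V := Pb 1 P1
  obtain ⟨a, b, q, hq, hql⟩ := Nat.findGreatest_spec (P := P) hc1 P1
  have hqmax : ∀ n, P n → n ≤ q.length := by
    intro n hn; rw [hql]; exact Nat.le_findGreatest (Pb n hn) hn
  have hlen1 : 1 ≤ q.length := hqmax 1 P1
  have hq0 : q.getVert 0 = a := q.getVert_zero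
  have hinj := hq.getVert_injOn
  have hadj : ∀ i < q.length, G.Adj (q.getVert i) (q.getVert (i+1)) :=
    fun i hi => q.adj_getVert_succ hi
  have hsup : ∀ z, G.Adj a z → ∃ i ≤ q.length, q.getVert i = z := by
    intro z hz
    have : z ∈ q.support := by
      by_contra h
      have := hqmax (q.length + 1) ⟨z, b, SimpleGraph.Walk.cons hz.symm q, by
        rw [SimpleGraph.Walk.cons_isPath_iff]; exact ⟨hq, h⟩, by simp⟩
      omega
    obtain ⟨i, h1, h2⟩ := SimpleGraph.Walk.mem_support_iff_exists_getVert.1 this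
    exact ⟨i, h2, h1⟩
  have ha1 : G.Adj a (q.getVert 1) := by have := hadj 0 hlen1; rwa [hq0] at this
  obtain ⟨z, haz, hz1⟩ : ∃ z, G.Adj a z ∧ z ≠ q.getVert 1 := by
    by_contra h
    push Not at h
    exact hpend ⟨q.getVert 1, a, ha1.symm, h⟩
  obtain ⟨w, hw1, hwz, hN⟩ := deg3_of_two D ha1 haz hz1.symm
  have haw : G.Adj a w := (hN w).2 (by tauto)
  obtain ⟨i, hi, hiz⟩ := hsup z haz
  obtain ⟨j, hj, hjw⟩ := hsup w haw
  have fin : ∀ i j, i < j → j ≤ q.length → G.Adj a (q.getVert i) → G.Adj a (q.getVert j) →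
      q.getVert i ≠ q.getVert 1 → ∃ ψ, Col G L ψ := by
    intro i j hij hj hai haj hi1
    have i0 : i ≠ 0 := by rintro rfl; rw [hq0] at hai; exact hai.ne rfl
    obtain ⟨c₁, hc₁, _⟩ := pick1 (L (q.getVert 0) (q.getVert i)) (by have := hL (q.getVert 0) (q.getVert i); omega) 0
    obtain ⟨c₂, hc₂, h⟩ := pick1 (L (q.getVert i) (q.getVert 0)) (by have := hL (q.getVert i) (q.getVert 0); omega) c₁
    obtain ⟨ψ, C, _⟩ := path_extend G D IH L hL j (by omega) q.getVert
      (fun i' j' hi hj h => hinj (by simp; omega) (by simp; omega) h)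
      (fun i' hi => hadj i' (by omega)) (by rw [hq0]; exact haj.symm) (q.getVert i)
      (by rw [hq0]; exact hai) hi1
      (fun h => by
        have := hinj (by simp; omega) (by simp; omega) h
        omega) (Or.inl ⟨i, hij.le, rfl⟩) c₁ c₂ hc₁ hc₂ h.symm
    exact ⟨ψ, C⟩
  subst hiz hjw
  rcases lt_trichotomy i j with h | h | h
  · exact fin i j h hj haz haw hz1
  · subst h; exact absurd rfl hwz
  · exact fin j i h hi haw haz hw1

/-- Let `G` be a semicubic graph (every vertex of degree 1 or 3) with at least one pendent
vertex, such that the graph obtained by deleting all pendent vertices is `K₁` or is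
2-connected. Then for every incidence 6-list assignment `L` of `G`, every pendent edge of `G`
is freely `L`-choosable. -/
theorem pendent_edge_freely_choosable {V : Type*} [Fintype V] (G : SimpleGraph V)
    (hsemi : ∀ v, vdeg G v = 1 ∨ vdeg G v = 3)
    (hpend : ∃ v, vdeg G v = 1)
    (hcore : ({v | vdeg G v ≠ 1} : Set V).ncard = 1 ∨
      TwoConnected (G.induce {v | vdeg G v ≠ 1}))
    (L : V × Sym2 V → Finset ℕ)
    (hL : ∀ v e, IsIncidence G v e → (L (v, e)).card = 6) :
    ∀ u v, G.Adj u v → vdeg G v = 1 → FreelyLChoosable G L u v := by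
  classical
  have D : Deg013 G := by
    intro v
    rcases hsemi v with h | h
    · right; left
      obtain ⟨a, ha⟩ := Set.ncard_eq_one.1 h
      exact ⟨a, fun w => by rw [← SimpleGraph.mem_neighborSet, ha]; simp⟩
    · right; right
      obtain ⟨a, b, c, h1, h2, h3, ha⟩ := Set.ncard_eq_three.1 h
      exact ⟨a, b, c, h1, h2, h3, fun w => by rw [← SimpleGraph.mem_neighborSet, ha]; simp⟩
  intro u p hup hp c₁ hc₁ c₂ hc₂ hc
  have hp' : ∀ z, G.Adj p z → z = u := by
    obtain ⟨a, ha⟩ := Set.ncard_eq_one.1 hp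
    have key : ∀ w, G.Adj p w → w = a := fun w h => by
      rw [← SimpleGraph.mem_neighborSet, ha] at h; simpa using h
    intro z hz
    rw [key z hz, key u hup.symm]
  let M : V → V → Finset ℕ := fun x y => if G.Adj x y then L (x, s(x, y)) else Finset.range 6
  have hM : ∀ x y, G.Adj x y → M x y = L (x, s(x, y)) := fun x y h => by simp [M, h]
  have hM6 : ∀ x y, 6 ≤ (M x y).card := by
    intro x y
    by_cases h : G.Adj x y
    · rw [hM x y h, hL]
      exact ⟨h, by simp⟩
    · simp [M, h]
  obtain ⟨ψ, C, e1, e2⟩ := (main_ext G D M hM6).2 u p hup hp' c₁ (by rwa [hM _ _ hup]) c₂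
    (by rw [hM _ _ hup.symm, Sym2.eq_swap]; exact hc₂) hc
  let φ : V × Sym2 V → ℕ := fun q => if h : q.1 ∈ q.2 then ψ q.1 (Sym2.Mem.other h) else 0
  have hφ : ∀ x y, φ (x, s(x, y)) = ψ x y := by
    intro x y
    have h : x ∈ s(x, y) := by simp
    simp only [φ, dif_pos h]
    congr 1
    exact Sym2.congr_right.1 (Sym2.other_spec h)
  have inc : ∀ x e, IsIncidence G x e → ∃ y, G.Adj x y ∧ e = s(x, y) := by
    rintro x e ⟨h1, h2⟩
    obtain ⟨y, rfl⟩ := h2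
    exact ⟨y, h1, rfl⟩
  refine ⟨φ, ⟨?_, ?_⟩, ?_, ?_⟩
  · intro x e h
    obtain ⟨y, hy, rfl⟩ := inc x e h
    rw [hφ, ← hM _ _ hy]; exact C.mem _ _ hy
  · intro x e x' e' h h' hne hadj
    obtain ⟨y, hy, rfl⟩ := inc x e h
    obtain ⟨y', hy', rfl⟩ := inc x' e' h'
    rw [hφ, hφ]
    have case1 : x = x' → ψ x y ≠ ψ x' y' := by
      rintro rfl
      exact C.out _ _ _ hy hy' (fun h => hne (by rw [h]))
    have case2 : y = x' → ψ x y ≠ ψ x' y' := by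
      rintro rfl
      exact C.thr _ _ _ hy.symm hy'
    have case3 : y' = x → ψ x y ≠ ψ x' y' := by
      rintro rfl
      exact (C.thr _ _ _ hy'.symm hy).symm
    rcases hadj with h | h | h | h
    · exact case1 h
    · rw [Sym2.eq_iff] at h
      rcases h with h | h
      · exact case1 h.1
      · exact case2 h.2
    · exact case2 (Sym2.congr_right.1 h).symm
    · rw [Sym2.eq_swap] at h
      exact case3 (Sym2.congr_right.1 h).symm
  · rw [hφ, e1]
  · rw [Sym2.eq_swap, hφ, e2]
end

section
/- Let G be a semicubic simple graph with exactly one pendent vertex v such that G − v is 2-connected. Then G has a (1,2)-decomposition. -/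
/-- A (1,2)-decomposition of `G`: a bipartition `(E₁, E₂)` of the edge set such that `E₁`
induces a 1-factor (every vertex lies on exactly one edge of `E₁`) and `E₂` induces a
2-regular graph (every vertex lies on exactly two edges of `E₂` or on none). -/
def IsOneTwoDecomposition {V : Type*} (G : SimpleGraph V) (E₁ E₂ : Set (Sym2 V)) : Prop :=
  E₁ ∪ E₂ = G.edgeSet ∧ Disjoint E₁ E₂ ∧
  (∀ v : V, {e | e ∈ E₁ ∧ v ∈ e}.ncard = 1) ∧
  (∀ v : V, {e | e ∈ E₂ ∧ v ∈ e}.ncard = 0 ∨ {e | e ∈ E₂ ∧ v ∈ e}.ncard = 2)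

open Classical in
/-- number of edges leaving `C` -/
noncomputable def eOut {V : Type*} [Fintype V] (G : SimpleGraph V) (C : Finset V) : ℕ :=
  ∑ x ∈ C, (Finset.univ.filter (fun y => G.Adj x y ∧ y ∉ C)).card

open Classical in
theorem vdeg_eq {V : Type*} [Fintype V] (G : SimpleGraph V) (x : V) :
    vdeg G x = (Finset.univ.filter (fun y => G.Adj x y)).card := by
  unfold vdeg
  rw [← Set.ncard_coe_finset]
  congr 1
  ext y
  simp

open Classical in
theorem eOut_odd {V : Type*} [Fintype V] (G : SimpleGraph V)
    (hodd : ∀ w, Odd (vdeg G w)) (C : Finset V) (hC : Odd C.card) : Odd (eOut G C) := by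
  obtain ⟨H, hA⟩ : ∃ H : SimpleGraph V, ∀ x y, H.Adj x y ↔ (G.Adj x y ∧ x ∈ C ∧ y ∈ C) :=
    ⟨{ Adj := fun x y => G.Adj x y ∧ x ∈ C ∧ y ∈ C
       symm := ⟨fun x y h => ⟨h.1.symm, h.2.2, h.2.1⟩⟩
       loopless := ⟨fun x h => G.loopless.irrefl x h.1⟩ }, fun _ _ => Iff.rfl⟩
  have hH : Even (∑ x, vdeg H x) := by
    have h := H.sum_degrees_eq_twice_card_edges
    have h2 : ∑ x, vdeg H x = ∑ x, H.degree x := by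
      refine Finset.sum_congr rfl fun x _ => ?_
      rw [vdeg_eq, ← SimpleGraph.card_neighborFinset_eq_degree]
      congr 1
      ext y
      simp
    rw [h2, h]
    exact even_two_mul _
  have hH2 : ∑ x, vdeg H x = ∑ x ∈ C, vdeg H x := by
    symm
    apply Finset.sum_subset (Finset.subset_univ _)
    intro x _ hx
    rw [vdeg_eq, Finset.card_eq_zero, Finset.filter_eq_empty_iff]
    intro y _ h
    exact hx ((hA _ _).1 h).2.1
  have hsum : ∑ x ∈ C, vdeg G x = ∑ x ∈ C, vdeg H x + eOut G C := by
    unfold eOut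
    rw [← Finset.sum_add_distrib]
    refine Finset.sum_congr rfl fun x hx => ?_
    rw [vdeg_eq, vdeg_eq, ← Finset.card_union_of_disjoint]
    · congr 1
      ext y
      simp only [Finset.mem_filter, Finset.mem_union, Finset.mem_univ, true_and, hA]
      tauto
    · rw [Finset.disjoint_left]
      intro y
      simp only [Finset.mem_filter, Finset.mem_univ, true_and, hA]
      tauto
  have hp : Odd (∑ x ∈ C, vdeg G x) := by
    rw [Finset.odd_sum_iff_odd_card_odd]
    rwa [Finset.filter_true_of_mem (fun x _ => hodd x)]
  rw [hH2] at hH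
  rw [hsum] at hp
  grind

open Classical in
theorem eOut_compl {V : Type*} [Fintype V] (G : SimpleGraph V) (C : Finset V) :
    eOut G Cᶜ = eOut G C := by
  unfold eOut
  have h1 : ∀ x, (Finset.univ.filter (fun y => G.Adj x y ∧ y ∉ C)).card
      = ∑ y ∈ Cᶜ, if G.Adj x y then 1 else 0 := by
    intro x
    rw [← Finset.card_filter]
    congr 1
    ext y
    simp [and_comm]
  have h2 : ∀ x, (Finset.univ.filter (fun y => G.Adj x y ∧ y ∉ Cᶜ)).card
      = ∑ y ∈ C, if G.Adj x y then 1 else 0 := by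
    intro x
    rw [← Finset.card_filter]
    congr 1
    ext y
    simp [and_comm]
  simp only [h1, h2]
  rw [Finset.sum_comm]
  simp only [SimpleGraph.adj_comm]

/-- crossing edge in a connected graph -/
theorem exists_cross {W : Type*} (H : SimpleGraph W) (hH : H.Connected) (P : W → Prop)
    (a b : W) (ha : P a) (hb : ¬ P b) : ∃ x y, H.Adj x y ∧ P x ∧ ¬ P y := by
  by_contra hcon
  push Not at hcon
  obtain ⟨p⟩ := hH.preconnected a b
  have : ∀ {a b : W} (p : H.Walk a b), P a → P b := by
    intro a b p
    induction p with
    | nil => exact id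
    | cons h p ih => exact fun h' => ih (hcon _ _ h h')
  exact hb (this p ha)

open Classical in
theorem bridge_compl {V : Type*} [Fintype V] (G : SimpleGraph V) (v : V)
    (h3 : ∀ w, w ≠ v → vdeg G w = 3)
    (h2 : TwoConnected (G.induce {x | x ≠ v})) (C : Finset V) (hv : v ∉ C)
    (he : eOut G C = 1) : Cᶜ = {v} := by
  have hpos : ∃ x ∈ C, 0 < (Finset.univ.filter (fun y => G.Adj x y ∧ y ∉ C)).card := by
    by_contra hcon
    push Not at hcon
    have : eOut G C = 0 := Finset.sum_eq_zero fun x hx => Nat.le_zero.1 (hcon x hx)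
    omega
  obtain ⟨x, hx, hxpos⟩ := hpos
  have huniq : ∀ x' ∈ C, x' ≠ x → ∀ y, G.Adj x' y → y ∈ C := by
    intro x' hx' hne y hadj
    by_contra hy
    have hpos' : 0 < (Finset.univ.filter (fun y => G.Adj x' y ∧ y ∉ C)).card :=
      Finset.card_pos.2 ⟨y, by simp [hadj, hy]⟩
    have : ∑ z ∈ ({x, x'} : Finset V),
        (Finset.univ.filter (fun y => G.Adj z y ∧ y ∉ C)).card ≤ eOut G C := by
      apply Finset.sum_le_sum_of_subset
      intro z hz
      simp only [Finset.mem_insert, Finset.mem_singleton] at hz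
      rcases hz with rfl | rfl <;> assumption
    rw [Finset.sum_pair hne.symm] at this
    omega
  have hxv : x ≠ v := fun h => hv (h ▸ hx)
  by_contra hne
  obtain ⟨z, hz, hzv⟩ : ∃ z, z ∉ C ∧ z ≠ v := by
    by_contra hcon
    push Not at hcon
    apply hne
    ext z
    simp only [Finset.mem_compl, Finset.mem_singleton]
    exact ⟨hcon z, fun h => h ▸ hv⟩
  by_cases hC : ∃ x' ∈ C, x' ≠ x
  · obtain ⟨x', hx', hx'x⟩ := hC
    have hx'v : x' ≠ v := fun h => hv (h ▸ hx')
    have hzx : z ≠ x := fun h => hz (h ▸ hx)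
    obtain ⟨a, b, hab, ha, hb⟩ := exists_cross _ (h2.2.2 ⟨x, hxv⟩) (fun w => w.1.1 ∈ C)
      ⟨⟨x', hx'v⟩, fun h => hx'x (congrArg Subtype.val h)⟩
      ⟨⟨z, hzv⟩, fun h => hzx (congrArg Subtype.val h)⟩ hx' hz
    exact hb (huniq a.1.1 ha (fun h => a.2 (Subtype.ext h)) _ hab)
  · push Not at hC
    have hCx : C = {x} := by
      ext w
      simp only [Finset.mem_singleton]
      exact ⟨hC w, fun h => h ▸ hx⟩
    have := h3 x hxv
    rw [vdeg_eq] at this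
    subst hCx
    unfold eOut at he
    rw [Finset.sum_singleton] at he
    have h4 : (Finset.univ.filter (fun y => G.Adj x y ∧ y ∉ ({x} : Finset V)))
      = Finset.univ.filter (fun y => G.Adj x y) := by
      ext y
      simp only [Finset.mem_filter, Finset.mem_univ, true_and, Finset.mem_singleton]
      exact ⟨fun h => h.1, fun h => ⟨h, fun h' => G.loopless.irrefl x (h' ▸ h)⟩⟩
    rw [h4] at he
    omega

open Classical in
theorem family_bound {V : Type*} [Fintype V] (G : SimpleGraph V) (v : V)
    (hv1 : vdeg G v = 1) (h3 : ∀ w, w ≠ v → vdeg G w = 3)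
    (h2 : TwoConnected (G.induce {x | x ≠ v})) (U : Finset V) (F : Finset (Finset V))
    (hdisj : (F : Set (Finset V)).PairwiseDisjoint id)
    (hodd : ∀ C ∈ F, Odd C.card) (hU : ∀ C ∈ F, Disjoint C U)
    (hout : ∀ C ∈ F, ∀ x ∈ C, ∀ y, G.Adj x y → y ∉ C → y ∈ U) : F.card ≤ U.card := by
  have hdo : ∀ w, Odd (vdeg G w) := by
    intro w
    by_cases h : w = v
    · rw [h, hv1]; decide
    · rw [h3 w h]; decide
  have hd3 : ∀ w, vdeg G w ≤ 3 := by
    intro w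
    by_cases h : w = v
    · rw [h, hv1]; decide
    · rw [h3 w h]
  have hone : ∀ C ∈ F, eOut G C = 1 → C = if v ∈ U then {v}ᶜ else {v} := by
    intro C hC he
    split_ifs with hvU
    · have := bridge_compl G v h3 h2 C (Finset.disjoint_right.1 (hU C hC) hvU) he
      rw [← this, compl_compl]
    · by_cases hvC : v ∈ C
      · have := bridge_compl G v h3 h2 Cᶜ (by simpa using hvC) (by rw [eOut_compl, he])
        rwa [compl_compl] at this
      · have := bridge_compl G v h3 h2 C hvC he
        exfalso
        have h0 : eOut G C = 0 := by
          refine Finset.sum_eq_zero fun x hx => ?_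
          rw [Finset.card_eq_zero, Finset.filter_eq_empty_iff]
          rintro y _ ⟨hxy, hy⟩
          have hyU := hout C hC x hx y hxy hy
          have : y ∈ ({v} : Finset V) := by rw [← this]; simpa using hy
          rw [Finset.mem_singleton] at this
          exact hvU (this ▸ hyU)
        omega
  -- lower bound
  have hlow : 3 * F.card ≤ ∑ C ∈ F, eOut G C + 2 := by
    have h1 : ∀ C ∈ F, 3 ≤ eOut G C + if C = (if v ∈ U then {v}ᶜ else {v}) then 2 else 0 := by
      intro C hC
      have ho := eOut_odd G hdo C (hodd C hC)
      by_cases he : eOut G C = 1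
      · rw [if_pos (hone C hC he)]; omega
      · obtain ⟨k, hk⟩ := ho
        omega
    have h2 := Finset.sum_le_sum h1
    rw [Finset.sum_add_distrib, Finset.sum_const, Finset.sum_ite_eq'] at h2
    rw [smul_eq_mul] at h2
    split_ifs at h2 <;> omega
  have hup : ∑ C ∈ F, eOut G C ≤ 3 * U.card := by
    calc ∑ C ∈ F, eOut G C ≤ ∑ C ∈ F, ∑ x ∈ C, ∑ y ∈ U, (if G.Adj x y then 1 else 0) := by
          refine Finset.sum_le_sum fun C hC => Finset.sum_le_sum fun x hx => ?_
          rw [← Finset.card_filter]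
          apply Finset.card_le_card
          intro y hy
          simp only [Finset.mem_filter, Finset.mem_univ, true_and] at hy ⊢
          exact ⟨hout C hC x hx y hy.1 hy.2, hy.1⟩
      _ = ∑ x ∈ F.biUnion id, ∑ y ∈ U, (if G.Adj x y then 1 else 0) := by
          rw [Finset.sum_biUnion hdisj]; rfl
      _ ≤ ∑ x, ∑ y ∈ U, (if G.Adj x y then 1 else 0) :=
          Finset.sum_le_sum_of_subset (Finset.subset_univ _)
      _ = ∑ y ∈ U, vdeg G y := by
          rw [Finset.sum_comm]
          refine Finset.sum_congr rfl fun y _ => ?_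
          rw [vdeg_eq, Finset.card_filter]
          simp only [SimpleGraph.adj_comm]
      _ ≤ ∑ y ∈ U, 3 := Finset.sum_le_sum fun y _ => hd3 y
      _ = 3 * U.card := by rw [Finset.sum_const, smul_eq_mul, mul_comm]
  omega

open Classical in
theorem exists_pm {V : Type*} [Fintype V] (G : SimpleGraph V) (v : V)
    (hv1 : vdeg G v = 1) (h3 : ∀ w, w ≠ v → vdeg G w = 3)
    (h2 : TwoConnected (G.induce {x | x ≠ v})) : ∃ M : G.Subgraph, M.IsPerfectMatching := by
  rw [SimpleGraph.tutte]
  intro u hu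
  unfold SimpleGraph.IsTutteViolator at hu
  let S := {c : ((⊤ : G.Subgraph).deleteVerts u).coe.ConnectedComponent | Odd c.supp.ncard}
  let f : ((⊤ : G.Subgraph).deleteVerts u).coe.ConnectedComponent → Finset V :=
    fun c => (Subtype.val '' c.supp).toFinset
  have hmem : ∀ c x, x ∈ f c ↔ ∃ h : x ∈ ((⊤ : G.Subgraph).deleteVerts u).verts,
      ((⊤ : G.Subgraph).deleteVerts u).coe.connectedComponentMk ⟨x, h⟩ = c := by
    intro c x
    simp only [f, Set.mem_toFinset, Set.mem_image, SimpleGraph.ConnectedComponent.mem_supp_iff]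
    constructor
    · rintro ⟨y, hy, rfl⟩
      exact ⟨y.2, hy⟩
    · rintro ⟨h, hc⟩
      exact ⟨⟨x, h⟩, hc, rfl⟩
  have hinj : Function.Injective f := by
    intro c d hcd
    obtain ⟨x, hx⟩ := c.nonempty_supp
    have h1 : x.1 ∈ f c := (hmem _ _).2 ⟨x.2, hx⟩
    rw [hcd] at h1
    obtain ⟨_, h⟩ := (hmem _ _).1 h1
    exact hx.symm.trans h
  have hb := family_bound G v hv1 h3 h2 u.toFinset (S.toFinset.image f) ?_ ?_ ?_ ?_
  · rw [Finset.card_image_of_injective _ hinj, ← Set.ncard_eq_toFinset_card',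
      ← Set.ncard_eq_toFinset_card'] at hb
    exact absurd hu (not_lt.2 hb)
  · intro C hC D hD hne
    simp only [Finset.coe_image, Set.mem_image] at hC hD
    obtain ⟨c, -, rfl⟩ := hC
    obtain ⟨d, -, rfl⟩ := hD
    simp only [Function.onFun, id]
    rw [Finset.disjoint_left]
    intro x hx hx'
    obtain ⟨_, h⟩ := (hmem _ _).1 hx
    obtain ⟨_, h'⟩ := (hmem _ _).1 hx'
    exact hne (by rw [← h, ← h'])
  · intro C hC
    simp only [Finset.mem_image, Set.mem_toFinset] at hC
    obtain ⟨c, hc, rfl⟩ := hC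
    have : (f c).card = c.supp.ncard := by
      simp only [f]
      rw [← Set.ncard_eq_toFinset_card', Set.ncard_image_of_injective _ Subtype.val_injective]
    rw [this]
    exact hc
  · intro C hC
    simp only [Finset.mem_image] at hC
    obtain ⟨c, hc, rfl⟩ := hC
    rw [Finset.disjoint_left]
    intro x hx hxu
    obtain ⟨h, _⟩ := (hmem _ _).1 hx
    simp at h hxu
    exact h hxu
  · intro C hC x hx y hxy hy
    simp only [Finset.mem_image] at hC
    obtain ⟨c, hc, rfl⟩ := hC
    obtain ⟨h, hcx⟩ := (hmem _ _).1 hx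
    by_contra hyu
    apply hy
    have hy' : y ∈ ((⊤ : G.Subgraph).deleteVerts u).verts := by simpa using hyu
    refine (hmem _ _).2 ⟨hy', ?_⟩
    rw [← hcx]
    apply SimpleGraph.ConnectedComponent.sound
    apply SimpleGraph.Adj.reachable
    simp only [SimpleGraph.Subgraph.coe_adj, SimpleGraph.Subgraph.deleteVerts_adj]
    simp at h hyu
    simp [h, hyu, hxy.symm]

/-- A semicubic graph (every vertex of degree 1 or 3) with exactly one pendent vertex `v`
such that `G - v` is 2-connected has a (1,2)-decomposition. -/
theorem oneTwoDecomposition_of_semicubic {V : Type*} [Fintype V] (G : SimpleGraph V)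
    (hsemi : ∀ w, vdeg G w = 1 ∨ vdeg G w = 3)
    (v : V) (hv : vdeg G v = 1) (huniq : ∀ w, vdeg G w = 1 → w = v)
    (h2 : TwoConnected (G.induce {x | x ≠ v})) :
    ∃ E₁ E₂ : Set (Sym2 V), IsOneTwoDecomposition G E₁ E₂ := by
  classical
  obtain ⟨M, hM⟩ := exists_pm G v hv
    (fun w hw => (hsemi w).resolve_left fun h => hw (huniq w h)) h2
  rw [SimpleGraph.Subgraph.isPerfectMatching_iff] at hM
  have hone : ∀ v : V, {e | e ∈ M.edgeSet ∧ v ∈ e}.ncard = 1 := by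
    intro x
    obtain ⟨w, hw, hu⟩ := hM x
    rw [Set.ncard_eq_one]
    refine ⟨s(x, w), ?_⟩
    ext e
    simp only [Set.mem_ofPred_eq, Set.mem_singleton_iff]
    constructor
    · rintro ⟨he, hx⟩
      obtain ⟨y, rfl⟩ := hx
      rw [hu y (by simpa using he)]
    · rintro rfl
      exact ⟨by simpa using hw, by simp⟩
  refine ⟨M.edgeSet, G.edgeSet \ M.edgeSet, ?_, Set.disjoint_sdiff_right, hone, ?_⟩
  · exact Set.union_sdiff_cancel M.edgeSet_subset
  · intro x
    have hG : {e | e ∈ G.edgeSet ∧ x ∈ e}.ncard = vdeg G x := by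
      unfold vdeg
      exact Nat.card_congr (G.incidenceSetEquivNeighborSet x)
    have hd : {e | e ∈ G.edgeSet \ M.edgeSet ∧ x ∈ e} =
        {e | e ∈ G.edgeSet ∧ x ∈ e} \ {e | e ∈ M.edgeSet ∧ x ∈ e} := by
      ext e
      simp only [Set.mem_ofPred_eq, Set.mem_sdiff]
      tauto
    have hsub : {e | e ∈ M.edgeSet ∧ x ∈ e} ⊆ {e | e ∈ G.edgeSet ∧ x ∈ e} :=
      fun e he => ⟨M.edgeSet_subset he.1, he.2⟩
    rw [hd, Set.ncard_sdiff hsub (Set.toFinite _), hone, hG]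
    rcases hsemi x with h | h <;> rw [h] <;> simp
end

section
/- For every cycle C of length n ≥ 3, the incidence choice number satisfies ch_i(C) ≤ 4; moreover, ch_i(C) = 3 if and only if n is a multiple of 3. -/
def CycCol (n : ℕ) [NeZero n] (LA LB : Fin n → Finset ℕ) : Prop :=
  ∃ a b : Fin n → ℕ, ∀ i, a i ∈ LA i ∧ b i ∈ LB i ∧ a i ≠ b i ∧ b i ≠ a (i + 1) ∧
    a i ≠ a (i + 1) ∧ b i ≠ b (i + 1)
theorem cyc_greedy_seq (K : ℕ → Finset ℕ) (hK : ∀ i, (K i).card = 4) (c0 c3 : ℕ) :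
    ∃ g : ℕ → ℕ, g 0 = c3 ∧ (∀ j, g (j + 1) ∈ K (j + 1)) ∧ (∀ j, g (j + 1) ≠ g j) ∧
      (∀ j, g (j + 1) ≠ c0) ∧ (∀ j, g (j + 2) ≠ g j) := by
  have hpick : ∀ (i : ℕ) (p q : ℕ), ∃ r, r ∈ K i ∧ r ≠ p ∧ r ≠ q ∧ r ≠ c0 := by
    intro i p q
    have h : ({p, q, c0} : Finset ℕ).card < (K i).card := by
      rw [hK]; exact lt_of_le_of_lt Finset.card_le_three (by norm_num)
    obtain ⟨r, h1, h2⟩ := Finset.exists_mem_notMem_of_card_lt_card h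
    simp at h2
    exact ⟨r, h1, h2.1, h2.2.1, h2.2.2⟩
  choose r h1 h2 h3 h4 using hpick
  let st : ℕ → ℕ × ℕ := fun j => Nat.rec (c3, c0) (fun j s => (r (j + 1) s.1 s.2, s.1)) j
  have hst : ∀ j, st (j + 1) = (r (j + 1) (st j).1 (st j).2, (st j).1) := fun j => rfl
  refine ⟨fun j => (st j).1, rfl, ?_, ?_, ?_, ?_⟩
  · intro j; simp only [hst]; exact h1 _ _ _
  · intro j; simp only [hst]; exact h2 _ _ _
  · intro j; simp only [hst]; exact h4 _ _ _
  · intro j; simp only [hst]; exact h3 _ _ _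

theorem cyc_pick (A : Finset ℕ) (hA : A.card = 4) (B : Finset ℕ) (hB : B.card < 4) :
    ∃ r ∈ A, r ∉ B := Finset.exists_mem_notMem_of_card_lt_card (by omega)

theorem cyc_greedy (m : ℕ) (hm : 6 ≤ m) (K : ℕ → Finset ℕ) (hK : ∀ i, (K i).card = 4) :
    ∃ c : ℕ → ℕ, ∀ p < m, c p ∈ K p ∧ c p ≠ c ((p + 1) % m) ∧ c p ≠ c ((p + 2) % m) := by
  -- choose colors of 0 and 3
  obtain ⟨c0, c3, h0, h3, hs⟩ : ∃ c0 c3, c0 ∈ K 0 ∧ c3 ∈ K 3 ∧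
      (c0 = c3 ∨ c0 ∉ K 1 ∨ c3 ∉ K 1) := by
    by_cases h : Disjoint (K 0) (K 3)
    · have hc : (K 1).card < (K 0 ∪ K 3).card := by
        rw [Finset.card_union_of_disjoint h, hK, hK, hK]; norm_num
      obtain ⟨r, hr, hr1⟩ := Finset.exists_mem_notMem_of_card_lt_card hc
      obtain ⟨x, hx⟩ : (K 0).Nonempty := Finset.card_pos.1 (by rw [hK]; norm_num)
      obtain ⟨y, hy⟩ : (K 3).Nonempty := Finset.card_pos.1 (by rw [hK]; norm_num)
      rcases Finset.mem_union.1 hr with hr | hr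
      · exact ⟨r, y, hr, hy, Or.inr (Or.inl hr1)⟩
      · exact ⟨x, r, hx, hr, Or.inr (Or.inr hr1)⟩
    · obtain ⟨x, hx, hy⟩ := Finset.not_disjoint_iff.1 h
      exact ⟨x, x, hx, hy, Or.inl rfl⟩
  obtain ⟨g, g0, gK, g1, gc, g2⟩ := cyc_greedy_seq (fun j => K (j + 3)) (fun j => hK _) c0 c3
  obtain ⟨c2, h2, h2'⟩ := cyc_pick (K 2) (hK 2) {c0, c3, g 1}
    (lt_of_le_of_lt Finset.card_le_three (by norm_num))
  obtain ⟨c1, h1, h1'⟩ : ∃ r ∈ K 1, r ∉ ({c0, c3, c2, g (m - 4)} : Finset ℕ) := by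
    rcases hs with rfl | hs | hs
    · obtain ⟨r, hr, hr'⟩ := cyc_pick (K 1) (hK 1) {c0, c2, g (m - 4)}
        (lt_of_le_of_lt Finset.card_le_three (by norm_num))
      exact ⟨r, hr, by simpa using hr'⟩
    · obtain ⟨r, hr, hr'⟩ := cyc_pick (K 1) (hK 1) {c3, c2, g (m - 4)}
        (lt_of_le_of_lt Finset.card_le_three (by norm_num))
      refine ⟨r, hr, ?_⟩
      rw [Finset.mem_insert, not_or]
      exact ⟨fun h => hs (h ▸ hr), hr'⟩
    · obtain ⟨r, hr, hr'⟩ := cyc_pick (K 1) (hK 1) {c0, c2, g (m - 4)}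
        (lt_of_le_of_lt Finset.card_le_three (by norm_num))
      refine ⟨r, hr, ?_⟩
      rw [Finset.insert_comm, Finset.mem_insert, not_or]
      exact ⟨fun h => hs (h ▸ hr), hr'⟩
  simp only [Finset.mem_insert, Finset.mem_singleton, not_or] at h1' h2'
  let c : ℕ → ℕ := fun p => if p = 0 then c0 else if p = 1 then c1 else if p = 2 then c2 else
    g (p - 3)
  have cc0 : c 0 = c0 := rfl
  have cc1 : c 1 = c1 := rfl
  have cc2 : c 2 = c2 := rfl
  have cc : ∀ j, c (j + 3) = g j := fun j => by simp [c]
  refine ⟨c, fun p hp => ?_⟩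
  have small : ∀ q, q < m → q % m = q := fun q h => Nat.mod_eq_of_lt h
  rcases p with _ | _ | _ | j
  · rw [small _ (by omega), small _ (by omega)]
    simp only [zero_add, cc0, cc1, cc2]
    exact ⟨h0, fun h => h1'.1 h.symm, fun h => h2'.1 h.symm⟩
  · rw [small _ (by omega), small _ (by omega)]
    simp only [zero_add, Nat.reduceAdd, cc1, cc2, cc 0, g0]
    exact ⟨h1, fun h => h1'.2.2.1 h, fun h => h1'.2.1 h⟩
  · rw [small _ (by omega), small _ (by omega)]
    have := cc 0
    have := cc 1
    simp only [zero_add, Nat.reduceAdd, cc2] at *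
    rw [cc 0, cc 1, g0]
    exact ⟨h2, h2'.2.1, h2'.2.2⟩
  · change c (j + 3) ∈ _ ∧ c (j + 3) ≠ c ((j + 3 + 1) % m) ∧ c (j + 3) ≠ c ((j + 3 + 2) % m)
    have hmem : c (j + 3) ∈ K (j + 3) := by
      rw [cc]
      rcases j with _ | j
      · rw [g0]; exact h3
      · exact gK j
    refine ⟨hmem, ?_, ?_⟩
    · by_cases h : j + 3 + 1 < m
      · rw [small _ h, show j + 3 + 1 = (j + 1) + 3 by ring, cc, cc]
        exact (g1 j).symm
      · have e : j + 3 + 1 = m := by omega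
        rw [e, Nat.mod_self, cc0, cc]
        obtain ⟨i, rfl⟩ : ∃ i, j = i + 1 := ⟨j - 1, by omega⟩
        exact gc i
    · by_cases h : j + 3 + 2 < m
      · rw [small _ h, show j + 3 + 2 = (j + 2) + 3 by ring, cc, cc]
        exact (g2 j).symm
      · obtain ⟨i, rfl⟩ : ∃ i, j = i + 1 := ⟨j - 1, by omega⟩
        by_cases e : i + 1 + 3 + 2 = m
        · rw [e, Nat.mod_self, cc0, cc]
          exact gc i
        · have e' : i + 1 + 3 + 2 = 1 + m := by omega
          rw [e', Nat.add_mod_right, small 1 (by omega), cc1, cc]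
          have : m - 4 = i + 1 := by omega
          rw [this] at h1'
          exact fun h => h1'.2.2.2 h.symm

theorem cycCol_four (m : ℕ) (LA LB : Fin (m + 3) → Finset ℕ) (hA : ∀ i, (LA i).card = 4)
    (hB : ∀ i, (LB i).card = 4) : CycCol (m + 3) LA LB := by
  obtain ⟨c, hc⟩ := cyc_greedy (2 * (m + 3)) (by omega)
    (fun p => if p % 2 = 0 then LA (Fin.ofNat _ (p / 2)) else LB (Fin.ofNat _ (p / 2)))
    (by intro i; split_ifs <;> simp [hA, hB])
  refine ⟨fun i => c (2 * i.val), fun i => c (2 * i.val + 1), fun i => ?_⟩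
  have h1 := hc (2 * i.val) (by omega)
  have h2 := hc (2 * i.val + 1) (by omega)
  have d1 : (2 * i.val) % 2 = 0 := by omega
  have d2 : (2 * i.val + 1) % 2 ≠ 0 := by omega
  have d3 : (2 * i.val) / 2 = i.val := by omega
  have d4 : (2 * i.val + 1) / 2 = i.val := by omega
  have d5 : Fin.ofNat (m + 3) i.val = i := by simp
  have s1 : (2 * i.val + 1) % (2 * (m + 3)) = 2 * i.val + 1 := Nat.mod_eq_of_lt (by omega)
  have v : (i + 1).val = (i.val + 1) % (m + 3) := by simp [Fin.val_add]
  have s2 : (2 * i.val + 2) % (2 * (m + 3)) = 2 * (i + 1).val := by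
    rw [v, ← Nat.mul_mod_mul_left]; ring_nf
  have s3 : (2 * i.val + 1 + 2) % (2 * (m + 3)) = 2 * (i + 1).val + 1 := by
    by_cases h : i.val + 1 < m + 3
    · rw [v, Nat.mod_eq_of_lt h, Nat.mod_eq_of_lt (by omega)]; ring
    · have : i.val + 1 = m + 3 := by omega
      rw [v, this, Nat.mod_self, show 2 * i.val + 1 + 2 = 1 + 2 * (m + 3) by omega,
        Nat.add_mod_right, Nat.mod_eq_of_lt (by omega)]
  simp only [d1, d2, d3, d4, d5, if_true, if_false, s1, s2, s3,
    show 2 * i.val + 1 + 1 = 2 * i.val + 2 by ring] at h1 h2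
  exact ⟨h1.1, h2.1, h1.2.1, h2.2.1, h1.2.2, h2.2.2⟩

theorem cycCol_dvd (m : ℕ) (h : CycCol (m + 3) (fun _ => Finset.range 3) (fun _ => Finset.range 3)) :
    3 ∣ m + 3 := by
  obtain ⟨a, b, h⟩ := h
  simp only [Finset.mem_range] at h
  let A : ℕ → ℕ := fun j => a (Fin.ofNat _ j)
  let B : ℕ → ℕ := fun j => b (Fin.ofNat _ j)
  have hs : ∀ j, Fin.ofNat (m + 3) j + 1 = Fin.ofNat (m + 3) (j + 1) := by
    intro j; ext; simp [Fin.val_add]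
  have hAB : ∀ j, A j < 3 ∧ B j < 3 ∧ A j ≠ B j ∧ B j ≠ A (j + 1) ∧
    A j ≠ A (j + 1) ∧ B j ≠ B (j + 1) := by
    intro j
    have := h (Fin.ofNat _ j)
    rw [hs] at this
    exact this
  have hper : ∀ j, A (3 * j) = A 0 ∧ B (3 * j) = B 0 := by
    intro j
    induction j with
    | zero => simp
    | succ j ih =>
      have h0 := hAB (3 * j)
      have h1 := hAB (3 * j + 1)
      have h2 := hAB (3 * j + 2)
      have h3 := hAB (3 * j + 3)
      have e : 3 * (j + 1) = 3 * j + 3 := by ring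
      rw [e]
      simp only [add_assoc, Nat.reduceAdd] at *
      omega
  have hn : A (m + 3) = A 0 := by
    have : Fin.ofNat (m + 3) (m + 3) = Fin.ofNat (m + 3) 0 := by ext; simp
    simp only [A, this]
  by_contra hd
  have hq := hper ((m + 3) / 3)
  set q := (m + 3) / 3 with hqd
  have h0 := hAB (3 * q)
  have h1 := hAB (3 * q + 1)
  have h2 := hAB (3 * q + 2)
  have : m + 3 = 3 * q + 1 ∨ m + 3 = 3 * q + 2 := by omega
  simp only [add_assoc, Nat.reduceAdd] at *
  rcases this with e | e <;> rw [e] at hn <;> omega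

theorem cycCol_lt (m k : ℕ) (hk : k < 3)
    (h : CycCol (m + 3) (fun _ => Finset.range k) (fun _ => Finset.range k)) : False := by
  obtain ⟨a, b, h⟩ := h
  simp only [Finset.mem_range] at h
  have h0 := h 0
  have h1 := h (0 + 1)
  omega

theorem cyc_two_ne (m : ℕ) (v : Fin (m + 3)) : v + 1 + 1 ≠ v := by
  intro h
  rw [add_assoc] at h
  have h2 : (1 + 1 : Fin (m + 3)) = 0 := by simpa using h
  have := congrArg Fin.val h2
  rw [Fin.val_add] at this
  simp only [Fin.val_one, Fin.val_zero, Nat.reduceAdd] at this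
  rw [Nat.mod_eq_of_lt (by omega)] at this
  omega

theorem cyc_one_ne (m : ℕ) (v : Fin (m + 3)) : v + 1 ≠ v := by
  simp

theorem cyc_inc (m : ℕ) (v : Fin (m + 3)) (e : Sym2 (Fin (m + 3))) :
    IsIncidence (SimpleGraph.cycleGraph (m + 3)) v e ↔
      e = s(v, v + 1) ∨ ∃ u, u + 1 = v ∧ e = s(u, u + 1) := by
  unfold IsIncidence
  induction e with | _ x y =>
  rw [SimpleGraph.mem_edgeSet, SimpleGraph.cycleGraph_adj (n := m + 1), Sym2.mem_iff,
    sub_eq_iff_eq_add', sub_eq_iff_eq_add']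
  constructor
  · rintro ⟨h | h, rfl | rfl⟩ <;> subst h
    · right; exact ⟨y, rfl, Sym2.eq_swap⟩
    · left; exact Sym2.eq_swap
    · left; rfl
    · right; exact ⟨x, rfl, rfl⟩
  · rintro (h | ⟨u, rfl, h⟩) <;> rw [Sym2.eq_iff] at h <;>
      rcases h with ⟨rfl, rfl⟩ | ⟨rfl, rfl⟩ <;> simp

theorem cyc_choosable (m k : ℕ) : IncChoosable (SimpleGraph.cycleGraph (m + 3)) k ↔
    ∀ LA LB : Fin (m + 3) → Finset ℕ, (∀ i, (LA i).card = k) → (∀ i, (LB i).card = k) →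
      CycCol (m + 3) LA LB := by
  have t2 := cyc_two_ne m
  have t1 := cyc_one_ne m
  have hinj : ∀ u v : Fin (m + 3), s(u, u + 1) = s(v, v + 1) → u = v := by
    intro u v h
    rw [Sym2.eq_iff] at h
    rcases h with ⟨h, _⟩ | ⟨h, h'⟩
    · exact h
    · subst h; exact absurd h' (t2 v)
  have hB : ∀ v, IsIncidence (SimpleGraph.cycleGraph (m + 3)) v s(v, v + 1) := fun v =>
    (cyc_inc m v _).2 (Or.inl rfl)
  have hA : ∀ v, IsIncidence (SimpleGraph.cycleGraph (m + 3)) (v + 1) s(v, v + 1) := fun v =>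
    (cyc_inc m (v + 1) _).2 (Or.inr ⟨v, rfl, rfl⟩)
  constructor
  · intro h LA LB hLA hLB
    obtain ⟨φ, h1, h2⟩ := h (fun p => if p.2 = s(p.1, p.1 + 1) then LB p.1 else LA p.1)
      (by intro v e _; dsimp only; split_ifs <;> simp [hLA, hLB])
    refine ⟨fun i => φ (i, s(i - 1, i - 1 + 1)), fun i => φ (i, s(i, i + 1)), fun i => ?_⟩
    obtain ⟨j, rfl⟩ : ∃ j, i = j + 1 := ⟨i - 1, by simp⟩
    simp only [add_sub_cancel_right]
    refine ⟨?_, ?_, ?_, ?_, ?_, ?_⟩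
    · have := h1 _ _ (hA j)
      simp only at this
      rw [if_neg] at this
      · exact this
      · intro h; exact t1 j (hinj _ _ h).symm
    · have := h1 _ _ (hB (j + 1))
      simpa using this
    · refine h2 _ _ _ _ (hA j) (hB (j + 1)) ?_ (Or.inl rfl)
      intro h; exact t1 j (hinj _ _ (Prod.ext_iff.1 h).2).symm
    · refine h2 _ _ _ _ (hB (j + 1)) (hA (j + 1)) ?_ (Or.inr (Or.inl rfl))
      intro h; exact t1 (j + 1) (Prod.ext_iff.1 h).1.symm
    · refine h2 _ _ _ _ (hA j) (hA (j + 1)) ?_ (Or.inr (Or.inr (Or.inr rfl)))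
      intro h; exact t1 (j + 1) (Prod.ext_iff.1 h).1.symm
    · refine h2 _ _ _ _ (hB (j + 1)) (hB (j + 1 + 1)) ?_ (Or.inr (Or.inr (Or.inl rfl)))
      intro h; exact t1 (j + 1) (Prod.ext_iff.1 h).1.symm
  · intro h L hL
    obtain ⟨a, b, hab⟩ := h (fun i => L (i, s(i - 1, i - 1 + 1))) (fun i => L (i, s(i, i + 1)))
      (by intro i; apply hL; have := hA (i - 1); simpa using this) (fun i => hL _ _ (hB i))
    have hm : ∀ u v : Fin (m + 3), s(u, u + 1) = s(v, v + 1) ↔ u = v :=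
      fun u v => ⟨hinj u v, fun h => by rw [h]⟩
    have ab : ∀ i, a i ≠ b i := fun i => (hab i).2.2.1
    have ba : ∀ i, b i ≠ a (i + 1) := fun i => (hab i).2.2.2.1
    have aa : ∀ i, a i ≠ a (i + 1) := fun i => (hab i).2.2.2.2.1
    have bb : ∀ i, b i ≠ b (i + 1) := fun i => (hab i).2.2.2.2.2
    have vB : ∀ v, (if s(v, v + 1) = s(v, v + 1) then b v else a v) = b v := fun v => if_pos rfl
    have vA : ∀ v, (if s(v, v + 1) = s(v + 1, v + 1 + 1) then b (v + 1) else a (v + 1))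
        = a (v + 1) := fun v => if_neg (fun h => t1 v (hinj _ _ h).symm)
    have hcan : ∀ u v : Fin (m + 3), u + 1 = v + 1 → u = v := fun u v h => add_right_cancel h
    refine ⟨fun p => if p.2 = s(p.1, p.1 + 1) then b p.1 else a p.1, ?_, ?_⟩
    · intro v e hve
      rcases (cyc_inc m v e).1 hve with rfl | ⟨u, rfl, rfl⟩
      · simp only [vB]; exact (hab v).2.1
      · simp only [vA]; have := (hab (u + 1)).1; simpa using this
    · intro v e w f hve hwf hne hadj
      rcases (cyc_inc m v e).1 hve with rfl | ⟨u, rfl, rfl⟩ <;>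
      rcases (cyc_inc m w f).1 hwf with rfl | ⟨x, rfl, rfl⟩ <;>
      simp only [vA, vB] <;> unfold IncAdj at hadj <;>
      simp only [Sym2.eq_iff, ne_eq, Prod.mk.injEq] at hadj hne ⊢ <;> grind
abbrev CycSt := Bool × Bool × Bool × Bool
def cycB (b : Bool) : ℕ := if b then 1 else 0
def cycAl (s : CycSt) : ℕ := cycB (!s.1) + cycB (!s.2.2.2)
def cycBe (s : CycSt) : ℕ := cycB (!s.2.1) + cycB (!s.2.2.1) + cycB s.2.2.2
def cycGa (s : CycSt) : ℕ := cycB s.1 + cycB s.2.2.1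
def cycDe (s : CycSt) : ℕ := cycB s.2.1
def cycSg (s : CycSt) : ℤ := (-1) ^ (cycB s.1 + cycB s.2.1 + cycB s.2.2.1 + cycB s.2.2.2)

def cycW : Matrix CycSt CycSt ℤ := fun s u =>
  if cycGa s + cycAl u = 2 ∧ cycDe s + cycBe u = 2 then cycSg s else 0

def cycP : Matrix CycSt (Fin 3 × Fin 2) ℤ := fun s t =>
  if cycGa s = t.1.val ∧ cycDe s = t.2.val then cycSg s else 0

def cycQ : Matrix (Fin 3 × Fin 2) CycSt ℤ := fun t u =>
  if t.1.val + cycAl u = 2 ∧ t.2.val + cycBe u = 2 then 1 else 0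

def cycN : Matrix (Fin 3 × Fin 2) (Fin 3 × Fin 2) ℤ := fun t v =>
  (!![1, 0, 0, 0, 0, 0; 0, -1, -1, 0, 0, 0; 0, 1, 0, 0, 0, 0; 0, 0, 0, 0, 1, 0; 0, 0, 0, -1, -1, 0; 0, 0, 0, 0, 0, 1] : Matrix (Fin 6) (Fin 6) ℤ) (finProdFinEquiv t) (finProdFinEquiv v)

theorem cycP_mul : cycP * cycQ = cycW := by decide +kernel

theorem cycQ_mul : cycQ * cycP = cycN := by decide +kernel

theorem cycN_three : cycN * cycN * cycN = 1 := by decide +kernel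

theorem cycW_pow (k : ℕ) : (cycW ^ (3 * (k + 1))).trace = 6 := by
  have h : ∀ j, cycW ^ (j + 1) = cycP * cycN ^ j * cycQ := by
    intro j
    induction j with
    | zero => simp [cycP_mul]
    | succ j ih =>
      rw [pow_succ, ih, pow_succ, ← cycP_mul, ← cycQ_mul]
      simp only [Matrix.mul_assoc]
  have h3 : cycN ^ 3 = 1 := by rw [← cycN_three]; simp [pow_succ]
  rw [show 3 * (k + 1) = (3 * k + 2) + 1 by ring, h, Matrix.trace_mul_comm, ← Matrix.mul_assoc,
    cycQ_mul, ← pow_succ', show 3 * k + 2 + 1 = 3 * (k + 1) by ring, pow_mul, h3, one_pow,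
    Matrix.trace_one]
  simp

theorem cyc_expand (x y x' y' : ℚ) :
    (x - x') * (y - y') * (y - x') * (x - y) =
      ∑ s : CycSt, (cycSg s : ℚ) * (x ^ cycAl s * y ^ cycBe s * x' ^ cycGa s * y' ^ cycDe s) := by
  simp [Fintype.sum_prod_type, cycSg, cycAl, cycBe, cycGa, cycDe, cycB]
  ring

theorem cyc_path {S : Type*} [Fintype S] [DecidableEq S] (W : Matrix S S ℤ) (k : ℕ) :
    ∀ f : S → S → ℤ, ∑ s : Fin (k + 1) → S, f (s 0) (s (Fin.last k)) *
      ∏ i : Fin k, W (s i.castSucc) (s i.succ) = ∑ u, ∑ v, f u v * (W ^ k) u v := by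
  induction k with
  | zero =>
    intro f
    simp only [Finset.univ_eq_empty, Finset.prod_empty, mul_one, pow_zero, Matrix.one_apply,
      mul_ite, mul_zero, Finset.sum_ite_eq, Finset.mem_univ, if_true]
    exact Fintype.sum_equiv (Equiv.funUnique (Fin 1) S) _ _ (fun s => by simp)
  | succ k ih =>
    intro f
    rw [← (Fin.consEquiv (fun _ => S)).sum_comp, Fintype.sum_prod_type]
    refine Finset.sum_congr rfl fun u _ => ?_
    have := ih (fun a b => f u b * W u a)
    simp only [Fin.consEquiv_apply, Fin.prod_univ_succ, Fin.cons_zero, Fin.castSucc_zero,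
      Fin.cons_succ, ← Fin.succ_last]
    trans ∑ a, ∑ b, f u b * W u a * (W ^ k) a b
    · rw [← this]
      refine Finset.sum_congr rfl fun s _ => ?_
      simp only [← Fin.succ_castSucc, Fin.cons_succ]
      ring
    · rw [Finset.sum_comm]
      refine Finset.sum_congr rfl fun v _ => ?_
      rw [pow_succ', Matrix.mul_apply, Finset.mul_sum]
      refine Finset.sum_congr rfl fun a _ => ?_
      ring

theorem cyc_trace {S : Type*} [Fintype S] [DecidableEq S] (W : Matrix S S ℤ) (k : ℕ) :
    ∑ s : Fin (k + 1) → S, ∏ i, W (s i) (s (i + 1)) = (W ^ (k + 1)).trace := by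
  have := cyc_path W k (fun u v => W v u)
  trans ∑ u, ∑ v, W v u * (W ^ k) u v
  · rw [← this]
    refine Finset.sum_congr rfl fun s _ => ?_
    rw [Fin.prod_univ_castSucc]
    simp [mul_comm]
  · rw [pow_succ, Matrix.trace]
    simp [Matrix.mul_apply, mul_comm]

theorem cyc_weights (X : Finset ℚ) (hX : X.card = 3) : ∃ w : ℚ → ℚ,
    ∑ x ∈ X, w x * x ^ 0 = 0 ∧ ∑ x ∈ X, w x * x ^ 1 = 0 ∧ ∑ x ∈ X, w x * x ^ 2 = 1 := by
  obtain ⟨a, b, c, hab, hac, hbc, rfl⟩ := Finset.card_eq_three.1 hX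
  refine ⟨fun x => if x = a then 1 / ((a - b) * (a - c)) else
    if x = b then 1 / ((b - a) * (b - c)) else 1 / ((c - a) * (c - b)), ?_⟩
  have h1 := sub_ne_zero.2 hab
  have h2 := sub_ne_zero.2 hac
  have h3 := sub_ne_zero.2 hbc
  have h1' := sub_ne_zero.2 hab.symm
  have h2' := sub_ne_zero.2 hac.symm
  have h3' := sub_ne_zero.2 hbc.symm
  have e1 : b - a = -(a - b) := by ring
  have e2 : c - a = -(a - c) := by ring
  have e3 : c - b = -(b - c) := by ring
  have m1 : a ∉ ({b, c} : Finset ℚ) := by simp [hab, hac]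
  have m2 : b ∉ ({c} : Finset ℚ) := by simp [hbc]
  simp only [Finset.sum_insert m1, Finset.sum_insert m2, Finset.sum_singleton, if_true,
    hab.symm, hac.symm, hbc.symm, if_false]
  rw [e1, e2, e3]
  refine ⟨?_, ?_, ?_⟩ <;> field_simp <;> ring

theorem cyc_deg (s : CycSt) : cycAl s + cycGa s + (cycBe s + cycDe s) = 4 := by
  revert s; decide

theorem cyc_null (k : ℕ) (X Y : Fin (k + 1) → Finset ℚ)
    (hX : ∀ i, (X i).card = 3) (hY : ∀ i, (Y i).card = 3)
    (hW : (cycW ^ (k + 1)).trace ≠ 0) :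
    ∃ x y : Fin (k + 1) → ℚ, (∀ i, x i ∈ X i) ∧ (∀ i, y i ∈ Y i) ∧
      ∀ i, (x i - x (i + 1)) * (y i - y (i + 1)) * (y i - x (i + 1)) * (x i - y i) ≠ 0 := by
  choose wA hA0 hA1 hA2 using fun i => cyc_weights (X i) (hX i)
  choose wB hB0 hB1 hB2 using fun i => cyc_weights (Y i) (hY i)
  by_contra! hcon
  have hZ : ∑ x ∈ Fintype.piFinset X, ∑ y ∈ Fintype.piFinset Y, ∏ i, ((wA i (x i) * wB i (y i)) *
      ((x i - x (i + 1)) * (y i - y (i + 1)) * (y i - x (i + 1)) * (x i - y i))) = 0 := by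
    refine Finset.sum_eq_zero fun x hx => Finset.sum_eq_zero fun y hy => ?_
    obtain ⟨i, hi⟩ := hcon x y (by simpa using hx) (by simpa using hy)
    exact Finset.prod_eq_zero (Finset.mem_univ i) (by rw [hi, mul_zero])
  apply hW
  have hsh : ∀ f : Fin (k + 1) → ℚ, ∏ i, f (i + 1) = ∏ i, f i :=
    fun f => Equiv.prod_comp (Equiv.addRight (1 : Fin (k + 1))) f
  have hshn : ∀ f : Fin (k + 1) → ℕ, ∑ i, f (i + 1) = ∑ i, f i :=
    fun f => Equiv.sum_comp (Equiv.addRight (1 : Fin (k + 1))) f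
  have key : ∀ s : Fin (k + 1) → CycSt,
      ∑ x ∈ Fintype.piFinset X, ∑ y ∈ Fintype.piFinset Y, ∏ i, ((wA i (x i) * wB i (y i)) *
        ((cycSg (s i) : ℚ) * (x i ^ cycAl (s i) * y i ^ cycBe (s i) *
          x (i + 1) ^ cycGa (s i) * y (i + 1) ^ cycDe (s i)))) =
      ((∏ i, cycW (s i) (s (i + 1)) : ℤ) : ℚ) := by
    intro s
    trans ∑ x ∈ Fintype.piFinset X, ∑ y ∈ Fintype.piFinset Y, (∏ i, (cycSg (s i) : ℚ)) *
      ((∏ i, wA i (x i) * x i ^ (cycAl (s i) + cycGa (s (i - 1)))) *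
       (∏ i, wB i (y i) * y i ^ (cycBe (s i) + cycDe (s (i - 1)))))
    · refine Finset.sum_congr rfl fun x hx => Finset.sum_congr rfl fun y hy => ?_
      have e1 := hsh (fun i => x i ^ cycGa (s (i - 1)))
      have e2 := hsh (fun i => y i ^ cycDe (s (i - 1)))
      simp only [add_sub_cancel_right] at e1 e2
      simp only [Finset.prod_mul_distrib, pow_add, e1, e2]
      ring
    simp only [← Finset.mul_sum, ← Finset.sum_mul]
    rw [← Finset.prod_univ_sum X (fun i a => wA i a * a ^ (cycAl (s i) + cycGa (s (i - 1)))),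
      ← Finset.prod_univ_sum Y (fun i a => wB i a * a ^ (cycBe (s i) + cycDe (s (i - 1))))]
    rw [← hsh (fun i => ∑ a ∈ X i, wA i a * a ^ (cycAl (s i) + cycGa (s (i - 1)))),
      ← hsh (fun i => ∑ a ∈ Y i, wB i a * a ^ (cycBe (s i) + cycDe (s (i - 1))))]
    simp only [add_sub_cancel_right]
    have hzA : ∀ i m, m < 2 → ∑ a ∈ X i, wA i a * a ^ m = 0 := by
      intro i m hm
      interval_cases m
      · exact hA0 i
      · exact hA1 i
    have hzB : ∀ i m, m < 2 → ∑ a ∈ Y i, wB i a * a ^ m = 0 := by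
      intro i m hm
      interval_cases m
      · exact hB0 i
      · exact hB1 i
    by_cases hall : ∀ i, cycGa (s i) + cycAl (s (i + 1)) = 2 ∧ cycDe (s i) + cycBe (s (i + 1)) = 2
    · have a1 : ∀ i, ∑ a ∈ X (i + 1), wA (i + 1) a * a ^ (cycAl (s (i + 1)) + cycGa (s i)) = 1 := by
        intro i; rw [add_comm (cycAl _), (hall i).1]; exact hA2 _
      have a2 : ∀ i, ∑ a ∈ Y (i + 1), wB (i + 1) a * a ^ (cycBe (s (i + 1)) + cycDe (s i)) = 1 := by
        intro i; rw [add_comm (cycBe _), (hall i).2]; exact hB2 _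
      simp [a1, a2, cycW, hall]
    · have hr : ∏ i, cycW (s i) (s (i + 1)) = 0 := by
        push Not at hall
        obtain ⟨i, hi⟩ := hall
        refine Finset.prod_eq_zero (Finset.mem_univ i) ?_
        rw [cycW, if_neg]
        exact fun h => hi h.1 h.2
      rw [hr]
      have hsmall : ∃ i, cycAl (s (i + 1)) + cycGa (s i) < 2 ∨
          cycBe (s (i + 1)) + cycDe (s i) < 2 := by
        by_contra! hc
        apply hall
        have hsum : ∑ i : Fin (k + 1), ((cycAl (s (i + 1)) + cycGa (s i)) +
            (cycBe (s (i + 1)) + cycDe (s i))) = ∑ i : Fin (k + 1), 4 := by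
          rw [← Finset.sum_congr rfl (fun i _ => cyc_deg (s i))]
          have e1 := hshn (fun i => cycAl (s i))
          have e2 := hshn (fun i => cycBe (s i))
          simp only [Finset.sum_add_distrib, e1, e2]
        have := (Finset.sum_eq_sum_iff_of_le (s := Finset.univ)
          (f := fun _ : Fin (k + 1) => 4) (g := fun i => ((cycAl (s (i + 1)) + cycGa (s i)) +
            (cycBe (s (i + 1)) + cycDe (s i)))) (by
              intro i _; have := hc i; omega)).1 hsum.symm
        intro i
        have h1 := this i (Finset.mem_univ i)
        have h2 := hc i
        omega
      obtain ⟨i, hi | hi⟩ := hsmall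
      · rw [Finset.prod_eq_zero (f := fun i => ∑ a ∈ X (i + 1), wA (i + 1) a *
          a ^ (cycAl (s (i + 1)) + cycGa (s i))) (Finset.mem_univ i) (hzA _ _ hi)]
        simp
      · rw [Finset.prod_eq_zero (f := fun i => ∑ a ∈ Y (i + 1), wB (i + 1) a *
          a ^ (cycBe (s (i + 1)) + cycDe (s i))) (Finset.mem_univ i) (hzB _ _ hi)]
        simp
  have : ((cycW ^ (k + 1)).trace : ℚ) = 0 := by
    rw [← cyc_trace, ← hZ]
    push_cast
    simp only [cyc_expand, Finset.mul_sum]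
    have hps : ∀ F : Fin (k + 1) → CycSt → ℚ, ∏ i, ∑ s, F i s =
        ∑ s : Fin (k + 1) → CycSt, ∏ i, F i (s i) := by
      intro F
      rw [Finset.prod_univ_sum, Fintype.piFinset_univ]
    simp only [hps]
    rw [Finset.sum_congr rfl fun x _ => Finset.sum_comm, Finset.sum_comm]
    refine Finset.sum_congr rfl fun s _ => ?_
    rw [key s]
    push_cast
    rfl
  exact_mod_cast this

theorem cycCol_three (m : ℕ) (hd : 3 ∣ m + 3) (LA LB : Fin (m + 3) → Finset ℕ)
    (hA : ∀ i, (LA i).card = 3) (hB : ∀ i, (LB i).card = 3) : CycCol (m + 3) LA LB := by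
  have hW : (cycW ^ (m + 2 + 1)).trace ≠ 0 := by
    obtain ⟨q, hq⟩ := hd
    obtain ⟨k, rfl⟩ : ∃ k, q = k + 1 := ⟨q - 1, by omega⟩
    rw [show m + 2 + 1 = 3 * (k + 1) by omega, cycW_pow]
    norm_num
  have hc : ∀ S : Finset ℕ, S.card = 3 → (S.image (Nat.cast : ℕ → ℚ)).card = 3 := fun S h => by
    rw [Finset.card_image_of_injective _ Nat.cast_injective, h]
  obtain ⟨x, y, hx, hy, hxy⟩ := cyc_null (m + 2) (fun i => (LA i).image (Nat.cast : ℕ → ℚ))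
    (fun i => (LB i).image (Nat.cast : ℕ → ℚ)) (fun i => hc _ (hA i)) (fun i => hc _ (hB i)) hW
  simp only [Finset.mem_image] at hx hy
  choose a ha hax using hx
  choose b hb hby using hy
  refine ⟨a, b, fun i => ⟨ha i, hb i, ?_, ?_, ?_, ?_⟩⟩ <;> intro h <;> apply hxy i <;>
    rw [← hax i, ← hby i, ← hax (i + 1), ← hby (i + 1), h] <;> ring

/-- For every cycle of length `n ≥ 3`, the incidence choice number is at most 4, and it equals
3 if and only if `n` is a multiple of 3. -/
theorem incChoiceNumber_cycleGraph (n : ℕ) (hn : 3 ≤ n) :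
    incChoiceNumber (SimpleGraph.cycleGraph n) ≤ 4 ∧
    (incChoiceNumber (SimpleGraph.cycleGraph n) = 3 ↔ 3 ∣ n) := by
  obtain ⟨m, rfl⟩ : ∃ m, n = m + 3 := ⟨n - 3, by omega⟩
  have h4 : IncChoosable (SimpleGraph.cycleGraph (m + 3)) 4 :=
    (cyc_choosable m 4).2 (cycCol_four m)
  have hmem : IncChoosable (SimpleGraph.cycleGraph (m + 3))
      (incChoiceNumber (SimpleGraph.cycleGraph (m + 3))) :=
    Nat.sInf_mem (s := {k | IncChoosable (SimpleGraph.cycleGraph (m + 3)) k}) ⟨4, h4⟩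
  have hle : ∀ k, IncChoosable (SimpleGraph.cycleGraph (m + 3)) k →
      incChoiceNumber (SimpleGraph.cycleGraph (m + 3)) ≤ k := fun k hk => Nat.sInf_le hk
  have hcst := (cyc_choosable m _).1 hmem
    (fun _ => Finset.range (incChoiceNumber (SimpleGraph.cycleGraph (m + 3))))
    (fun _ => Finset.range (incChoiceNumber (SimpleGraph.cycleGraph (m + 3))))
    (fun _ => Finset.card_range _) (fun _ => Finset.card_range _)
  refine ⟨hle 4 h4, fun h => ?_, fun h => ?_⟩
  · rw [h] at hcst
    exact cycCol_dvd m hcst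
  · apply le_antisymm (hle 3 ((cyc_choosable m 3).2 (cycCol_three m h)))
    by_contra hlt
    exact cycCol_lt m _ (by omega) hcst
end

section
/- Let G be a connected almost cubic simple graph (every vertex has degree 3 except at most one) that admits a (1,2)-decomposition, and let L be an incidence 6-list assignment of G. Then G is incidence L-choosable. -/
lemma pickOne (s t : Finset ℕ) (h : t.card < s.card) : ∃ x ∈ s, x ∉ t :=
  Finset.exists_mem_notMem_of_card_lt_card h

lemma cyc_seq (A : ℕ → Finset ℕ) (M c0 c1 : ℕ) (h3 : ∀ i < M, 3 ≤ (A i).card) (k : ℕ)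
    (hk : k + 2 ≤ M) :
    ∃ c : ℕ → ℕ, c 0 = c0 ∧ c 1 = c1 ∧
      ∀ j < k, c (j+2) ∈ A (j+2) ∧ c (j+2) ≠ c (j+1) ∧ c (j+2) ≠ c j := by
  induction k with
  | zero => exact ⟨fun i => if i = 0 then c0 else c1, by simp, by simp, by simp⟩
  | succ k ih =>
    obtain ⟨c, h0, h1, hc⟩ := ih (by omega)
    obtain ⟨x, hx, hx'⟩ := pickOne (A (k+2)) {c (k+1), c k}
      (lt_of_le_of_lt Finset.card_le_two (h3 (k+2) (by omega)))
    refine ⟨Function.update c (k+2) x, by simp [Function.update, h0], by simp [Function.update, h1], ?_⟩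
    intro j hj
    simp only [Finset.mem_insert, Finset.mem_singleton, not_or] at hx'
    rcases Nat.lt_succ_iff_lt_or_eq.mp hj with h | h
    · have := hc j h
      simp only [Function.update]
      grind
    · subst h
      simp only [Function.update]
      grind

lemma cyc_color (M : ℕ) (hM : 4 ≤ M) (A : ℕ → Finset ℕ) (h3 : ∀ i < M, 3 ≤ (A i).card)
    (hs : 4 ≤ (A M).card)
    (hy : 5 ≤ (A (M+1)).card ∨ (4 ≤ (A (M+1)).card ∧ ¬ A 1 ⊆ A (M+1))) :
    ∃ c : ℕ → ℕ, (∀ i < M+2, c i ∈ A i) ∧ (∀ i, i + 1 < M+2 → c i ≠ c (i+1)) ∧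
      (∀ i, i + 2 < M+2 → c i ≠ c (i+2)) ∧ c (M+1) ≠ c 0 ∧ c (M+1) ≠ c 1 ∧ c M ≠ c 0 := by
  obtain ⟨c1, hc1, hc1'⟩ : ∃ c1 ∈ A 1, 5 ≤ (A (M+1)).card ∨ (4 ≤ (A (M+1)).card ∧ c1 ∉ A (M+1)) := by
    rcases hy with hy | ⟨hy, hy'⟩
    · obtain ⟨x, hx⟩ := Finset.card_pos.mp (lt_of_lt_of_le (by norm_num) (h3 1 (by omega)))
      exact ⟨x, hx, Or.inl hy⟩
    · obtain ⟨x, hx, hx'⟩ := Finset.not_subset.mp hy'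
      exact ⟨x, hx, Or.inr ⟨hy, hx'⟩⟩
  obtain ⟨c0, hc0, hc0'⟩ := pickOne (A 0) {c1} (by
    have := h3 0 (by omega)
    simp; omega)
  obtain ⟨c, e0, e1, hc⟩ := cyc_seq A M c0 c1 h3 (M-2) (by omega)
  obtain ⟨x, hx, hx'⟩ := pickOne (A M) {c (M-1), c (M-2), c 0}
      (lt_of_le_of_lt Finset.card_le_three hs)
  obtain ⟨y, hy, hy', hyc⟩ : ∃ y ∈ A (M+1), y ∉ ({x, c (M-1), c 0} : Finset ℕ) ∧ y ≠ c 1 := by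
    rcases hc1' with h | ⟨h, h'⟩
    · obtain ⟨y, hy, hy'⟩ := pickOne (A (M+1)) {x, c (M-1), c 0, c 1}
        (lt_of_le_of_lt Finset.card_le_four h)
      exact ⟨y, hy, by grind, by grind⟩
    · obtain ⟨y, hy, hy'⟩ := pickOne (A (M+1)) {x, c (M-1), c 0}
        (lt_of_le_of_lt Finset.card_le_three h)
      exact ⟨y, hy, hy', by grind⟩
  simp only [Finset.mem_insert, Finset.mem_singleton, not_or] at hx' hy' hc0'
  have hc' : ∀ j, 2 ≤ j → j < M → c j ∈ A j ∧ c j ≠ c (j-1) ∧ c j ≠ c (j-2) := by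
    intro j h1 h2
    obtain ⟨i, rfl⟩ := Nat.exists_eq_add_of_le' h1
    exact hc i (by omega)
  refine ⟨fun i => if i = M then x else if i = M+1 then y else c i, ?_, ?_, ?_, ?_, ?_, ?_⟩
  · intro i hi
    by_cases h : i = M
    · simp [h, hx]
    by_cases h' : i = M + 1
    · simp [h', hy]
    simp only [h, h', if_false]
    by_cases i0 : i = 0
    · subst i0; rwa [e0]
    by_cases i1 : i = 1
    · subst i1; rwa [e1]
    exact (hc' i (by omega) (by omega)).1
  · intro i hi
    by_cases a1 : i = M
    · subst a1
      simp only [if_true, Nat.succ_ne_self, if_false]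
      exact fun h => hy'.1 h.symm
    by_cases a2 : i + 1 = M
    · have : i = M - 1 := by omega
      have a3 : i ≠ M + 1 := by omega
      simp only [a1, a2, a3, if_true, if_false]
      rw [this]; exact fun h => hx'.1 h.symm
    have a3 : i ≠ M + 1 := by omega
    have a4 : i + 1 ≠ M + 1 := by omega
    simp only [a1, a2, a3, a4, if_false]
    by_cases i0 : i = 0
    · subst i0; rw [e0]; simpa [e1] using hc0'
    · exact fun h => (hc' (i+1) (by omega) (by omega)).2.1 h.symm
  · intro i hi
    have a1 : i ≠ M := by omega
    have a3 : i ≠ M + 1 := by omega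
    by_cases a2 : i + 2 = M
    · have : i = M - 2 := by omega
      simp only [a1, a2, a3, if_true, if_false]
      rw [this]; exact fun h => hx'.2.1 h.symm
    by_cases a4 : i + 2 = M + 1
    · have : i = M - 1 := by omega
      have a5 : M + 1 ≠ M := by omega
      simp only [a1, a4, a3, a5, if_true, if_false]
      rw [this]; exact fun h => hy'.2.1 h.symm
    simp only [a1, a2, a3, a4, if_false]
    exact fun h => (hc' (i+2) (by omega) (by omega)).2.2 h.symm
  all_goals
    have b1 : M + 1 ≠ M := by omega
    have b2 : (0:ℕ) ≠ M := by omega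
    have b3 : (0:ℕ) ≠ M + 1 := by omega
    have b4 : (1:ℕ) ≠ M := by omega
    have b5 : (1:ℕ) ≠ M + 1 := by omega
    simp only [b1, b2, b3, b4, b5, if_true, if_false]
  · exact hy'.2.2
  · exact hyc
  · exact hx'.2.2

lemma orbit_color {V : Type*} [Fintype V] (σ : Equiv.Perm V) (v : V)
    (h1 : σ v ≠ v) (h2 : σ (σ v) ≠ v) (F G : V → Finset ℕ)
    (hF : ∀ a, σ.SameCycle v a → 3 ≤ (F a).card)
    (hG : ∀ a, σ.SameCycle v a → 3 ≤ (G a).card)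
    (hs : 4 ≤ (F (σ.symm v)).card)
    (hy : 5 ≤ (G (σ.symm v)).card ∨ (4 ≤ (G (σ.symm v)).card ∧ ¬ G v ⊆ G (σ.symm v))) :
    ∃ f g : V → ℕ, ∀ a, σ.SameCycle v a → f a ∈ F a ∧ g a ∈ G a ∧ f a ≠ g a ∧ f a ≠ f (σ a) ∧
      g a ≠ f (σ a) ∧ g a ≠ g (σ a) := by
  classical
  set n := Function.minimalPeriod σ v with hn
  have hper : Function.IsPeriodicPt σ n v := Function.isPeriodicPt_minimalPeriod _ _
  have hnpos : 0 < n := by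
    apply Function.minimalPeriod_pos_of_mem_periodicPts
    exact Function.Injective.mem_periodicPts σ.injective v
  have hn1 : n ≠ 1 := by
    intro h; rw [h] at hper; exact h1 hper
  have hn2 : n ≠ 2 := by
    intro h; rw [h] at hper; exact h2 hper
  obtain ⟨k, hk⟩ : ∃ k, n = k + 3 := ⟨n - 3, by omega⟩
  have hsame : ∀ i, σ.SameCycle v (σ^[i] v) := by
    intro i
    exact ⟨i, by simp [Equiv.Perm.iterate_eq_pow]⟩
  have hb : σ.symm v = σ^[k+2] v := by
    rw [Equiv.symm_apply_eq, ← Function.iterate_succ_apply' σ]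
    rw [hk] at hper; exact hper.symm
  have hex : ∀ a, σ.SameCycle v a → ∃ i < n, a = σ^[i] v := by
    intro a ha
    obtain ⟨i, hi⟩ := ha.exists_nat_pow_eq
    refine ⟨i % n, Nat.mod_lt _ hnpos, ?_⟩
    rw [Function.iterate_mod_minimalPeriod_eq, ← hi, Equiv.Perm.iterate_eq_pow]
  have hinj : ∀ i < n, ∀ j < n, σ^[i] v = σ^[j] v → i = j := by
    intro i hi j hj h
    exact Function.iterate_injOn_Iio_minimalPeriod (f := σ) (x := v) hi hj h
  let A : ℕ → Finset ℕ := fun j => if j % 2 = 0 then F (σ^[j/2] v) else G (σ^[j/2] v)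
  have hAe : ∀ i, A (2*i) = F (σ^[i] v) := by
    intro i; simp [A]
  have hAo : ∀ i, A (2*i+1) = G (σ^[i] v) := by
    intro i
    have h1 : (2*i+1) % 2 = 1 := by omega
    have h2 : (2*i+1) / 2 = i := by omega
    simp [A, h1, h2]
  obtain ⟨c, hc1, hc2, hc3, hc4, hc5, hc6⟩ := cyc_color (2*(k+2)) (by omega) A (by
    intro i _
    simp only [A]
    split_ifs
    · exact hF _ (hsame _)
    · exact hG _ (hsame _)) (by rw [hAe, ← hb]; exact hs)
    (by rw [hAo, ← hb]; have := hAo 0; simp only [Nat.mul_zero, Nat.zero_add, Function.iterate_zero, id] at this; rw [this]; exact hy)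
  choose! idx hidx using hex
  have hidx' : ∀ i < n, idx (σ^[i] v) = i := by
    intro i hi
    have := hidx _ (hsame i)
    exact (hinj _ this.1 _ hi this.2.symm)
  refine ⟨fun a => c (2 * idx a), fun a => c (2 * idx a + 1), ?_⟩
  intro a ha
  obtain ⟨i, hi, rfl⟩ : ∃ i < n, a = σ^[i] v := ⟨idx a, hidx a ha⟩
  have e1 := hidx' i hi
  have m1 := hc1 (2*i) (by omega)
  have m2 := hc1 (2*i+1) (by omega)
  rw [hAe] at m1
  rw [hAo] at m2
  have hstep : σ (σ^[i] v) = σ^[i+1] v := (Function.iterate_succ_apply' σ i v).symm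
  simp only [e1, hstep]
  refine ⟨m1, m2, hc2 _ (by omega), ?_⟩
  by_cases hl : i + 1 < n
  · rw [hidx' _ hl]
    exact ⟨hc3 (2*i) (by omega), hc2 (2*i+1) (by omega), hc3 (2*i+1) (by omega)⟩
  · have : i = k + 2 := by omega
    have e0 : σ^[i+1] v = v := by
      have : i + 1 = n := by omega
      rw [this]; exact hper
    have e0' : idx v = 0 := hidx' 0 hnpos
    rw [e0, e0', this]
    exact ⟨hc6, hc4, hc5⟩

structure CSys (V : Type*) where
  σ : Equiv.Perm V
  μ : V → V
  F : V → Finset ℕ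
  G : V → Finset ℕ
  H : V → Finset ℕ
  mm : ∀ a, μ (μ a) = a
  mne : ∀ a, μ a ≠ a
  ms : ∀ a, μ a ≠ σ a
  s2 : ∀ a, σ a ≠ a → σ (σ a) ≠ a
  hF : ∀ a, σ a ≠ a → (F a).card = 6
  hG : ∀ a, σ a ≠ a → (G a).card = 6
  hH : ∀ a, (H a).card = 6

namespace CSys

variable {V : Type*} (S : CSys V)

def Gd (hx : V → Finset ℕ) (f g : V → ℕ) (a : V) : Prop :=
  f a ∈ S.F a \ (hx a ∪ hx (S.μ a) ∪ hx (S.σ a)) ∧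
  g a ∈ S.G a \ (hx (S.σ a) ∪ hx (S.μ (S.σ a)) ∪ hx a) ∧
  f a ≠ g a ∧ f a ≠ f (S.σ a) ∧ g a ≠ f (S.σ a) ∧ g a ≠ g (S.σ a)

def sg (h : V → ℕ) : V → Finset ℕ := fun a => {h a}

def PH (h : V → ℕ) : Prop := ∀ a, h a ∈ S.H a ∧ h a ≠ h (S.μ a)

def Cl (P : Set V) : Prop := ∀ a, a ∈ P ↔ S.σ a ∈ P

def Orb (v : V) : Set V := {a | S.σ.SameCycle v a}

def Cn (X : Set V) : Prop :=
  ∀ Y ⊆ X, Y.Nonempty → S.Cl Y → (∀ a ∈ Y, S.μ a ∈ X → S.μ a ∈ Y) → Y = X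

lemma ms' (a : V) : S.σ (S.μ a) ≠ a := by
  intro h
  exact S.ms (S.μ a) (by rw [S.mm, h])

lemma muinj {a b : V} (h : S.μ a = S.μ b) : a = b := by
  rw [← S.mm a, h, S.mm]

lemma orb_cl (v : V) : S.Cl (S.Orb v) := by
  intro a
  simp only [Orb, Set.mem_setOf_eq]
  exact Equiv.Perm.sameCycle_apply_right.symm

lemma orb_self (v : V) : v ∈ S.Orb v := Equiv.Perm.SameCycle.refl _ _

lemma cl_orb [Finite V] {P : Set V} (hP : S.Cl P) {v : V} (hv : v ∈ P) : S.Orb v ⊆ P := by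
  intro a ha
  obtain ⟨i, hi⟩ := Equiv.Perm.SameCycle.exists_nat_pow_eq ha
  rw [← hi]
  clear hi ha
  induction i with
  | zero => simpa using hv
  | succ i ih =>
    rw [pow_succ', Equiv.Perm.mul_apply]
    exact (hP _).1 ih

lemma orb_nf {v a : V} (hv : S.σ v ≠ v) (ha : a ∈ S.Orb v) : S.σ a ≠ a := by
  intro h
  exact hv ((Equiv.Perm.SameCycle.apply_eq_self_iff ha).2 h)

lemma symm_nf {v : V} (hv : S.σ v ≠ v) : S.σ.symm v ≠ v := by
  intro h
  apply hv
  rw [Equiv.symm_apply_eq] at h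
  exact h.symm

lemma symm_ne_app {v : V} (hv : S.σ v ≠ v) : S.σ.symm v ≠ S.σ v := by
  intro h
  rw [Equiv.symm_apply_eq] at h
  exact S.s2 v hv h.symm

lemma orb_symm (v : V) : S.σ.symm v ∈ S.Orb v := by
  rw [S.orb_cl v, Equiv.apply_symm_apply]
  exact S.orb_self v

lemma gd_congr {hx hx' : V → Finset ℕ} {f g f' g' : V → ℕ} {a : V}
    (h : S.Gd hx f g a) (f1 : f' a = f a) (f2 : f' (S.σ a) = f (S.σ a))
    (g1 : g' a = g a) (g2 : g' (S.σ a) = g (S.σ a))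
    (x1 : hx' a = hx a) (x2 : hx' (S.μ a) = hx (S.μ a)) (x3 : hx' (S.σ a) = hx (S.σ a))
    (x4 : hx' (S.μ (S.σ a)) = hx (S.μ (S.σ a))) : S.Gd hx' f' g' a := by
  unfold Gd at *
  rw [f1, f2, g1, g2, x1, x2, x3, x4]
  exact h

lemma extend [Fintype V] (f g : V → ℕ) (v : V) (hv : S.σ v ≠ v) (hx : V → Finset ℕ)
    (hx1 : ∀ a, (hx a).card ≤ 1)
    (hs : 4 ≤ (S.F (S.σ.symm v) \ (hx (S.σ.symm v) ∪ hx (S.μ (S.σ.symm v)) ∪ hx v)).card)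
    (hy : 5 ≤ (S.G (S.σ.symm v) \ (hx v ∪ hx (S.μ v) ∪ hx (S.σ.symm v))).card ∨
      (4 ≤ (S.G (S.σ.symm v) \ (hx v ∪ hx (S.μ v) ∪ hx (S.σ.symm v))).card ∧
        ¬ S.G v \ (hx (S.σ v) ∪ hx (S.μ (S.σ v)) ∪ hx v) ⊆
          S.G (S.σ.symm v) \ (hx v ∪ hx (S.μ v) ∪ hx (S.σ.symm v)))) :
    ∃ f' g' : V → ℕ, (∀ a ∉ S.Orb v, f' a = f a ∧ g' a = g a) ∧ ∀ a ∈ S.Orb v, S.Gd hx f' g' a := by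
  classical
  have key : ∀ (A : Finset ℕ) (x y z : V), A.card = 6 → 3 ≤ (A \ (hx x ∪ hx y ∪ hx z)).card := by
    intro A x y z hA
    have h1 := Finset.le_card_sdiff (hx x ∪ hx y ∪ hx z) A
    have h2 := Finset.card_union_le (hx x ∪ hx y) (hx z)
    have h3 := Finset.card_union_le (hx x) (hx y)
    have := hx1 x; have := hx1 y; have := hx1 z
    omega
  obtain ⟨f1, g1, h1⟩ := orbit_color S.σ v hv (S.s2 v hv)
    (fun a => S.F a \ (hx a ∪ hx (S.μ a) ∪ hx (S.σ a)))
    (fun a => S.G a \ (hx (S.σ a) ∪ hx (S.μ (S.σ a)) ∪ hx a))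
    (fun a ha => key _ _ _ _ (S.hF a (S.orb_nf hv ha)))
    (fun a ha => key _ _ _ _ (S.hG a (S.orb_nf hv ha)))
    (by simpa only [Equiv.apply_symm_apply] using hs)
    (by simpa only [Equiv.apply_symm_apply] using hy)
  refine ⟨fun a => if a ∈ S.Orb v then f1 a else f a, fun a => if a ∈ S.Orb v then g1 a else g a, ?_, ?_⟩
  · intro a ha; simp [ha]
  · intro a ha
    have ha' : S.σ a ∈ S.Orb v := (S.orb_cl v a).1 ha
    unfold Gd
    simp only [ha, ha', if_true]
    exact h1 a ha

open Classical in
noncomputable def hxE (h : V → ℕ) (e : V) : V → Finset ℕ :=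
  fun a => if a = e ∨ a = S.μ e then ∅ else {h a}

lemma hxE_card (h : V → ℕ) (e a : V) : (S.hxE h e a).card ≤ 1 := by
  unfold hxE; split_ifs <;> simp

lemma exitc [Fintype V] (f g h : V → ℕ) (e : V) (he : S.σ e ≠ e) :
    ∃ f' g' : V → ℕ, (∀ a ∉ S.Orb e, f' a = f a ∧ g' a = g a) ∧
      ∀ a ∈ S.Orb e, S.Gd (S.hxE h e) f' g' a := by
  have e1 : S.hxE h e e = ∅ := by simp [hxE]
  have e2 : S.hxE h e (S.μ e) = ∅ := by simp [hxE]
  have hb : S.σ (S.σ.symm e) ≠ S.σ.symm e := S.orb_nf he (S.orb_symm e)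
  apply S.extend f g e he _ (S.hxE_card h e)
  · rw [e1, Finset.union_empty]
    have h1 := Finset.le_card_sdiff (S.hxE h e (S.σ.symm e) ∪ S.hxE h e (S.μ (S.σ.symm e))) (S.F (S.σ.symm e))
    have h3 := Finset.card_union_le (S.hxE h e (S.σ.symm e)) (S.hxE h e (S.μ (S.σ.symm e)))
    have := S.hxE_card h e (S.σ.symm e)
    have := S.hxE_card h e (S.μ (S.σ.symm e))
    have := S.hF _ hb
    omega
  · left
    rw [e1, e2, Finset.union_empty, Finset.empty_union]
    have h1 := Finset.le_card_sdiff (S.hxE h e (S.σ.symm e)) (S.G (S.σ.symm e))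
    have := S.hxE_card h e (S.σ.symm e)
    have := S.hG _ hb
    omega

open Classical in
noncomputable def upd (h : V → ℕ) (e : V) (x y : ℕ) : V → ℕ :=
  fun a => if a = e then x else if a = S.μ e then y else h a

lemma upd_self (h : V → ℕ) (e : V) (x y : ℕ) : S.upd h e x y e = x := by simp [upd]
lemma upd_mu (h : V → ℕ) (e : V) (x y : ℕ) : S.upd h e x y (S.μ e) = y := by simp [upd, S.mne e]
lemma upd_of {h : V → ℕ} {e : V} {x y : ℕ} {a : V} (h1 : a ≠ e) (h2 : a ≠ S.μ e) :
    S.upd h e x y a = h a := by simp [upd, h1, h2]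

lemma upd_ph {h : V → ℕ} (hh : S.PH h) {e : V} {x y : ℕ} (hx : x ∈ S.H e) (hy : y ∈ S.H (S.μ e))
    (hxy : x ≠ y) : S.PH (S.upd h e x y) := by
  intro a
  by_cases h1 : a = e
  · subst h1
    rw [S.upd_self, S.upd_mu]
    exact ⟨hx, hxy⟩
  by_cases h2 : a = S.μ e
  · subst h2
    rw [S.mm, S.upd_self, S.upd_mu]
    exact ⟨hy, hxy.symm⟩
  rw [S.upd_of h1 h2, S.upd_of]
  · exact hh a
  · intro h; apply h2; rw [← h, S.mm]
  · intro h; exact h1 (S.muinj h)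

lemma refix {f g h : V → ℕ} (hh : S.PH h) {e : V} (he : S.σ e ≠ e) (hme : S.μ e ∉ S.Orb e)
    (hg : ∀ a ∈ S.Orb e, S.Gd (S.hxE h e) f g a) (d : ℕ) :
    ∃ x y, x ≠ d ∧ y ≠ d ∧ S.PH (S.upd h e x y) ∧
      ∀ a ∈ S.Orb e, S.Gd (sg (S.upd h e x y)) f g a := by
  set b := S.σ.symm e with hb
  have hbe : S.σ b = e := by simp [hb]
  obtain ⟨x, hx, hx'⟩ := pickOne (S.H e) {f e, g e, f b, g b, d} (by
    rw [S.hH]; exact lt_of_le_of_lt Finset.card_le_five (by norm_num))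
  obtain ⟨y, hy, hy'⟩ := pickOne (S.H (S.μ e)) {f e, g b, d, x} (by
    rw [S.hH]; exact lt_of_le_of_lt Finset.card_le_four (by norm_num))
  simp only [Finset.mem_insert, Finset.mem_singleton, not_or] at hx' hy'
  refine ⟨x, y, hx'.2.2.2.2, hy'.2.2.1, S.upd_ph hh hx hy (fun h => hy'.2.2.2 h.symm), ?_⟩
  intro a ha
  have G0 := hg a ha
  have hσa : S.σ a ∈ S.Orb e := (S.orb_cl e a).1 ha
  have gen : ∀ c, c ≠ e → c ≠ S.μ e → sg (S.upd h e x y) c = S.hxE h e c := by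
    intro c h1 h2
    simp [sg, S.upd_of h1 h2, hxE, h1, h2]
  have se : sg (S.upd h e x y) e = {x} := by simp [sg, S.upd_self]
  have sm : sg (S.upd h e x y) (S.μ e) = {y} := by simp [sg, S.upd_mu]
  have nm : ∀ c ∈ S.Orb e, c ≠ S.μ e := by
    intro c hc h; exact hme (h ▸ hc)
  have nm1 : ∀ c ∈ S.Orb e, S.μ c ≠ e := by
    intro c hc h; apply nm c hc; rw [← h, S.mm]
  by_cases h1 : a = e
  · subst h1
    obtain ⟨G1, G2, G3⟩ := G0
    have q1 := gen (S.σ a) he (nm _ hσa)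
    have q2 := gen (S.μ (S.σ a)) (nm1 _ hσa) (fun h => he (S.muinj h))
    refine ⟨?_, ?_, G3⟩
    · rw [se, sm, q1]
      simp only [Finset.mem_sdiff, Finset.mem_union, Finset.mem_singleton, not_or] at G1 ⊢
      exact ⟨G1.1, ⟨fun h => hx'.1 h.symm, fun h => hy'.1 h.symm⟩, G1.2.2⟩
    · rw [se, q1, q2]
      simp only [Finset.mem_sdiff, Finset.mem_union, Finset.mem_singleton, not_or] at G2 ⊢
      exact ⟨G2.1, G2.2.1, fun h => hx'.2.1 h.symm⟩
  by_cases h2 : S.σ a = e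
  · have hab : a = b := by rw [hb, Equiv.eq_symm_apply]; exact h2
    obtain ⟨G1, G2, G3⟩ := G0
    have q1 := gen a h1 (nm _ ha)
    have q2 := gen (S.μ a) (nm1 _ ha) (fun h => h1 (S.muinj h))
    rw [h2] at G1 G2
    refine ⟨?_, ?_, G3⟩
    · rw [h2, se, q1, q2]
      simp only [Finset.mem_sdiff, Finset.mem_union, Finset.mem_singleton, not_or] at G1 ⊢
      exact ⟨G1.1, G1.2.1, fun h => hx'.2.2.1 (by rw [← hab, h])⟩
    · rw [h2, se, sm, q1]
      simp only [Finset.mem_sdiff, Finset.mem_union, Finset.mem_singleton, not_or] at G2 ⊢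
      exact ⟨G2.1, ⟨fun h => hx'.2.2.2.1 (by rw [← hab, h]), fun h => hy'.2.1 (by rw [← hab, h])⟩, G2.2.2⟩
  · exact S.gd_congr G0 rfl rfl rfl rfl (gen _ h1 (nm _ ha))
      (gen _ (nm1 _ ha) (fun h => h1 (S.muinj h))) (gen _ h2 (nm _ hσa))
      (gen _ (nm1 _ hσa) (fun h => h2 (S.muinj h)))

lemma sg_upd {h : V → ℕ} {e : V} {x y : ℕ} {a : V} (h1 : a ≠ e) (h2 : a ≠ S.μ e) :
    sg (S.upd h e x y) a = sg h a := by simp [sg, S.upd_of h1 h2]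

lemma nonroot [Fintype V] (X : Set V) (hX : S.Cl X) (hC : S.Cn X) (h0 : V → ℕ) (hh0 : S.PH h0) :
    ∀ (n : ℕ) (U : Set V), (X \ U).ncard = n → U ⊆ X → U.Nonempty → S.Cl U →
      (∀ a ∈ X \ U, S.σ a ≠ a) →
      ∃ f g h : V → ℕ, S.PH h ∧ (∀ a ∈ X \ U, S.Gd (sg h) f g a) ∧
        (∀ a, ¬ (a ∈ X ∧ S.μ a ∈ X) → h a = h0 a) := by
  intro n
  induction n using Nat.strong_induction_on with
  | _ n ih =>
    intro U hn hUX hU hcl hnf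
    by_cases hE : U = X
    · exact ⟨h0, h0, h0, hh0, by simp [hE], fun _ _ => rfl⟩
    obtain ⟨a, haU, haX, haU'⟩ : ∃ a ∈ U, S.μ a ∈ X ∧ S.μ a ∉ U := by
      by_contra hcon
      push Not at hcon
      exact hE (hC U hUX hU hcl hcon)
    set e := S.μ a with he
    have hme : S.μ e = a := S.mm a
    have heX : e ∈ X \ U := ⟨haX, haU'⟩
    have hclD : S.Cl (X \ U) := by
      intro c
      simp only [Set.mem_diff]
      rw [hX c, hcl c]
    have hD : S.Orb e ⊆ X \ U := S.cl_orb hclD heX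
    have hsub : X \ (U ∪ S.Orb e) ⊂ X \ U := by
      refine ⟨fun c hc => ⟨hc.1, fun h => hc.2 (Or.inl h)⟩, fun h => (h heX).2 (Or.inr (S.orb_self e))⟩
    have hcl' : S.Cl (U ∪ S.Orb e) := by
      intro c
      simp only [Set.mem_union]
      rw [hcl c, S.orb_cl e c]
    obtain ⟨f, g, h, hh, hgd, hag⟩ := ih _ (by
        rw [← hn]; exact Set.ncard_lt_ncard hsub (Set.toFinite _)) (U ∪ S.Orb e) rfl
      (Set.union_subset hUX (fun c hc => (hD hc).1)) (hU.mono Set.subset_union_left) hcl'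
      (fun c hc => hnf c (hsub.1 hc))
    obtain ⟨f', g', hoff, hon⟩ := S.exitc f g h e (hnf e heX)
    have hme' : S.μ e ∉ S.Orb e := by
      rw [hme]; intro h; exact (hD h).2 haU
    obtain ⟨x, y, -, -, hph, hgd'⟩ := S.refix hh (hnf e heX) hme' hon 0
    refine ⟨f', g', S.upd h e x y, hph, ?_, ?_⟩
    · intro c hc
      by_cases hcO : c ∈ S.Orb e
      · exact hgd' c hcO
      have hc' : c ∈ X \ (U ∪ S.Orb e) := ⟨hc.1, by
        rintro (h | h)
        exacts [hc.2 h, hcO h]⟩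
      have hsO : S.σ c ∉ S.Orb e := fun h => hcO ((S.orb_cl e c).2 h)
      have hsU : S.σ c ∉ U := fun h => hc.2 ((hcl c).2 h)
      have n1 : c ≠ e := fun h => hcO (h ▸ S.orb_self e)
      have n2 : c ≠ S.μ e := fun h => hc.2 (by rw [h, hme]; exact haU)
      have n3 : S.σ c ≠ e := fun h => hsO (h ▸ S.orb_self e)
      have n4 : S.σ c ≠ S.μ e := fun h => hsU (by rw [h, hme]; exact haU)
      refine S.gd_congr (hgd c hc') (hoff c hcO).1 (hoff _ hsO).1 (hoff c hcO).2 (hoff _ hsO).2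
        (S.sg_upd n1 n2) (S.sg_upd ?_ ?_) (S.sg_upd n3 n4) (S.sg_upd ?_ ?_)
      · intro h; apply n2; rw [← h, S.mm]
      · intro h; exact n1 (S.muinj h)
      · intro h; apply n4; rw [← h, S.mm]
      · intro h; exact n3 (S.muinj h)
    · intro c hc
      rw [S.upd_of, hag c hc]
      · rintro rfl; exact hc ⟨haX, by rw [hme]; exact hUX haU⟩
      · rintro rfl; exact hc ⟨by rw [hme]; exact hUX haU, by rw [S.mm]; exact haX⟩

lemma exists_ph [Finite V] : ∃ h, S.PH h := by
  classical
  obtain ⟨n, ⟨idx⟩⟩ := Finite.exists_equiv_fin V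
  have hx : ∀ a, ∃ x, x ∈ S.H a := by
    intro a
    obtain ⟨x, hx⟩ := Finset.card_pos.mp (by rw [S.hH a]; norm_num : 0 < (S.H a).card)
    exact ⟨x, hx⟩
  choose x hx using hx
  have hy : ∀ a, ∃ y ∈ S.H a, y ∉ ({x (S.μ a)} : Finset ℕ) := by
    intro a
    exact pickOne _ _ (by rw [S.hH a]; simp)
  choose y hy hy' using hy
  refine ⟨fun a => if idx a < idx (S.μ a) then x a else y a, ?_⟩
  intro a
  have hne : idx a ≠ idx (S.μ a) := fun h => S.mne a (idx.injective h).symm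
  have h1 := hy' a
  have h2 := hy' (S.μ a)
  simp only [Finset.mem_singleton] at h1 h2
  rw [S.mm] at h2
  simp only [S.mm]
  rcases lt_or_gt_of_ne hne with h | h
  · simp only [h, h.not_gt, if_true, if_false]
    exact ⟨hx a, fun h => h2 h.symm⟩
  · simp only [h, h.not_gt, if_true, if_false]
    exact ⟨hy a, h1⟩

/-- the key local choice -/
lemma presave (A B C D : Finset ℕ) (m : ℕ) (hA : A.card = 6) (hB : B.card = 6) (hC : C.card = 6)
    (hD : D.card = 6) :
    ∃ q ∈ A, ∃ q' ∈ B, q ≠ q' ∧ 4 ≤ (C \ ({q} ∪ {q'} ∪ {m})).card ∧ 5 ≤ (D \ {m, q}).card := by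
  have two : ∀ (E : Finset ℕ) (r s : ℕ), E.card = 6 → 4 ≤ (E \ {r, s}).card := by
    intro E r s hE
    have := Finset.le_card_sdiff {r, s} E
    have := Finset.card_le_two (a := r) (b := s)
    omega
  have one : ∀ (E : Finset ℕ) (r : ℕ), E.card = 6 → 5 ≤ (E \ {r}).card := by
    intro E r hE
    have := Finset.le_card_sdiff {r} E
    rw [Finset.card_singleton] at this
    omega
  by_cases hm : m ∈ A
  · obtain ⟨q', hq', hne⟩ := pickOne B {m} (by rw [hB]; simp)
    simp only [Finset.mem_singleton] at hne
    refine ⟨m, hm, q', hq', fun h => hne h.symm, ?_, ?_⟩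
    · have : ({m} ∪ {q'} ∪ {m} : Finset ℕ) = {m, q'} := by ext; simp; tauto
      rw [this]; exact two _ _ _ hC
    · have : ({m, m} : Finset ℕ) = {m} := by simp
      rw [this]; exact one _ _ hD
  obtain ⟨q, hq, hqD⟩ : ∃ q ∈ A, m ∉ D ∨ q ∉ D := by
    by_cases hmD : m ∈ D
    · have : ¬ A ⊆ D := by
        intro hs
        have : A = D := Finset.eq_of_subset_of_card_le hs (by omega)
        exact hm (this ▸ hmD)
      obtain ⟨q, h1, h2⟩ := Finset.not_subset.mp this
      exact ⟨q, h1, Or.inr h2⟩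
    · obtain ⟨x, hx⟩ := Finset.card_pos.mp (by rw [hA]; norm_num : 0 < A.card)
      exact ⟨x, hx, Or.inl hmD⟩
  have h5 : 5 ≤ (D \ {m, q}).card := by
    rcases hqD with h | h
    · have : D \ {m, q} = D \ {q} := by ext x; simp; grind
      rw [this]; exact one _ _ hD
    · have : D \ {m, q} = D \ {m} := by ext x; simp; grind
      rw [this]; exact one _ _ hD
  have hqm : q ≠ m := fun h => hm (h ▸ hq)
  have fin : ∀ q', (m ∉ C ∨ q' = m ∨ q' ∉ C ∨ q ∉ C) → 4 ≤ (C \ ({q} ∪ {q'} ∪ {m})).card := by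
    intro q' h
    rcases h with h | h | h | h
    · have : C \ ({q} ∪ {q'} ∪ {m}) = C \ {q, q'} := by ext x; simp; grind
      rw [this]; exact two _ _ _ hC
    · have : C \ ({q} ∪ {q'} ∪ {m}) = C \ {q, q'} := by ext x; simp; grind
      rw [this]; exact two _ _ _ hC
    · have : C \ ({q} ∪ {q'} ∪ {m}) = C \ {q, m} := by ext x; simp; grind
      rw [this]; exact two _ _ _ hC
    · have : C \ ({q} ∪ {q'} ∪ {m}) = C \ {q', m} := by ext x; simp; grind
      rw [this]; exact two _ _ _ hC
  by_cases hmB : m ∈ B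
  · exact ⟨q, hq, m, hmB, hqm, fin m (by tauto), h5⟩
  by_cases hmC : m ∈ C
  · have : ¬ B ⊆ C := by
      intro hs
      have : B = C := Finset.eq_of_subset_of_card_le hs (by omega)
      exact hmB (this ▸ hmC)
    obtain ⟨r, h1, h2⟩ := Finset.not_subset.mp this
    by_cases hrq : q = r
    · obtain ⟨q', hq', hne⟩ := pickOne B {q} (by rw [hB]; simp)
      simp only [Finset.mem_singleton] at hne
      exact ⟨q, hq, q', hq', fun h => hne h.symm, fin q' (by subst hrq; tauto), h5⟩
    · exact ⟨q, hq, r, h1, hrq, fin r (by tauto), h5⟩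
  · obtain ⟨q', hq', hne⟩ := pickOne B {q} (by rw [hB]; simp)
    simp only [Finset.mem_singleton] at hne
    exact ⟨q, hq, q', hq', fun h => hne h.symm, fin q' (by tauto), h5⟩

lemma pre [Finite V] (v : V) (hv : S.σ v ≠ v) : ∃ h, S.PH h ∧
    4 ≤ (S.F (S.σ.symm v) \ ({h (S.σ.symm v)} ∪ {h (S.μ (S.σ.symm v))} ∪ {h v})).card ∧
    5 ≤ (S.G (S.σ.symm v) \ {h v, h (S.σ.symm v)}).card := by
  obtain ⟨h, hh⟩ := S.exists_ph
  set b := S.σ.symm v with hb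
  have hbv : S.σ b = v := by simp [hb]
  have hbn : S.σ b ≠ b := S.orb_nf hv (S.orb_symm v)
  obtain ⟨q, hq, q', hq', hne, h1, h2⟩ := presave (S.H b) (S.H (S.μ b)) (S.F b) (S.G b) (h v)
    (S.hH _) (S.hH _) (S.hF _ hbn) (S.hG _ hbn)
  refine ⟨S.upd h b q q', S.upd_ph hh hq hq' hne, ?_⟩
  have e1 : S.upd h b q q' v = h v := S.upd_of (by rw [← hbv]; exact hbn) (by
    rw [← hbv]; exact fun h => S.ms b h.symm)
  rw [e1, S.upd_self, S.upd_mu]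
  exact ⟨h1, h2⟩

end CSys

namespace CSys

variable {V : Type*} (S : CSys V)

lemma pickM (T B H : Finset ℕ) (m : ℕ) (hT : 3 ≤ T.card) (hB : 5 ≤ B.card) (hB' : B.card ≤ 6)
    (hH : H.card = 6) :
    ∃ m' ∈ H, m' ≠ m ∧ (5 ≤ (B.erase m').card ∨ (4 ≤ (B.erase m').card ∧
      ∃ t ∈ T, t ≠ m' ∧ t ∉ B) ∨ (4 ≤ (B.erase m').card ∧ m' ∈ T) ∨
       (4 ≤ (B.erase m').card ∧ ¬ T ⊆ B.erase m')) := by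
  by_contra hcon
  push Not at hcon
  have h5 : 5 ≤ (H.erase m).card := by
    have := Finset.pred_card_le_card_erase (s := H) (a := m)
    omega
  have h4 : ∀ x, 4 ≤ (B.erase x).card := by
    intro x
    have := Finset.pred_card_le_card_erase (s := B) (a := x)
    omega
  have hmB : ∀ x ∈ H.erase m, x ∈ B ∧ x ∉ T ∧ T ⊆ B.erase x := by
    intro x hx
    have h1 := hcon x (Finset.mem_of_mem_erase hx) (Finset.ne_of_mem_erase hx)
    refine ⟨?_, h1.2.2.1 (h4 x), h1.2.2.2 (h4 x)⟩
    by_contra hxB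
    rw [Finset.erase_eq_of_notMem hxB] at h1
    omega
  have hdisj : Disjoint (H.erase m) T := Finset.disjoint_left.2 fun x hx => (hmB x hx).2.1
  have hsub : H.erase m ∪ T ⊆ B := by
    apply Finset.union_subset (fun x hx => (hmB x hx).1)
    obtain ⟨x, hx⟩ := Finset.card_pos.mp (by omega : 0 < (H.erase m).card)
    exact (hmB x hx).2.2.trans (Finset.erase_subset _ _)
  have := Finset.card_le_card hsub
  rw [Finset.card_union_of_disjoint hdisj] at this
  omega

lemma sdiff3 (A : Finset ℕ) (x y z : ℕ) (hA : A.card = 6) : 3 ≤ (A \ ({x} ∪ {y} ∪ {z})).card := by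
  have h1 := Finset.le_card_sdiff ({x} ∪ {y} ∪ {z}) A
  have h2 := Finset.card_union_le ({x} ∪ {y}) ({z} : Finset ℕ)
  have h3 := Finset.card_union_le {x} ({y} : Finset ℕ)
  simp only [Finset.card_singleton] at h2 h3
  omega

lemma hamil [Fintype V] (v : V) (hv : S.σ v ≠ v) (hO : S.Orb v = Set.univ) :
    ∃ f g h : V → ℕ, S.PH h ∧ ∀ a, S.Gd (sg h) f g a := by
  obtain ⟨h0, hh0, p1, p2⟩ := S.pre v hv
  set b := S.σ.symm v with hb
  have hbv : S.σ b = v := by simp [hb]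
  have hbn : S.σ b ≠ b := S.orb_nf hv (S.orb_symm v)
  obtain ⟨m', hm', hmm, hor⟩ := pickM (S.G v \ ({h0 (S.σ v)} ∪ {h0 (S.μ (S.σ v))} ∪ {h0 v}))
    (S.G b \ {h0 v, h0 b}) (S.H (S.μ v)) (h0 v) (sdiff3 _ _ _ _ (S.hG _ hv)) p2
    ((Finset.card_le_card Finset.sdiff_subset).trans (S.hG _ hbn).le) (S.hH _)
  set h := S.upd h0 v (h0 v) m' with hh
  have hph : S.PH h := S.upd_ph hh0 (hh0 v).1 hm' hmm.symm
  have ag : ∀ a, a ≠ S.μ v → h a = h0 a := by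
    intro a ha
    by_cases h1 : a = v
    · subst h1; exact S.upd_self _ _ _ _
    · exact S.upd_of h1 ha
  have a0 : h (S.μ v) = m' := S.upd_mu _ _ _ _
  have a1 : h v = h0 v := ag _ (S.mne v).symm
  have a2 : h b = h0 b := ag _ (fun h => S.ms' v (by rw [← h, hbv]))
  have a3 : h (S.μ b) = h0 (S.μ b) := ag _ (fun h => hbn (by rw [hbv]; exact (S.muinj h).symm))
  have a4 : h (S.σ v) = h0 (S.σ v) := ag _ (S.ms v).symm
  have a5 : h (S.μ (S.σ v)) = h0 (S.μ (S.σ v)) := ag _ (fun h => hv (S.muinj h))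
  have eq1 : S.G b \ ({h0 v} ∪ {m'} ∪ {h0 b}) = (S.G b \ {h0 v, h0 b}).erase m' := by
    ext x; simp only [Finset.mem_sdiff, Finset.mem_union, Finset.mem_singleton, Finset.mem_insert, Finset.mem_erase]; tauto
  obtain ⟨f, g, -, hg⟩ := S.extend h h v hv (sg h) (by simp [sg])
    (by simp only [sg, ← hb, a1, a2, a3]; exact p1)
    (by
      simp only [sg, ← hb, a0, a1, a2, a3, a4, a5, eq1]
      rcases hor with h | ⟨h, t, ht, ht', ht''⟩ | ⟨h, ht⟩ | h
      · exact Or.inl h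
      · exact Or.inr ⟨h, fun hs => ht'' (Finset.mem_of_mem_erase (hs ht))⟩
      · exact Or.inr ⟨h, fun hs => Finset.notMem_erase _ _ (hs ht)⟩
      · exact Or.inr h)
  exact ⟨f, g, h, hph, fun a => hg a (by rw [hO]; trivial)⟩

lemma orb_cn [Finite V] (v : V) : S.Cn (S.Orb v) := by
  intro Y hY hne hcl _
  obtain ⟨a, ha⟩ := hne
  apply hY.antisymm
  have hva : v ∈ S.Orb a := (hY ha).symm
  exact S.cl_orb hcl (S.cl_orb hcl ha hva)

lemma multi [Fintype V] (hnf : ∀ a, S.σ a ≠ a) (X : Set V) (hXne : X.Nonempty) (hX : S.Cl X)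
    (hC : S.Cn X) (e : V) (he : e ∈ X) (hD : S.Orb (S.μ e) = Xᶜ) :
    ∃ f g h : V → ℕ, S.PH h ∧ ∀ a, S.Gd (sg h) f g a := by
  set u := S.μ e with hu
  set v := S.σ.symm u with hvd
  have hvu : S.σ v = u := by simp [hvd]
  obtain ⟨h0, hh0, p1, p2⟩ := S.pre v (hnf v)
  set b := S.σ.symm v with hb
  have hbv : S.σ b = v := by simp [hb]
  have hclD : S.Cl Xᶜ := by rw [← hD]; exact S.orb_cl _
  have huX : u ∉ X := by
    have := S.orb_self u
    rw [hD] at this; exact this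
  have hvX : v ∉ X := (hclD v).2 (by rw [hvu]; exact huX)
  have hbX : b ∉ X := (hclD b).2 (by rw [hbv]; exact hvX)
  have hOv : S.Orb v = Xᶜ := by
    apply (S.cl_orb hclD hvX).antisymm
    rw [← hD]
    refine S.cl_orb (S.orb_cl v) ?_
    rw [← hvu]
    exact (S.orb_cl v v).1 (S.orb_self v)
  have hOe : S.Orb e ⊆ X := S.cl_orb hX he
  obtain ⟨f, g, h, hh, hgd, hag⟩ := S.nonroot X hX hC h0 hh0 _ (S.Orb e) rfl hOe ⟨e, S.orb_self e⟩
    (S.orb_cl e) (fun a _ => hnf a)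
  obtain ⟨f', g', hoff, hon⟩ := S.exitc f g h e (hnf e)
  have hag' : ∀ a ∉ X, h a = h0 a ∧ h (S.μ a) = h0 (S.μ a) := by
    intro a ha
    exact ⟨hag a (fun h => ha h.1), hag _ (fun h => ha (by rw [← S.mm a]; exact h.2))⟩
  set Y := S.G b \ ({h v} ∪ {h (S.μ v)} ∪ {h b}) with hY
  have hYe : Y = (S.G b \ {h0 v, h0 b}).erase (h0 (S.μ v)) := by
    rw [hY, (hag' v hvX).1, (hag' v hvX).2, (hag' b hbX).1]
    ext x; simp only [Finset.mem_sdiff, Finset.mem_union, Finset.mem_singleton, Finset.mem_insert, Finset.mem_erase]; tauto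
  have hY4 : 4 ≤ Y.card := by
    rw [hYe]
    have := Finset.pred_card_le_card_erase (s := S.G b \ {h0 v, h0 b}) (a := h0 (S.μ v))
    omega
  obtain ⟨d, hd⟩ : ∃ d, 5 ≤ Y.card ∨ (d ∈ S.G v ∧ d ≠ h v ∧ d ∉ Y) := by
    by_cases h5 : 5 ≤ Y.card
    · exact ⟨0, Or.inl h5⟩
    · obtain ⟨d, hd, hd'⟩ := pickOne ((S.G v).erase (h v)) Y (by
        have := Finset.pred_card_le_card_erase (s := S.G v) (a := h v)
        have := S.hG v (hnf v)
        omega)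
      exact ⟨d, Or.inr ⟨Finset.mem_of_mem_erase hd, Finset.ne_of_mem_erase hd, hd'⟩⟩
  obtain ⟨x, y, hxd, hyd, hph, hgd'⟩ := S.refix hh (hnf e) (fun h => huX (hOe h)) hon d
  set h' := S.upd h e x y with hh'
  have k1 : h' e = x := S.upd_self _ _ _ _
  have k2 : h' u = y := S.upd_mu _ _ _ _
  have hne : ∀ a, a ∉ X → a ≠ u → h' a = h a ∧ h' (S.μ a) = h (S.μ a) := by
    intro a ha hau
    have hae : a ≠ e := fun h => ha (h ▸ he)
    exact ⟨S.upd_of hae hau, S.upd_of (fun h => hau (by rw [hu, ← h, S.mm])) (fun h => hae (S.muinj h))⟩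
  have hvu' : v ≠ u := by rw [← hvu]; exact (hnf v).symm
  have hbu' : b ≠ u := by rw [← hvu, ← hbv]; exact (S.s2 b (hnf b)).symm
  obtain ⟨v1, v2⟩ := hne v hvX hvu'
  obtain ⟨b1, b2⟩ := hne b hbX hbu'
  have hGX : ∀ a ∈ X, S.Gd (sg h') f' g' a := by
    intro c hc
    by_cases hcO : c ∈ S.Orb e
    · exact hgd' c hcO
    have hsX : S.σ c ∈ X := (hX c).1 hc
    have hsO : S.σ c ∉ S.Orb e := fun h => hcO ((S.orb_cl e c).2 h)
    have n1 : c ≠ e := fun h => hcO (h ▸ S.orb_self e)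
    have n2 : c ≠ S.μ e := fun h => huX (by rw [hu, ← h]; exact hc)
    have n3 : S.σ c ≠ e := fun h => hsO (h ▸ S.orb_self e)
    have n4 : S.σ c ≠ S.μ e := fun h => huX (by rw [hu, ← h]; exact hsX)
    refine S.gd_congr (hgd c ⟨hc, hcO⟩) (hoff c hcO).1 (hoff _ hsO).1 (hoff c hcO).2 (hoff _ hsO).2
      (S.sg_upd n1 n2) (S.sg_upd ?_ ?_) (S.sg_upd n3 n4) (S.sg_upd ?_ ?_)
    · intro h; apply n2; rw [← h, S.mm]
    · intro h; exact n1 (S.muinj h)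
    · intro h; apply n4; rw [← h, S.mm]
    · intro h; exact n3 (S.muinj h)
  obtain ⟨f2, g2, hoff2, hon2⟩ := S.extend f' g' v (hnf v) (sg h') (by simp [sg])
    (by
      simp only [sg, ← hb, v1, b1, b2, (hag' v hvX).1, (hag' b hbX).1, (hag' b hbX).2]
      exact p1)
    (by
      have hmu : S.μ u = e := by rw [hu, S.mm]
      simp only [sg, ← hb, v1, v2, b1, ← hY, hvu, hmu, k1, k2]
      rcases hd with hd | ⟨d1, d2, d3⟩
      · exact Or.inl hd
      · refine Or.inr ⟨hY4, fun hs => d3 (hs ?_)⟩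
        simp only [Finset.mem_sdiff, Finset.mem_union, Finset.mem_singleton, not_or]
        exact ⟨d1, ⟨hyd.symm, hxd.symm⟩, d2⟩)
  refine ⟨f2, g2, h', hph, ?_⟩
  intro a
  by_cases ha : a ∈ X
  · have h1 : a ∉ S.Orb v := by rw [hOv]; exact fun h => h ha
    have h2 : S.σ a ∉ S.Orb v := by rw [hOv]; exact fun h => h ((hX a).1 ha)
    exact S.gd_congr (hGX a ha) (hoff2 _ h1).1 (hoff2 _ h2).1 (hoff2 _ h1).2 (hoff2 _ h2).2 rfl rfl rfl rfl
  · exact hon2 a (by rw [hOv]; exact ha)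

theorem core [Fintype V] [Nonempty V] (hconn : S.Cn Set.univ)
    (hfix : ∀ u w, S.σ u = u → S.σ w = w → u = w) :
    ∃ f g h : V → ℕ, S.PH h ∧ ∀ a, S.σ a ≠ a → S.Gd (sg h) f g a := by
  by_cases hl : ∃ l, S.σ l = l
  · obtain ⟨l, hl⟩ := hl
    obtain ⟨h0, hh0⟩ := S.exists_ph
    obtain ⟨f, g, h, hh, hgd, -⟩ := S.nonroot Set.univ (fun a => by simp) hconn h0 hh0 _ {l} rfl
      (Set.subset_univ _) ⟨l, rfl⟩ (fun a => by
        simp only [Set.mem_singleton_iff]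
        constructor
        · rintro rfl; exact hl
        · intro h; exact S.σ.injective (h.trans hl.symm)) (by
        intro a ha h
        exact ha.2 (hfix a l h hl))
    exact ⟨f, g, h, hh, fun a ha => hgd a ⟨trivial, fun h => ha (by
      rw [Set.mem_singleton_iff] at h; rw [h]; exact hl)⟩⟩
  push Not at hl
  obtain ⟨v⟩ := (inferInstance : Nonempty V)
  by_cases hO : S.Orb v = Set.univ
  · obtain ⟨f, g, h, hh, hgd⟩ := S.hamil v (hl v) hO
    exact ⟨f, g, h, hh, fun a _ => hgd a⟩
  obtain ⟨X, hXmax⟩ := Set.Finite.exists_maximal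
    (Set.toFinite {X : Set V | X.Nonempty ∧ S.Cl X ∧ S.Cn X ∧ X ≠ Set.univ})
    ⟨S.Orb v, ⟨v, S.orb_self v⟩, S.orb_cl v, S.orb_cn v, hO⟩
  obtain ⟨⟨hXne, hXcl, hXcn, hXu⟩, hmax⟩ := hXmax
  obtain ⟨a, haX, ha'⟩ : ∃ a ∈ X, S.μ a ∉ X := by
    by_contra hcon
    push Not at hcon
    exact hXu (hconn X (Set.subset_univ _) hXne hXcl (fun a ha _ => hcon a ha))
  have hXc : S.Cl Xᶜ := fun c => not_congr (hXcl c)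
  have hDX : S.Orb (S.μ a) ⊆ Xᶜ := S.cl_orb hXc ha'
  have hcl : S.Cl (X ∪ S.Orb (S.μ a)) := by
    intro c
    simp only [Set.mem_union]
    rw [hXcl c, S.orb_cl (S.μ a) c]
  have hcn : S.Cn (X ∪ S.Orb (S.μ a)) := by
    intro Y hY hYne hYcl hYm
    have hYX : S.Cl (Y ∩ X) := by
      intro c
      simp only [Set.mem_inter_iff]
      rw [hXcl c, hYcl c]
    have haY : a ∈ Y → Y = X ∪ S.Orb (S.μ a) := by
      intro haY
      have h1 : Y ∩ X = X := hXcn _ Set.inter_subset_right ⟨a, haY, haX⟩ hYX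
        (fun c hc hcX => ⟨hYm c hc.1 (Or.inl hcX), hcX⟩)
      have h2 : S.μ a ∈ Y := hYm a haY (Or.inr (S.orb_self _))
      apply hY.antisymm
      exact Set.union_subset (Set.inter_eq_right.1 h1) (S.cl_orb hYcl h2)
    apply haY
    by_cases hi : (Y ∩ X).Nonempty
    · have h1 : Y ∩ X = X := hXcn _ Set.inter_subset_right hi hYX
        (fun c hc hcX => ⟨hYm c hc.1 (Or.inl hcX), hcX⟩)
      exact Set.inter_eq_right.1 h1 haX
    · obtain ⟨c, hc⟩ := hYne
      have hcD : c ∈ S.Orb (S.μ a) := by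
        rcases hY hc with h | h
        · exact absurd ⟨c, hc, h⟩ hi
        · exact h
      have h2 : S.μ a ∈ Y := S.cl_orb hYcl hc hcD.symm
      have := hYm _ h2 (by rw [S.mm]; exact Or.inl haX)
      rwa [S.mm] at this
  have huniv : X ∪ S.Orb (S.μ a) = Set.univ := by
    by_contra hne
    have := hmax ⟨hXne.mono Set.subset_union_left, hcl, hcn, hne⟩ Set.subset_union_left
    exact ha' (this (Or.inr (S.orb_self _)))
  have hD : S.Orb (S.μ a) = Xᶜ := by
    apply hDX.antisymm
    intro c hc
    have : c ∈ X ∪ S.Orb (S.μ a) := by rw [huniv]; trivial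
    exact this.resolve_left hc
  obtain ⟨f, g, h, hh, hgd⟩ := S.multi hl X hXne hXcl hXcn a haX hD
  exact ⟨f, g, h, hh, fun a _ => hgd a⟩

end CSys

lemma cyc_orient {V : Type*} [DecidableEq V] {K : SimpleGraph V} {r : V} (p : K.Walk r r)
    (hp : p.IsCycle) (a : V) (ha : a ∈ p.support) :
    K.Adj a (p.support.tail.formPerm a) ∧ p.support.tail.formPerm a ∈ p.support ∧
      p.support.tail.formPerm (p.support.tail.formPerm a) ≠ a := by
  have hnd : p.support.tail.Nodup := hp.support_nodup
  have hlen : p.support.tail.length = p.length := by simp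
  have h3 : 3 ≤ p.length := hp.three_le_length
  have hget : ∀ i (hi : i < p.support.tail.length), p.support.tail[i] = p.getVert (i+1) := by
    intro i hi
    rw [List.getElem_tail, SimpleGraph.Walk.support_getElem_eq_getVert]
  have ha' : a ∈ p.support.tail := by
    rw [SimpleGraph.Walk.mem_support_iff] at ha
    rcases ha with rfl | h
    · exact SimpleGraph.Walk.end_mem_tail_support (by intro h; exact hp.not_nil h)
    · exact h
  obtain ⟨i, hi, rfl⟩ := List.getElem_of_mem ha'
  have e1 := List.formPerm_apply_getElem _ hnd i hi
  refine ⟨?_, ?_, ?_⟩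
  · rw [e1, hget, hget]
    rw [hlen] at *
    by_cases h : i + 1 < p.length
    · rw [Nat.mod_eq_of_lt h]
      exact p.adj_getVert_succ h
    · have : i + 1 = p.length := by omega
      rw [this, Nat.mod_self, SimpleGraph.Walk.getVert_length]
      have := p.adj_getVert_succ (i := 0) (by omega)
      simpa using this
  · rw [e1]
    exact List.mem_of_mem_tail (List.getElem_mem _)
  · rw [e1, List.formPerm_apply_getElem _ hnd]
    intro h
    rw [List.Nodup.getElem_inj_iff hnd] at h
    rw [hlen] at *
    by_cases h1 : i + 1 < p.length
    · rw [Nat.mod_eq_of_lt h1] at h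
      by_cases h2 : i + 1 + 1 < p.length
      · rw [Nat.mod_eq_of_lt h2] at h; omega
      · have : i + 1 + 1 = p.length := by omega
        rw [this, Nat.mod_self] at h; omega
    · have : i + 1 = p.length := by omega
      rw [this, Nat.mod_self, Nat.mod_eq_of_lt (by omega)] at h; omega

lemma orient {V : Type*} [Finite V] (K : SimpleGraph V) (hK : K.IsCycles) :
    ∃ σ : Equiv.Perm V, (∀ a b, K.Adj a b ↔ (σ a ≠ a ∧ (b = σ a ∨ b = σ.symm a))) ∧
      ∀ a, σ a ≠ a → σ (σ a) ≠ a := by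
  classical
  have h1 : ∀ c : K.ConnectedComponent, ∃ τ : Equiv.Perm V, ∀ a ∈ c.supp, (K.neighborSet a).Nonempty →
      K.Adj a (τ a) ∧ τ (τ a) ≠ a := by
    intro c
    by_cases hc : ∃ v ∈ c.supp, (K.neighborSet v).Nonempty
    · obtain ⟨v, hv, hn⟩ := hc
      obtain ⟨p, hp, hpc⟩ := hK.exists_cycle_toSubgraph_verts_eq_connectedComponentSupp hv hn
      refine ⟨p.support.tail.formPerm, fun a ha _ => ?_⟩
      have := cyc_orient p hp a (by
        rw [← SimpleGraph.Walk.mem_verts_toSubgraph, hpc]; exact ha)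
      exact ⟨this.1, this.2.2⟩
    · exact ⟨1, fun a ha h => absurd ⟨a, ha, h⟩ hc⟩
  choose τ hτ using h1
  let s : V → V := fun a => if (K.neighborSet a).Nonempty then τ (K.connectedComponentMk a) a else a
  have hsn : ∀ a, (K.neighborSet a).Nonempty → s a = τ (K.connectedComponentMk a) a := by
    intro a ha; simp only [s, if_pos ha]
  have hsi : ∀ a, ¬ (K.neighborSet a).Nonempty → s a = a := by
    intro a ha; simp only [s, if_neg ha]
  have hadj : ∀ a, (K.neighborSet a).Nonempty → K.Adj a (s a) := by
    intro a ha
    rw [hsn a ha]; exact (hτ _ a rfl ha).1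
  have hcomp : ∀ a, K.connectedComponentMk (s a) = K.connectedComponentMk a := by
    intro a
    by_cases ha : (K.neighborSet a).Nonempty
    · exact SimpleGraph.ConnectedComponent.sound (hadj a ha).symm.reachable
    · rw [hsi a ha]
  have hne : ∀ a, (K.neighborSet a).Nonempty → (K.neighborSet (s a)).Nonempty := fun a ha =>
    ⟨a, (hadj a ha).symm⟩
  have hss : ∀ a, (K.neighborSet a).Nonempty → s (s a) ≠ a := by
    intro a ha
    rw [hsn _ (hne a ha), hcomp, hsn a ha]
    exact (hτ _ a rfl ha).2
  have hinj : Function.Injective s := by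
    intro a b hab
    have hc : K.connectedComponentMk a = K.connectedComponentMk b := by
      rw [← hcomp a, hab, hcomp]
    by_cases ha : (K.neighborSet a).Nonempty
    · have hb : (K.neighborSet b).Nonempty := by
        by_contra hb
        rw [hsi b hb] at hab
        exact hb (hab ▸ hne a ha)
      rw [hsn a ha, hsn b hb, hc] at hab
      exact (τ _).injective hab
    · have hb : ¬ (K.neighborSet b).Nonempty := by
        intro hb
        rw [hsi a ha] at hab
        exact ha (hab ▸ hne b hb)
      rwa [hsi a ha, hsi b hb] at hab
  let σ : Equiv.Perm V := Equiv.ofBijective s (Finite.injective_iff_bijective.1 hinj)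
  have hσ : ∀ a, σ a = s a := fun a => rfl
  have hfx : ∀ a, σ a ≠ a ↔ (K.neighborSet a).Nonempty := by
    intro a
    constructor
    · intro h; by_contra hn; exact h (hsi a hn)
    · intro h; exact (hadj a h).ne'
  refine ⟨σ, ?_, fun a ha => hss a ((hfx a).1 ha)⟩
  have hside : ∀ a, σ a ≠ a → K.Adj a (σ a) ∧ K.Adj a (σ.symm a) := by
    intro a ha
    refine ⟨hadj a ((hfx a).1 ha), ?_⟩
    have hb : σ (σ.symm a) ≠ σ.symm a := by
      intro h; rw [Equiv.apply_symm_apply] at h; apply ha; nth_rw 1 [h]; simp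
    have := hadj _ ((hfx _).1 hb)
    rw [← hσ, Equiv.apply_symm_apply] at this
    exact this.symm
  intro a b
  constructor
  · intro hab
    have hn : (K.neighborSet a).Nonempty := ⟨b, hab⟩
    have ha := (hfx a).2 hn
    refine ⟨ha, ?_⟩
    have h2 := hK hn
    have hd : σ a ≠ σ.symm a := by
      intro h
      have : σ (σ a) = a := by rw [h, Equiv.apply_symm_apply]
      exact hss a hn this
    have hsub : ({σ a, σ.symm a} : Set V) ⊆ K.neighborSet a := by
      rintro x (rfl | rfl)
      exacts [(hside a ha).1, (hside a ha).2]
    have := Set.eq_of_subset_of_ncard_le hsub (by rw [h2, Set.ncard_pair hd]) (Set.toFinite _)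
    have hb : b ∈ K.neighborSet a := hab
    rw [← this] at hb
    exact hb
  · rintro ⟨ha, rfl | rfl⟩
    exacts [(hside a ha).1, (hside a ha).2]

lemma ext_mu {V : Type*} (G : SimpleGraph V) (E₁ : Set (Sym2 V))
    (h1 : ∀ v : V, {e | e ∈ E₁ ∧ v ∈ e}.ncard = 1) (a : V) :
    ∃ b, s(a, b) ∈ E₁ ∧ ∀ c, s(a, c) ∈ E₁ → c = b := by
  obtain ⟨e, he⟩ := Set.ncard_eq_one.1 (h1 a)
  have h : e ∈ {e | e ∈ E₁ ∧ a ∈ e} := by rw [he]; rfl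
  obtain ⟨h2, b, rfl⟩ := h
  refine ⟨b, h2, fun c hc => ?_⟩
  have : s(a, c) ∈ {e | e ∈ E₁ ∧ a ∈ e} := ⟨hc, Sym2.mem_mk_left _ _⟩
  rw [he] at this
  exact Sym2.congr_right.1 this

lemma e2_cycles {V : Type*} (E₂ : Set (Sym2 V)) (hnd : ∀ a b, s(a, b) ∈ E₂ → a ≠ b)
    (h2 : ∀ v : V, {e | e ∈ E₂ ∧ v ∈ e}.ncard = 0 ∨ {e | e ∈ E₂ ∧ v ∈ e}.ncard = 2) [Finite V] :
    (SimpleGraph.fromEdgeSet E₂).IsCycles := by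
  intro v hv
  have himg : {e | e ∈ E₂ ∧ v ∈ e} = (fun b => s(v, b)) '' ((SimpleGraph.fromEdgeSet E₂).neighborSet v) := by
    ext e
    constructor
    · rintro ⟨he, b, rfl⟩
      exact ⟨b, (SimpleGraph.fromEdgeSet_adj _).2 ⟨he, hnd _ _ he⟩, rfl⟩
    · rintro ⟨b, hb, rfl⟩
      exact ⟨((SimpleGraph.fromEdgeSet_adj _).1 hb).1, Sym2.mem_mk_left _ _⟩
  have hc : {e | e ∈ E₂ ∧ v ∈ e}.ncard = ((SimpleGraph.fromEdgeSet E₂).neighborSet v).ncard := by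
    rw [himg]
    exact Set.ncard_image_of_injective _ (fun x y h => Sym2.congr_right.1 h)
  have hpos := (Set.ncard_pos (Set.toFinite _)).2 hv
  rcases h2 v with h | h <;> omega

lemma sys_color {V : Type*} (G : SimpleGraph V) (L : V × Sym2 V → Finset ℕ) (S : CSys V)
    (hadj : ∀ a b, G.Adj a b ↔ b = S.μ a ∨ (S.σ a ≠ a ∧ (b = S.σ a ∨ b = S.σ.symm a)))
    (hF : ∀ a, S.F a = L (a, s(a, S.σ a))) (hG : ∀ a, S.G a = L (S.σ a, s(a, S.σ a)))
    (hH : ∀ a, S.H a = L (a, s(a, S.μ a)))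
    (f g h : V → ℕ) (hp : S.PH h) (hgd : ∀ a, S.σ a ≠ a → S.Gd (CSys.sg h) f g a) :
    ∃ φ, IsIncListColoring G L φ := by
  classical
  let ψ : V → V → ℕ := fun a b => if b = S.μ a then h a else if b = S.σ a then f a else g b
  have hval : ∀ a b, G.Adj a b → (b = S.μ a ∧ ψ a b = h a) ∨
      (S.σ a ≠ a ∧ b = S.σ a ∧ ψ a b = f a) ∨ (S.σ b ≠ b ∧ a = S.σ b ∧ ψ a b = g b) := by
    intro a b hab
    rw [hadj] at hab
    rcases hab with hb | ⟨ha, hb | hb⟩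
    · left; exact ⟨hb, by simp [ψ, hb]⟩
    · right; left
      refine ⟨ha, hb, ?_⟩
      have : S.σ a ≠ S.μ a := (S.ms a).symm
      simp [ψ, hb, this]
    · right; right
      have hab : a = S.σ b := by rw [hb, Equiv.apply_symm_apply]
      have hbn : S.σ b ≠ b := by
        intro h; apply ha; rw [hab, h, h]
      refine ⟨hbn, hab, ?_⟩
      have n1 : b ≠ S.μ a := by
        intro h; apply S.ms' a; rw [← h, hab]
      have n2 : b ≠ S.σ a := by
        intro h; apply S.s2 b hbn; rw [← hab, ← h]
      simp [ψ, n1, n2]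
  have gd : ∀ c, S.σ c ≠ c → (f c ∈ S.F c ∧ f c ≠ h c ∧ f c ≠ h (S.μ c) ∧ f c ≠ h (S.σ c)) ∧
      (g c ∈ S.G c ∧ g c ≠ h (S.σ c) ∧ g c ≠ h (S.μ (S.σ c)) ∧ g c ≠ h c) ∧
      f c ≠ g c ∧ f c ≠ f (S.σ c) ∧ g c ≠ f (S.σ c) ∧ g c ≠ g (S.σ c) := by
    intro c hc
    have := hgd c hc
    simp only [CSys.Gd, CSys.sg, Finset.mem_sdiff, Finset.mem_union, Finset.mem_singleton, not_or] at this
    tauto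
  have key1 : ∀ a b d, G.Adj a b → G.Adj a d → b ≠ d → ψ a b ≠ ψ a d := by
    intro a b d hab had hbd
    rcases hval a b hab with ⟨e, v⟩ | ⟨n, e, v⟩ | ⟨n, e, v⟩ <;>
    rcases hval a d had with ⟨e', v'⟩ | ⟨n', e', v'⟩ | ⟨n', e', v'⟩ <;> rw [v, v']
    · exact absurd (e.trans e'.symm) hbd
    · exact (gd a n').1.2.1.symm
    · have := (gd d n').2.1.2.1; rw [← e'] at this; exact this.symm
    · exact (gd a n).1.2.1
    · exact absurd (e.trans e'.symm) hbd
    · have := (gd d n').2.2.2.2.1; rw [← e'] at this; exact this.symm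
    · have := (gd b n).2.1.2.1; rw [← e] at this; exact this
    · have := (gd b n).2.2.2.2.1; rw [← e] at this; exact this
    · exact absurd (S.σ.injective (e.symm.trans e')) hbd
  have key2 : ∀ a b d, G.Adj a b → G.Adj b d → ψ a b ≠ ψ b d := by
    intro a b d hab hbd
    rcases hval a b hab with ⟨e, v⟩ | ⟨n, e, v⟩ | ⟨n, e, v⟩ <;>
    rcases hval b d hbd with ⟨e', v'⟩ | ⟨n', e', v'⟩ | ⟨n', e', v'⟩ <;> rw [v, v']
    · rw [e]; exact (hp a).2
    · have := (gd b n').1.2.2.1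
      rw [e, S.mm] at this; rw [e]; exact this.symm
    · have := (gd d n').2.1.2.2.1
      rw [← e', e, S.mm] at this; exact this.symm
    · rw [e]; exact (gd a n).1.2.2.2
    · rw [e]; exact (gd a n).2.2.2.1
    · have : d = a := S.σ.injective (by rw [← e', e])
      rw [this]; exact (gd a n).2.2.1
    · exact (gd b n).2.1.2.2.2
    · exact (gd b n).2.2.1.symm
    · have := (gd d n').2.2.2.2.2; rw [← e'] at this; exact this.symm
  let φ : V × Sym2 V → ℕ := fun p => if hv : p.1 ∈ p.2 then ψ p.1 (Sym2.Mem.other hv) else 0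
  have hφ : ∀ a b, φ (a, s(a, b)) = ψ a b := by
    intro a b
    have hm : a ∈ s(a, b) := Sym2.mem_mk_left _ _
    have h1 : Sym2.Mem.other hm = b := Sym2.congr_right.1 (Sym2.other_spec hm)
    simp only [φ]
    rw [dif_pos hm, h1]
  refine ⟨φ, ?_, ?_⟩
  · rintro a e ⟨he, b, rfl⟩
    have hab : G.Adj a b := he
    rw [hφ]
    rcases hval a b hab with ⟨e, v⟩ | ⟨n, e, v⟩ | ⟨n, e, v⟩ <;> rw [v]
    · rw [e, ← hH]; exact (hp a).1
    · rw [e, ← hF]; exact (gd a n).1.1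
    · rw [Sym2.eq_swap, e, ← hG]; exact (gd b n).2.1.1
  · rintro a e c e' ⟨he, b, rfl⟩ ⟨he', d, rfl⟩ hne hinc
    have hab : G.Adj a b := he
    have hcd : G.Adj c d := he'
    rw [hφ, hφ]
    have hcase : a = c ∨ b = c ∨ d = a := by
      rcases hinc with h | h | h | h
      · exact Or.inl h
      · rw [Sym2.eq_iff] at h
        rcases h with h | h
        · exact Or.inl h.1
        · exact Or.inr (Or.inl h.2)
      · exact Or.inr (Or.inl (Sym2.congr_right.1 h).symm)
      · rw [Sym2.eq_swap] at h
        exact Or.inr (Or.inr (Sym2.congr_right.1 h).symm)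
    rcases hcase with rfl | rfl | rfl
    · exact key1 a b d hab hcd (fun h => hne (by rw [h]))
    · exact key2 _ _ _ hab hcd
    · exact (key2 _ _ _ hcd hab).symm

/-- Let `G` be a connected almost cubic simple graph (all vertices have degree 3 except at
most one) admitting a (1,2)-decomposition, and let `L` be an incidence 6-list assignment of
`G`. Then `G` is incidence `L`-choosable. -/
theorem incidence_L_choosable_of_almost_cubic {V : Type*} [Fintype V] (G : SimpleGraph V)
    (hconn : G.Connected)
    (halmost : ∀ u w : V, vdeg G u ≠ 3 → vdeg G w ≠ 3 → u = w)
    (hdecomp : ∃ E₁ E₂ : Set (Sym2 V), IsOneTwoDecomposition G E₁ E₂)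
    (L : V × Sym2 V → Finset ℕ)
    (hL : ∀ v e, IsIncidence G v e → (L (v, e)).card = 6) :
    ∃ φ, IsIncListColoring G L φ := by
  obtain ⟨E₁, E₂, hU, hdis, h1, h2⟩ := hdecomp
  have hE : ∀ a b, G.Adj a b ↔ s(a, b) ∈ E₁ ∨ s(a, b) ∈ E₂ := by
    intro a b
    rw [← SimpleGraph.mem_edgeSet, ← hU, Set.mem_union]
  choose μ hμ hμ' using ext_mu G E₁ h1
  obtain ⟨σ, hσ, hs2⟩ := orient _ (e2_cycles E₂ (fun a b h => ((hE a b).2 (Or.inr h)).ne) h2)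
  have hσ' : ∀ a b, s(a, b) ∈ E₂ ↔ (σ a ≠ a ∧ (b = σ a ∨ b = σ.symm a)) := by
    intro a b
    rw [← hσ, SimpleGraph.fromEdgeSet_adj]
    exact ⟨fun h => ⟨h, ((hE a b).2 (Or.inr h)).ne⟩, fun h => h.1⟩
  have hμ1 : ∀ a b, s(a, b) ∈ E₁ ↔ b = μ a := by
    intro a b
    exact ⟨hμ' a b, fun h => h ▸ hμ a⟩
  have hmne : ∀ a, μ a ≠ a := fun a => ((hE a _).2 (Or.inl (hμ a))).ne'
  have hsE : ∀ a, σ a ≠ a → s(a, σ a) ∈ E₂ := fun a ha => (hσ' a _).2 ⟨ha, Or.inl rfl⟩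
  let S : CSys V :=
    { σ := σ
      μ := μ
      F := fun a => L (a, s(a, σ a))
      G := fun a => L (σ a, s(a, σ a))
      H := fun a => L (a, s(a, μ a))
      mm := fun a => ((hμ1 (μ a) a).1 (by rw [Sym2.eq_swap]; exact hμ a)).symm
      mne := hmne
      ms := by
        intro a h
        by_cases ha : σ a = a
        · exact hmne a (h.trans ha)
        · exact Set.disjoint_left.1 hdis (hμ a) (by rw [h]; exact hsE a ha)
      s2 := hs2
      hF := fun a ha => hL _ _ ⟨(hE _ _).2 (Or.inr (hsE a ha)), Sym2.mem_mk_left _ _⟩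
      hG := fun a ha => hL _ _ ⟨(hE _ _).2 (Or.inr (hsE a ha)), Sym2.mem_mk_right _ _⟩
      hH := fun a => hL _ _ ⟨(hE _ _).2 (Or.inl (hμ a)), Sym2.mem_mk_left _ _⟩ }
  have hadj : ∀ a b, G.Adj a b ↔ b = μ a ∨ (σ a ≠ a ∧ (b = σ a ∨ b = σ.symm a)) := by
    intro a b
    rw [hE, hμ1, hσ']
  haveI : Nonempty V := hconn.nonempty
  have hC : S.Cn Set.univ := by
    intro Y _ hYne hcl hm
    have hback : ∀ c ∈ Y, σ.symm c ∈ Y := by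
      intro c hc
      apply (hcl _).2
      have h : S.σ (σ.symm c) = c := Equiv.apply_symm_apply σ c
      rw [h]; exact hc
    obtain ⟨a, ha⟩ := hYne
    apply Set.eq_univ_of_forall
    intro x
    obtain ⟨p⟩ := hconn.preconnected a x
    induction p with
    | nil => exact ha
    | cons hab _ ih =>
      apply ih
      rcases (hadj _ _).1 hab with h | ⟨-, h | h⟩
      · rw [h]; exact hm _ ha trivial
      · rw [h]; exact (hcl _).1 ha
      · rw [h]; exact hback _ ha
  have hd : ∀ u, σ u = u → vdeg G u ≠ 3 := by
    intro u hu h3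
    have hsub : G.neighborSet u ⊆ {μ u} := by
      intro b hb
      rcases (hadj u b).1 hb with h | h
      · exact h
      · exact absurd hu h.1
    have := Set.ncard_le_ncard hsub (Set.toFinite _)
    rw [Set.ncard_singleton] at this
    unfold vdeg at h3
    omega
  obtain ⟨f, g, h, hp, hgd⟩ := S.core hC (fun u w hu hw => halmost u w (hd u hu) (hd w hw))
  exact sys_color G L S hadj (fun _ => rfl) (fun _ => rfl) (fun _ => rfl) f g h hp hgd
end
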